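/- Theorem 1 (inner bound via secure transmission of the key). Let t ∈ P(Y|X) and q ∈ P(Z|X) be channels over finite alphabets X, Y, Z, and let j ≥ 1 be the number of rounds. Suppose there exist finite sets U and W and distributions ρ ∈ P(X|U), σ ∈ P(U ≫ W), τ ∈ P(W) such that the nonnegative reals (r, α, κ) satisfy: r + α ≤ I(tρ, στ); α ≤ L(t,q|ρ,σ,τ); α ≤ I(tρ, σ|τ); and α ≤ jκ. Then (r, α, κ) belongs to the average authentication capacity region C_{AA(j)}(t,q). -/

import Mathlib

/-!
Secret key authentication capacity region (average authentication metric):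
Theorem 2 (universal composition with Simmons' scheme).
-/

open scoped BigOperators

noncomputable section

namespace AuthAvg

/-- `t` is a (row-stochastic) channel from `A` to `B`. -/
def IsChannel {A B : Type*} [Fintype B] (t : A → B → ℝ) : Prop :=
  (∀ a b, 0 ≤ t a b) ∧ ∀ a, ∑ b, t a b = 1

/-- `τ` is a probability distribution on the finite set `A`. -/
def IsDist {A : Type*} [Fintype A] (τ : A → ℝ) : Prop :=
  (∀ a, 0 ≤ τ a) ∧ ∑ a, τ a = 1

/-- The memoryless `n`-fold extension of a channel:
`t^n(y|x) = ∏ ℓ, t (x ℓ) (y ℓ)`. -/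
def nfold {A B : Type*} (t : A → B → ℝ) (n : ℕ) (x : Fin n → A) (y : Fin n → B) : ℝ :=
  ∏ ℓ, t (x ℓ) (y ℓ)

variable {X Y Z : Type*} [Fintype X] [Fintype Y] [Fintype Z]

/-- Probability of message error of a single round: the message and the key are
uniform, the channel input is generated by the encoder `f`, the output passes
through the (non-attacked) channel `t^n`, and the decoder `φ` must reproduce
the message. -/
def roundError {n M K : ℕ} (t : X → Y → ℝ)
    (f : Fin M × Fin K → (Fin n → X) → ℝ)
    (φ : (Fin n → Y) × Fin K → Option (Fin M) → ℝ) : ℝ :=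
  1 - (1 / ((M : ℝ) * (K : ℝ))) *
      ∑ m : Fin M, ∑ k : Fin K, ∑ x : Fin n → X, ∑ y : Fin n → Y,
        φ (y, k) (some m) * nfold t n x y * f (m, k) x

/-- The joint probability that the adversary observes `z = (z_0, …, z_i)` over the
channel `q^n` in rounds `0, …, i`, that the round-`i` message equals `m`, and
that the key equals `k`. -/
def advDist {n M K j : ℕ} (q : X → Z → ℝ)
    (f : Fin j → Fin M × Fin K → (Fin n → X) → ℝ) (i : Fin j)
    (z : Fin (i.1 + 1) → Fin n → Z) (m : Fin M) (k : Fin K) : ℝ :=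
  (1 / ((M : ℝ) ^ (i.1 + 1) * (K : ℝ))) *
    (∑ x : Fin n → X, nfold q n x (z (Fin.last i.1)) * f i (m, k) x) *
    ∏ ℓ : Fin i.1, ∑ m' : Fin M, ∑ x : Fin n → X,
      nfold q n x (z ℓ.castSucc) * f ⟨ℓ.1, ℓ.2.trans i.2⟩ (m', k) x

/-- The expected probability that the adversary's substitution attack `ψ` in
round `i` makes the decoder output some message different from the one sent. -/
def attackProb {n M K j : ℕ} (q : X → Z → ℝ)
    (f : Fin j → Fin M × Fin K → (Fin n → X) → ℝ)
    (φ : Fin j → (Fin n → Y) × Fin K → Option (Fin M) → ℝ) (i : Fin j)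
    (ψ : (Fin (i.1 + 1) → Fin n → Z) → (Fin n → Y) → ℝ) : ℝ :=
  ∑ z : Fin (i.1 + 1) → Fin n → Z, ∑ m : Fin M, ∑ k : Fin K,
    advDist q f i z m k *
      ∑ y : Fin n → Y, ψ z y * ∑ m' ∈ Finset.univ.erase m, φ i (y, k) (some m')

/-- `(r, α, κ, ε, j, n)`-average-authentication code for the DM-AIC `(t, q)`:
blocklength `n`, message rate at least `r`, key consumption rate at most `κ`,
probability of message error (minimized over the rounds) less than `ε`, and
authentication rate at least `α` (that is, for every round and every attack
channel the expected probability of false authentication is at most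
`2^(-n·α)`). -/
def IsAACode (t : X → Y → ℝ) (q : X → Z → ℝ) (r α κ ε : ℝ) (j n : ℕ) : Prop :=
  ∃ (M K : ℕ) (f : Fin j → Fin M × Fin K → (Fin n → X) → ℝ)
      (φ : Fin j → (Fin n → Y) × Fin K → Option (Fin M) → ℝ),
    0 < M ∧ 0 < K ∧
    (∀ i, IsChannel (f i)) ∧ (∀ i, IsChannel (φ i)) ∧
    (2 : ℝ) ^ ((n : ℝ) * r) ≤ (M : ℝ) ∧
    (K : ℝ) ≤ (2 : ℝ) ^ ((n : ℝ) * (j : ℝ) * κ) ∧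
    (∃ i : Fin j, roundError t (f i) (φ i) < ε) ∧
    (∀ (i : Fin j) (ψ : (Fin (i.1 + 1) → Fin n → Z) → (Fin n → Y) → ℝ),
      IsChannel ψ → attackProb q f φ i ψ ≤ (2 : ℝ) ^ (-(n : ℝ) * α))

/-- Membership of `(a, b, c)` in the average authentication capacity region
`C_{AA(j)}(t, q)`: there is a sequence of `(r_n, α_n, κ_n, ε_n, j, n)`-AA codes
with `(r_n, α_n, κ_n, ε_n) → (a, b, c, 0)`. -/
def InCapRegion (t : X → Y → ℝ) (q : X → Z → ℝ) (j : ℕ) (a b c : ℝ) : Prop :=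
  ∃ r α κ ε : ℕ → ℝ,
    (∀ n : ℕ, IsAACode t q (r n) (α n) (κ n) (ε n) j n) ∧
    Filter.Tendsto (fun n => (r n, α n, κ n, ε n)) Filter.atTop
      (nhds (a, b, c, 0))

/-! ### Information measures -/

/-- Composition of a channel `μ : U → Y` with an input channel `σ : W → U`:
`(μσ)(y|w) = ∑ u, σ(u|w) μ(y|u)`. -/
def comp {U W Y : Type*} [Fintype U] (μ : U → Y → ℝ) (σ : W → U → ℝ) :
    W → Y → ℝ :=
  fun w y => ∑ u, σ w u * μ u y

/-- Output distribution of `σ : W → U` under the input distribution `τ`: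
`(στ)(u) = ∑ w, σ(u|w) τ(w)`. -/
def marg {U W : Type*} [Fintype W] (σ : W → U → ℝ) (τ : W → ℝ) : U → ℝ :=
  fun u => ∑ w, τ w * σ w u

/-- Mutual information `I(μ, π)` of the channel `μ : U → Y` with input
distribution `π`. -/
def mutInfo {U Y : Type*} [Fintype U] [Fintype Y]
    (μ : U → Y → ℝ) (π : U → ℝ) : ℝ :=
  ∑ u, ∑ y, π u * μ u y * Real.logb 2 (μ u y / ∑ u', π u' * μ u' y)

/-- Conditional mutual information `I(μ, σ | τ)`. -/
def condMutInfo {U W Y : Type*} [Fintype U] [Fintype W] [Fintype Y]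
    (μ : U → Y → ℝ) (σ : W → U → ℝ) (τ : W → ℝ) : ℝ :=
  ∑ w, ∑ u, ∑ y, τ w * σ w u * μ u y * Real.logb 2 (μ u y / comp μ σ w y)

/-- `σ ∈ P(U ≫ W)`: for every `u` there is at most one `w` with `σ(u|w) > 0`. -/
def Deterministic {U W : Type*} (σ : W → U → ℝ) : Prop :=
  ∀ u w w', 0 < σ w u → 0 < σ w' u → w = w'

/-- `F(ν‖q, ρ|σ) = min_{ζ : Σ_x ζ(z|x,u)ρ(x|u) = ν(z|u)} D(ζ‖q | ρ×σ)`. -/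
def Fdiv {U X Z : Type*} [Fintype U] [Fintype X] [Fintype Z]
    (ν : U → Z → ℝ) (q : X → Z → ℝ) (ρ : U → X → ℝ) (σ : U → ℝ) : ℝ :=
  sInf { d | ∃ ζ : U × X → Z → ℝ, IsChannel ζ ∧
    (∀ u z, ∑ x, ρ u x * ζ (u, x) z = ν u z) ∧
    d = ∑ u, ∑ x, ∑ z,
          σ u * ρ u x * ζ (u, x) z * Real.logb 2 (ζ (u, x) z / q x z) }

/-- `S(μ, ν | σ, τ) = I(μ,σ|τ) − I(ν,σ|τ) + |I(μσ,τ) − I(νσ,τ)|⁺`. -/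
def Sfun {U W Y Z : Type*} [Fintype U] [Fintype W] [Fintype Y] [Fintype Z]
    (μ : U → Y → ℝ) (ν : U → Z → ℝ) (σ : W → U → ℝ) (τ : W → ℝ) : ℝ :=
  condMutInfo μ σ τ - condMutInfo ν σ τ +
    max (mutInfo (comp μ σ) τ - mutInfo (comp ν σ) τ) 0

/-- `L(t, q | ρ, σ, τ) = min_{ν ∈ P(Z|U)} F(ν‖q,ρ|στ) + |S(tρ, ν|σ,τ)|⁺`. -/
def Lfun {X Y Z U W : Type*} [Fintype X] [Fintype Y] [Fintype Z] [Fintype U]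
    [Fintype W] (t : X → Y → ℝ) (q : X → Z → ℝ)
    (ρ : U → X → ℝ) (σ : W → U → ℝ) (τ : W → ℝ) : ℝ :=
  sInf { d | ∃ ν : U → Z → ℝ, IsChannel ν ∧
    d = Fdiv ν q ρ (marg σ τ) + max (Sfun (comp t ρ) ν σ τ) 0 }


set_option linter.unusedSectionVars false

/-! ### Finite product distributions -/

section Prob

lemma sum_prod_pi {ι A : Type*} [Fintype ι] [DecidableEq ι] [Fintype A] (p : ι → A → ℝ) :
    ∑ f : ι → A, ∏ i, p i (f i) = ∏ i, ∑ a, p i a := by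
  rw [Finset.prod_univ_sum, Fintype.piFinset_univ]

lemma marg1 {ι A : Type*} [Fintype ι] [DecidableEq ι] [Fintype A] (p : ι → A → ℝ)
    (hp : ∀ i, ∑ a, p i a = 1) (i : ι) (F : A → ℝ) :
    ∑ f : ι → A, (∏ j, p j (f j)) * F (f i) = ∑ a, p i a * F a := by
  have h := sum_prod_pi (fun j a => if j = i then p j a * F a else p j a)
  have h1 : ∀ f : ι → A, ∏ j, (if j = i then p j (f j) * F (f j) else p j (f j))
      = (∏ j, p j (f j)) * F (f i) := by
    intro f
    rw [← Finset.mul_prod_erase Finset.univ _ (Finset.mem_univ i),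
      ← Finset.mul_prod_erase Finset.univ (fun j => p j (f j)) (Finset.mem_univ i)]
    rw [Finset.prod_congr rfl (g := fun j => p j (f j))]
    · simp; ring
    · intro j hj
      simp [Finset.ne_of_mem_erase hj]
  simp only [h1] at h
  rw [h, ← Finset.mul_prod_erase Finset.univ _ (Finset.mem_univ i),
    Finset.prod_eq_one (s := Finset.univ.erase i)]
  · simp
  · intro j hj
    simp [Finset.ne_of_mem_erase hj, hp]

lemma marg2 {ι A : Type*} [Fintype ι] [DecidableEq ι] [Fintype A] (p : ι → A → ℝ)
    (hp : ∀ i, ∑ a, p i a = 1) (i i' : ι) (hi : i ≠ i') (F : A → A → ℝ) :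
    ∑ f : ι → A, (∏ j, p j (f j)) * F (f i) (f i')
      = ∑ a, ∑ b, p i a * p i' b * F a b := by
  classical
  have hF : ∀ a b, ∑ f : ι → A, (∏ j, p j (f j)) *
      ((if f i = a then 1 else 0) * (if f i' = b then 1 else 0)) = p i a * p i' b := by
    intro a b
    have h := sum_prod_pi (fun j c => (p j c * if j = i then (if c = a then 1 else 0) else 1)
      * if j = i' then (if c = b then 1 else 0) else 1)
    simp only [Finset.prod_mul_distrib] at h
    have e1 : ∀ f : ι → A, (∏ j, if j = i then (if f j = a then (1:ℝ) else 0) else 1)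
        = if f i = a then 1 else 0 := by
      intro f; rw [Finset.prod_ite_eq' Finset.univ i]; simp
    have e2 : ∀ f : ι → A, (∏ j, if j = i' then (if f j = b then (1:ℝ) else 0) else 1)
        = if f i' = b then 1 else 0 := by
      intro f; rw [Finset.prod_ite_eq' Finset.univ i']; simp
    simp only [e1, e2] at h
    have h' : ∑ f : ι → A, (∏ j, p j (f j)) *
      ((if f i = a then 1 else 0) * (if f i' = b then 1 else 0)) = ∑ f : ι → A, (∏ j, p j (f j)) *
      ((if f i = a then 1 else 0)) * (if f i' = b then 1 else 0) := by
      simp only [mul_assoc]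
    rw [h', h]
    rw [← Finset.mul_prod_erase Finset.univ _ (Finset.mem_univ i),
      ← Finset.mul_prod_erase (Finset.univ.erase i) _
        (Finset.mem_erase.mpr ⟨hi.symm, Finset.mem_univ i'⟩),
      Finset.prod_eq_one (s := (Finset.univ.erase i).erase i')]
    · simp [hi, hi.symm]
    · intro j hj
      rw [Finset.mem_erase, Finset.mem_erase] at hj
      simp [hj.1, hj.2.1, hp]
  have : ∀ f : ι → A, F (f i) (f i') = ∑ a, ∑ b,
      ((if f i = a then 1 else 0) * (if f i' = b then 1 else 0)) * F a b := by
    intro f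
    simp [Finset.sum_ite_eq]
  calc ∑ f : ι → A, (∏ j, p j (f j)) * F (f i) (f i')
      = ∑ f : ι → A, ∑ a, ∑ b, (∏ j, p j (f j)) *
        ((if f i = a then 1 else 0) * (if f i' = b then 1 else 0)) * F a b := by
        refine Finset.sum_congr rfl fun f _ => ?_
        rw [this f]; simp only [Finset.mul_sum, mul_assoc]
    _ = ∑ a, ∑ b, ∑ f : ι → A, (∏ j, p j (f j)) *
        ((if f i = a then 1 else 0) * (if f i' = b then 1 else 0)) * F a b := by
        rw [Finset.sum_comm]
        refine Finset.sum_congr rfl fun a _ => ?_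
        rw [Finset.sum_comm]
    _ = _ := by
        simp only [← Finset.sum_mul, hF]

lemma exists_le_of_avg {Ω : Type*} [Fintype Ω] (p : Ω → ℝ) (hp : ∀ w, 0 ≤ p w)
    (hp1 : ∑ w, p w = 1) (F G : Ω → ℝ) (hF : ∀ w, 0 ≤ F w) (hG : ∀ w, 0 ≤ G w)
    (e g : ℝ) (he : 0 < e) (hg : 0 < g)
    (h1 : ∑ w, p w * F w ≤ e) (h2 : ∑ w, p w * G w ≤ g) :
    ∃ w, F w ≤ 2 * e ∧ G w ≤ 2 * g := by
  by_contra! hcon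
  have hlt : ∀ w, 2 < F w / e + G w / g := by
    intro w
    have a1 : 0 ≤ F w / e := div_nonneg (hF w) he.le
    have a2 : 0 ≤ G w / g := div_nonneg (hG w) hg.le
    by_cases h : F w ≤ 2 * e
    · have : 2 < G w / g := by rw [lt_div_iff₀ hg]; exact hcon w h
      linarith
    · have : 2 < F w / e := by rw [lt_div_iff₀ he]; linarith
      linarith
  have hs : ∑ w, p w * (F w / e + G w / g) ≤ 2 := by
    have : ∑ w, p w * (F w / e + G w / g) = (∑ w, p w * F w) / e + (∑ w, p w * G w) / g := by
      rw [Finset.sum_div, Finset.sum_div, ← Finset.sum_add_distrib]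
      refine Finset.sum_congr rfl fun w _ => ?_
      ring
    rw [this]
    have := (div_le_one he).2 h1
    have := (div_le_one hg).2 h2
    linarith
  have h2' : ∑ w, p w * 2 = 2 := by rw [← Finset.sum_mul, hp1, one_mul]
  obtain ⟨w0, hw0⟩ : ∃ w, 0 < p w := by
    by_contra! hc
    have : ∑ w, p w ≤ 0 := Finset.sum_nonpos fun w _ => hc w
    linarith
  have : ∑ w, p w * 2 < ∑ w, p w * (F w / e + G w / g) := by
    refine Finset.sum_lt_sum (fun w _ => mul_le_mul_of_nonneg_left (hlt w).le (hp w))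
      ⟨w0, Finset.mem_univ _, mul_lt_mul_of_pos_left (hlt w0) hw0⟩
  linarith

lemma sum_prod_one {S : Type*} [Fintype S] (P : S → ℝ) (hP1 : ∑ s, P s = 1) (n : ℕ) :
    ∑ s : Fin n → S, ∏ l, P (s l) = 1 := by
  have := sum_prod_pi (fun (_ : Fin n) => P)
  rw [this]; simp [hP1]

lemma wlln_var {S : Type*} [Fintype S] (P : S → ℝ) (hP1 : ∑ s, P s = 1)
    (h : S → ℝ) (h0 : ∑ s, P s * h s = 0) (n : ℕ) :
    ∑ s : Fin n → S, (∏ l, P (s l)) * (∑ l, h (s l)) ^ 2 = n * ∑ s, P s * h s ^ 2 := by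
  have key : ∀ s : Fin n → S, (∏ l, P (s l)) * (∑ l, h (s l)) ^ 2
      = ∑ i, ∑ j, (∏ l, P (s l)) * (h (s i) * h (s j)) := by
    intro s
    rw [sq, Finset.sum_mul_sum, Finset.mul_sum]
    simp only [Finset.mul_sum]
  simp only [key]
  rw [Finset.sum_comm]
  have : ∀ i : Fin n, ∑ s : Fin n → S, ∑ j, (∏ l, P (s l)) * (h (s i) * h (s j))
      = ∑ s, P s * h s ^ 2 := by
    intro i
    rw [Finset.sum_comm]
    rw [Finset.sum_eq_single i]
    · rw [marg1 (fun _ => P) (fun _ => hP1) i (fun a => h a * h a)]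
      simp only [sq]
    · intro j _ hj
      rw [marg2 (fun _ => P) (fun _ => hP1) i j hj.symm (fun a b => h a * h b)]
      have : ∀ a b, P a * P b * (h a * h b) = (P a * h a) * (P b * h b) := by intros; ring
      simp only [this, ← Finset.mul_sum, h0, mul_zero, Finset.sum_const_zero]
    · simp
  simp [this]

open Classical in
lemma wlln {S : Type*} [Fintype S] (P : S → ℝ) (hP : ∀ s, 0 ≤ P s) (hP1 : ∑ s, P s = 1)
    (h : S → ℝ) (δ η : ℝ) (hδ : 0 < δ) (hη : 0 < η) :
    ∀ᶠ n : ℕ in Filter.atTop, ∑ s : Fin n → S, (∏ l, P (s l)) *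
      (if (n : ℝ) * δ < |∑ l, h (s l) - n * ∑ s, P s * h s| then 1 else 0) ≤ η := by
  set μ := ∑ s, P s * h s with hμ
  set V := ∑ s, P s * (h s - μ) ^ 2 with hV
  have hV0 : 0 ≤ V := Finset.sum_nonneg fun s _ => mul_nonneg (hP s) (sq_nonneg _)
  have h0 : ∑ s, P s * (h s - μ) = 0 := by
    simp only [mul_sub, Finset.sum_sub_distrib, ← Finset.sum_mul, hP1]
    simp [hμ]
  obtain ⟨N, hN⟩ := exists_nat_gt (V / (δ ^ 2 * η))
  filter_upwards [Filter.eventually_ge_atTop (max N 1)] with n hn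
  have hn1 : 1 ≤ n := le_trans (le_max_right _ _) hn
  have hnN : (N : ℝ) ≤ n := by exact_mod_cast le_trans (le_max_left _ _) hn
  have hnpos : (0 : ℝ) < n := by exact_mod_cast hn1
  have hvar := wlln_var P hP1 (fun s => h s - μ) h0 n
  have hsum : ∀ s : Fin n → S, ∑ l, (h (s l) - μ) = ∑ l, h (s l) - n * μ := by
    intro s; simp [Finset.sum_sub_distrib]
  simp only [hsum] at hvar
  have hb : ∑ s : Fin n → S, (∏ l, P (s l)) *
      (if (n : ℝ) * δ < |∑ l, h (s l) - n * μ| then 1 else 0) ≤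
      ∑ s : Fin n → S, (∏ l, P (s l)) * (∑ l, h (s l) - n * μ) ^ 2 / ((n * δ) ^ 2) := by
    refine Finset.sum_le_sum fun s _ => ?_
    rw [mul_div_assoc]
    refine mul_le_mul_of_nonneg_left ?_ (Finset.prod_nonneg fun l _ => hP _)
    split_ifs with hc
    · rw [le_div_iff₀ (by positivity), one_mul, ← sq_abs (∑ l, h (s l) - n * μ)]
      exact pow_le_pow_left₀ (by positivity) hc.le 2
    · positivity
  refine hb.trans ?_
  rw [← Finset.sum_div, hvar, div_le_iff₀ (by positivity)]
  rw [div_lt_iff₀ (by positivity)] at hN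
  have : V ≤ n * (δ ^ 2 * η) := hN.le.trans (mul_le_mul_of_nonneg_right hnN (by positivity))
  calc (n : ℝ) * V ≤ n * (n * (δ ^ 2 * η)) := mul_le_mul_of_nonneg_left this hnpos.le
    _ = _ := by ring

end Prob

set_option linter.unusedSectionVars false

/-! ### Random superposition codebooks -/

section Codebook

variable {𝒲 𝒰 A B K : Type*} [Fintype 𝒲] [Fintype 𝒰] [Fintype A] [Fintype B] [Fintype K]
  [DecidableEq A] [DecidableEq B] [DecidableEq K]

/-- weight of a superposition codebook -/
def cbw (P0 : 𝒲 → ℝ) (P1 : 𝒲 → 𝒰 → ℝ) (w : A → 𝒲) (u : A × B × K → 𝒰) : ℝ :=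
  (∏ a, P0 (w a)) * ∏ i : A × B × K, P1 (w i.1) (u i)

lemma cbw_nonneg (P0 : 𝒲 → ℝ) (P1 : 𝒲 → 𝒰 → ℝ) (h0 : ∀ w, 0 ≤ P0 w)
    (h1 : ∀ w u, 0 ≤ P1 w u) (w : A → 𝒲) (u : A × B × K → 𝒰) : 0 ≤ cbw P0 P1 w u :=
  mul_nonneg (Finset.prod_nonneg fun _ _ => h0 _) (Finset.prod_nonneg fun _ _ => h1 _ _)

lemma cbw_cond (P0 : 𝒲 → ℝ) (P1 : 𝒲 → 𝒰 → ℝ) (F : (A → 𝒲) → (A × B × K → 𝒰) → ℝ) :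
    ∑ w : A → 𝒲, ∑ u : A × B × K → 𝒰, cbw P0 P1 w u * F w u
      = ∑ w : A → 𝒲, (∏ a, P0 (w a)) *
        ∑ u : A × B × K → 𝒰, (∏ i : A × B × K, P1 (w i.1) (u i)) * F w u := by
  simp only [cbw, Finset.mul_sum, mul_assoc]

lemma cbw_one (P0 : 𝒲 → ℝ) (P1 : 𝒲 → 𝒰 → ℝ) (h0 : ∑ w, P0 w = 1)
    (h1 : ∀ w, ∑ u, P1 w u = 1) :
    ∑ w : A → 𝒲, ∑ u : A × B × K → 𝒰, cbw P0 P1 w u = 1 := by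
  have := cbw_cond (A := A) (B := B) (K := K) P0 P1 (fun _ _ => 1)
  simp only [mul_one] at this
  rw [this]
  have h2 : ∀ w : A → 𝒲, ∑ u : A × B × K → 𝒰, ∏ i : A × B × K, P1 (w i.1) (u i) = 1 := by
    intro w
    rw [sum_prod_pi (fun i : A × B × K => P1 (w i.1))]
    simp [h1]
  simp only [h2, mul_one]
  rw [sum_prod_pi (fun _ : A => P0)]
  simp [h0]

lemma cbw_single (P0 : 𝒲 → ℝ) (P1 : 𝒲 → 𝒰 → ℝ) (h0 : ∑ w, P0 w = 1)
    (h1 : ∀ w, ∑ u, P1 w u = 1) (i : A × B × K) (F : 𝒲 → 𝒰 → ℝ) :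
    ∑ w : A → 𝒲, ∑ u : A × B × K → 𝒰, cbw P0 P1 w u * F (w i.1) (u i)
      = ∑ w, ∑ u, P0 w * P1 w u * F w u := by
  rw [cbw_cond P0 P1 (fun w u => F (w i.1) (u i))]
  have h2 : ∀ w : A → 𝒲, ∑ u : A × B × K → 𝒰, (∏ i : A × B × K, P1 (w i.1) (u i)) *
      F (w i.1) (u i) = ∑ u, P1 (w i.1) u * F (w i.1) u := by
    intro w
    rw [marg1 (fun i : A × B × K => P1 (w i.1)) (fun _ => h1 _) i (fun u => F (w i.1) u)]
  simp only [h2]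
  rw [marg1 (fun _ : A => P0) (fun _ => h0) i.1 (fun w => ∑ u, P1 w u * F w u)]
  simp only [Finset.mul_sum, mul_assoc]

lemma cbw_same (P0 : 𝒲 → ℝ) (P1 : 𝒲 → 𝒰 → ℝ) (h0 : ∑ w, P0 w = 1)
    (h1 : ∀ w, ∑ u, P1 w u = 1) (i i' : A × B × K) (hne : i ≠ i') (he : i.1 = i'.1)
    (F : 𝒲 → 𝒰 → 𝒰 → ℝ) :
    ∑ w : A → 𝒲, ∑ u : A × B × K → 𝒰, cbw P0 P1 w u * F (w i.1) (u i) (u i')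
      = ∑ w, ∑ u, ∑ u', P0 w * P1 w u * P1 w u' * F w u u' := by
  rw [cbw_cond P0 P1 (fun w u => F (w i.1) (u i) (u i'))]
  have h2 : ∀ w : A → 𝒲, ∑ u : A × B × K → 𝒰, (∏ i : A × B × K, P1 (w i.1) (u i)) *
      F (w i.1) (u i) (u i') = ∑ u, ∑ u', P1 (w i.1) u * P1 (w i.1) u' * F (w i.1) u u' := by
    intro w
    rw [marg2 (fun i : A × B × K => P1 (w i.1)) (fun _ => h1 _) i i' hne
      (fun u u' => F (w i.1) u u'), he]
  simp only [h2]
  rw [marg1 (fun _ : A => P0) (fun _ => h0) i.1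
    (fun w => ∑ u, ∑ u', P1 w u * P1 w u' * F w u u')]
  simp only [Finset.mul_sum, mul_assoc]

lemma cbw_diff (P0 : 𝒲 → ℝ) (P1 : 𝒲 → 𝒰 → ℝ) (h0 : ∑ w, P0 w = 1)
    (h1 : ∀ w, ∑ u, P1 w u = 1) (i i' : A × B × K) (hne : i.1 ≠ i'.1)
    (F : 𝒲 → 𝒰 → 𝒲 → 𝒰 → ℝ) :
    ∑ w : A → 𝒲, ∑ u : A × B × K → 𝒰, cbw P0 P1 w u * F (w i.1) (u i) (w i'.1) (u i')
      = ∑ w, ∑ w', ∑ u, ∑ u', P0 w * P0 w' * (P1 w u * P1 w' u' * F w u w' u') := by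
  rw [cbw_cond P0 P1 (fun w u => F (w i.1) (u i) (w i'.1) (u i'))]
  have h2 : ∀ w : A → 𝒲, ∑ u : A × B × K → 𝒰, (∏ i : A × B × K, P1 (w i.1) (u i)) *
      F (w i.1) (u i) (w i'.1) (u i') =
        ∑ u, ∑ u', P1 (w i.1) u * P1 (w i'.1) u' * F (w i.1) u (w i'.1) u' := by
    intro w
    rw [marg2 (fun i : A × B × K => P1 (w i.1)) (fun _ => h1 _) i i'
      (fun h => hne (by rw [h])) (fun u u' => F (w i.1) u (w i'.1) u')]
  simp only [h2]
  rw [marg2 (fun _ : A => P0) (fun _ => h0) i.1 i'.1 hne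
    (fun w w' => ∑ u, ∑ u', P1 w u * P1 w' u' * F w u w' u')]
  simp only [Finset.mul_sum]

/-- largest (over keys) total weight -/
def maxKey (g : 𝒲 → 𝒰 → ℝ) (w : A → 𝒲) (u : A × B × K → 𝒰) : ℝ :=
  ⨆ k : K, ∑ a, ∑ b, g (w a) (u (a, b, k))

lemma le_maxKey (g : 𝒲 → 𝒰 → ℝ) (w : A → 𝒲) (u : A × B × K → 𝒰) (k : K) :
    ∑ a, ∑ b, g (w a) (u (a, b, k)) ≤ maxKey g w u :=
  le_ciSup (f := fun k : K => ∑ a, ∑ b, g (w a) (u (a, b, k))) (Set.finite_range _).bddAbove k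

lemma maxKey_nonneg (g : 𝒲 → 𝒰 → ℝ) (hg : ∀ w u, 0 ≤ g w u) (w : A → 𝒲) (u : A × B × K → 𝒰) :
    0 ≤ maxKey g w u :=
  Real.iSup_nonneg fun _ => Finset.sum_nonneg fun _ _ => Finset.sum_nonneg fun _ _ => hg _ _

lemma exp_le_one_add_two_mul {x : ℝ} (h0 : 0 ≤ x) (h1 : x ≤ 1) : Real.exp x ≤ 1 + 2 * x := by
  have := Real.abs_exp_sub_one_sub_id_le (x := x) (by rw [abs_of_nonneg h0]; exact h1)
  have h2 := (abs_le.1 this).2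
  nlinarith

lemma maxKey_cond [Nonempty K] (P1 : 𝒲 → 𝒰 → ℝ)
    (h1n : ∀ w u, 0 ≤ P1 w u) (h1 : ∀ w, ∑ u, P1 w u = 1)
    (g : 𝒲 → 𝒰 → ℝ) (c : ℝ) (hc : 0 < c) (hg0 : ∀ w u, 0 ≤ g w u) (hgc : ∀ w u, g w u ≤ c)
    (w : A → 𝒲) :
    ∑ u : A × B × K → 𝒰, (∏ i : A × B × K, P1 (w i.1) (u i)) * maxKey g w u
      ≤ c * Real.log (Fintype.card K) +
        2 * (Fintype.card B) * ∑ a, ∑ u, P1 (w a) u * g (w a) u := by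
  set e : A → ℝ := fun a => ∑ u, P1 (w a) u * g (w a) u with he
  have he0 : ∀ a, 0 ≤ e a := fun a => Finset.sum_nonneg fun u _ => mul_nonneg (h1n _ _) (hg0 _ _)
  set μ : ℝ := (Fintype.card B) * ∑ a, e a with hμ
  set N : (A × B × K → 𝒰) → K → ℝ := fun u k => ∑ a, ∑ b, g (w a) (u (a, b, k)) with hN
  have hK : (0 : ℝ) < Fintype.card K := by exact_mod_cast Fintype.card_pos
  set c0 : ℝ := Fintype.card K * Real.exp (2 * μ / c) with hc0
  have hc0p : 0 < c0 := mul_pos hK (Real.exp_pos _)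
  have hmgf : ∀ k : K, ∑ u : A × B × K → 𝒰, (∏ i : A × B × K, P1 (w i.1) (u i)) *
      Real.exp (N u k / c) ≤ Real.exp (2 * μ / c) := by
    intro k
    have hprod : ∀ u : A × B × K → 𝒰, (∏ i : A × B × K, P1 (w i.1) (u i)) * Real.exp (N u k / c)
        = ∏ i : A × B × K, (P1 (w i.1) (u i) *
            if i.2.2 = k then Real.exp (g (w i.1) (u i) / c) else 1) := by
      intro u
      rw [Finset.prod_mul_distrib]
      congr 1
      rw [Fintype.prod_prod_type]
      simp only [Fintype.prod_prod_type, Finset.prod_ite_eq', Finset.mem_univ, if_true]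
      simp only [← Real.exp_sum, hN, Finset.sum_div]
    simp only [hprod]
    rw [sum_prod_pi (fun (i : A × B × K) u => P1 (w i.1) u *
            if i.2.2 = k then Real.exp (g (w i.1) u / c) else 1)]
    have hfac : ∀ i : A × B × K, ∑ u, P1 (w i.1) u *
        (if i.2.2 = k then Real.exp (g (w i.1) u / c) else 1)
        ≤ if i.2.2 = k then Real.exp (2 * e i.1 / c) else 1 := by
      intro i
      split_ifs with hik
      · calc ∑ u, P1 (w i.1) u * Real.exp (g (w i.1) u / c)
            ≤ ∑ u, P1 (w i.1) u * (1 + 2 * (g (w i.1) u / c)) := by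
              refine Finset.sum_le_sum fun u _ => mul_le_mul_of_nonneg_left ?_ (h1n _ _)
              exact exp_le_one_add_two_mul (div_nonneg (hg0 _ _) hc.le)
                ((div_le_one hc).2 (hgc _ _))
          _ = 1 + 2 * e i.1 / c := by
              simp only [mul_add, mul_one, Finset.sum_add_distrib, h1, he, Finset.mul_sum,
                Finset.sum_div]
              congr 1
              refine Finset.sum_congr rfl fun u _ => ?_
              ring
          _ ≤ _ := by
              have := Real.add_one_le_exp (2 * e i.1 / c)
              linarith
      · simp [h1]
    calc _ ≤ ∏ i : A × B × K, (if i.2.2 = k then Real.exp (2 * e i.1 / c) else 1) := by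
          refine Finset.prod_le_prod (fun i _ => Finset.sum_nonneg fun u _ =>
            mul_nonneg (h1n _ _) ?_) (fun i _ => hfac i)
          split_ifs <;> positivity
      _ = Real.exp (2 * μ / c) := by
          rw [Fintype.prod_prod_type]
          simp only [Fintype.prod_prod_type, Finset.prod_ite_eq', Finset.mem_univ, if_true]
          simp only [← Real.exp_sum, hμ, Finset.mul_sum, Finset.sum_div]
          congr 1
          refine Finset.sum_congr rfl fun a _ => ?_
          simp
          ring
  have hmax : ∀ u, maxKey g w u ≤ c * ((∑ k, Real.exp (N u k / c)) / c0 + Real.log c0 - 1) := by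
    intro u
    refine ciSup_le fun k => ?_
    have hle : Real.exp (N u k / c) ≤ ∑ k, Real.exp (N u k / c) :=
      Finset.single_le_sum (f := fun k => Real.exp (N u k / c))
        (fun k _ => (Real.exp_pos _).le) (Finset.mem_univ k)
    set X := ∑ k, Real.exp (N u k / c) with hX
    have hXp : 0 < X := lt_of_lt_of_le (Real.exp_pos _) hle
    have h1 : N u k / c ≤ Real.log X := by
      rw [Real.le_log_iff_exp_le hXp]; exact hle
    have h2 : Real.log X ≤ X / c0 + Real.log c0 - 1 := by
      have := Real.log_le_sub_one_of_pos (div_pos hXp hc0p)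
      rw [Real.log_div hXp.ne' hc0p.ne'] at this
      linarith
    have := h1.trans h2
    rw [div_le_iff₀ hc] at this
    change N u k ≤ _
    linarith
  have hw1 : ∑ u : A × B × K → 𝒰, ∏ i : A × B × K, P1 (w i.1) (u i) = 1 := by
    rw [sum_prod_pi (fun i : A × B × K => P1 (w i.1))]
    simp [h1]
  have hwn : ∀ u : A × B × K → 𝒰, 0 ≤ ∏ i : A × B × K, P1 (w i.1) (u i) :=
    fun u => Finset.prod_nonneg fun _ _ => h1n _ _
  calc _ ≤ ∑ u : A × B × K → 𝒰, (∏ i : A × B × K, P1 (w i.1) (u i)) *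
        (c * ((∑ k, Real.exp (N u k / c)) / c0 + Real.log c0 - 1)) :=
        Finset.sum_le_sum fun u _ => mul_le_mul_of_nonneg_left (hmax u) (hwn u)
    _ = c * ((∑ k, ∑ u : A × B × K → 𝒰, (∏ i : A × B × K, P1 (w i.1) (u i)) *
          Real.exp (N u k / c)) / c0) + c * (Real.log c0 - 1) := by
        rw [Finset.sum_comm]
        have : ∀ u : A × B × K → 𝒰, (∏ i : A × B × K, P1 (w i.1) (u i)) *
          (c * ((∑ k, Real.exp (N u k / c)) / c0 + Real.log c0 - 1)) =
          (c / c0) * (∑ k, (∏ i : A × B × K, P1 (w i.1) (u i)) * Real.exp (N u k / c)) +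
          (∏ i : A × B × K, P1 (w i.1) (u i)) * (c * (Real.log c0 - 1)) := by
          intro u; rw [← Finset.mul_sum]; ring
        simp only [this, Finset.sum_add_distrib]
        rw [← Finset.sum_mul, hw1, one_mul, ← Finset.mul_sum]
        ring
    _ ≤ c * 1 + c * (Real.log c0 - 1) := by
        have hle : (∑ k, ∑ u : A × B × K → 𝒰, (∏ i : A × B × K, P1 (w i.1) (u i)) *
          Real.exp (N u k / c)) / c0 ≤ 1 := by
          rw [div_le_one hc0p]
          refine (Finset.sum_le_sum fun k _ => hmgf k).trans ?_
          simp [hc0]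
        nlinarith
    _ = c * Real.log (Fintype.card K) + 2 * μ := by
        rw [hc0, Real.log_mul hK.ne' (Real.exp_pos _).ne', Real.log_exp]
        field_simp
        ring
    _ = _ := by rw [hμ]; ring

open Classical in
/-- expected largest key weight -/
lemma maxKey_exp [Nonempty K] (P0 : 𝒲 → ℝ) (P1 : 𝒲 → 𝒰 → ℝ)
    (h0n : ∀ w, 0 ≤ P0 w) (h0 : ∑ w, P0 w = 1)
    (h1n : ∀ w u, 0 ≤ P1 w u) (h1 : ∀ w, ∑ u, P1 w u = 1)
    (g : 𝒲 → 𝒰 → ℝ) (c : ℝ) (hc : 0 < c) (hg0 : ∀ w u, 0 ≤ g w u) (hgc : ∀ w u, g w u ≤ c)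
    (S : 𝒲 → Prop) (hS : ∀ w u, ¬ S w → g w u = 0) :
    ∑ w : A → 𝒲, ∑ u : A × B × K → 𝒰, cbw P0 P1 w u * maxKey g w u
      ≤ c * Real.log (Fintype.card K) *
          min 1 (Fintype.card A * ∑ w, P0 w * if S w then 1 else 0) +
        2 * (Fintype.card A * Fintype.card B) * ∑ w, ∑ u, P0 w * P1 w u * g w u := by
  have hK : (1 : ℝ) ≤ Fintype.card K := by exact_mod_cast Fintype.card_pos
  have hlog : 0 ≤ c * Real.log (Fintype.card K) := mul_nonneg hc.le (Real.log_nonneg hK)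
  rw [cbw_cond P0 P1 (fun w u => maxKey g w u)]
  have hin : ∀ w : A → 𝒲, ∑ u : A × B × K → 𝒰, (∏ i : A × B × K, P1 (w i.1) (u i)) *
      maxKey g w u ≤ c * Real.log (Fintype.card K) * (if ∃ a, S (w a) then 1 else 0) +
        2 * (Fintype.card B) * ∑ a, ∑ u, P1 (w a) u * g (w a) u := by
    intro w
    split_ifs with hw
    · rw [mul_one]; exact maxKey_cond P1 h1n h1 g c hc hg0 hgc w
    · push Not at hw
      have hz : ∀ u : A × B × K → 𝒰, maxKey g w u = 0 := by
        intro u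
        have : ∀ k : K, ∑ a, ∑ b, g (w a) (u (a, b, k)) = 0 := fun k =>
          Finset.sum_eq_zero fun a _ => Finset.sum_eq_zero fun b _ => hS _ _ (hw a)
        simp [maxKey, this]
      simp only [hz, mul_zero, Finset.sum_const_zero, zero_add]
      refine mul_nonneg (by positivity) (Finset.sum_nonneg fun a _ => Finset.sum_nonneg fun u _ =>
        mul_nonneg (h1n _ _) (hg0 _ _))
  have hwn : ∀ w : A → 𝒲, 0 ≤ ∏ a, P0 (w a) := fun w => Finset.prod_nonneg fun _ _ => h0n _
  have hw1 : ∑ w : A → 𝒲, ∏ a, P0 (w a) = 1 := by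
    rw [sum_prod_pi (fun _ : A => P0)]; simp [h0]
  refine (Finset.sum_le_sum fun w _ => mul_le_mul_of_nonneg_left (hin w) (hwn w)).trans ?_
  simp only [mul_add, Finset.sum_add_distrib]
  refine add_le_add ?_ ?_
  · have e1 : ∑ w : A → 𝒲, (∏ a, P0 (w a)) * (c * Real.log (Fintype.card K) *
        (if ∃ a, S (w a) then 1 else 0)) = c * Real.log (Fintype.card K) *
        ∑ w : A → 𝒲, (∏ a, P0 (w a)) * (if ∃ a, S (w a) then 1 else 0) := by
      rw [Finset.mul_sum]
      refine Finset.sum_congr rfl fun w _ => ?_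
      ring
    rw [e1]
    refine mul_le_mul_of_nonneg_left (le_min ?_ ?_) hlog
    · refine le_trans (Finset.sum_le_sum fun w _ => ?_) hw1.le
      exact mul_le_of_le_one_right (hwn w) (by split_ifs <;> norm_num)
    · have e2 : ∀ w : A → 𝒲, (∏ a, P0 (w a)) * (if ∃ a, S (w a) then (1:ℝ) else 0) ≤
          ∑ a, (∏ a, P0 (w a)) * (if S (w a) then 1 else 0) := by
        intro w
        rw [← Finset.mul_sum]
        refine mul_le_mul_of_nonneg_left ?_ (hwn w)
        split_ifs with hex
        · obtain ⟨a, ha⟩ := hex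
          have := Finset.single_le_sum (f := fun a => if S (w a) then (1:ℝ) else 0)
            (fun a _ => by positivity) (Finset.mem_univ a)
          simpa [ha] using this
        · positivity
      refine (Finset.sum_le_sum fun w _ => e2 w).trans ?_
      rw [Finset.sum_comm]
      have e3 : ∀ a : A, ∑ w : A → 𝒲, (∏ a, P0 (w a)) * (if S (w a) then (1:ℝ) else 0) =
          ∑ w, P0 w * if S w then 1 else 0 := fun a =>
        marg1 (fun _ : A => P0) (fun _ => h0) a (fun w => if S w then 1 else 0)
      simp only [e3]
      simp
  · have e1 : ∀ w : A → 𝒲, (∏ a, P0 (w a)) * (2 * (Fintype.card B : ℝ) *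
        ∑ a, ∑ u, P1 (w a) u * g (w a) u) = ∑ a, 2 * (Fintype.card B : ℝ) *
          ((∏ a, P0 (w a)) * ∑ u, P1 (w a) u * g (w a) u) := by
      intro w
      rw [Finset.mul_sum, Finset.mul_sum]
      refine Finset.sum_congr rfl fun a _ => ?_
      ring
    simp only [e1]
    rw [Finset.sum_comm]
    simp only [← Finset.mul_sum]
    have e3 : ∀ a : A, ∑ w : A → 𝒲, (∏ a, P0 (w a)) * (∑ u, P1 (w a) u * g (w a) u) =
          ∑ w, P0 w * ∑ u, P1 w u * g w u := fun a =>
        marg1 (fun _ : A => P0) (fun _ => h0) a (fun w => ∑ u, P1 w u * g w u)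
    simp only [e3]
    simp only [Finset.mul_sum, mul_assoc]
    simp only [Finset.sum_const, Finset.card_univ, nsmul_eq_mul, Finset.mul_sum]
    refine le_of_eq ?_
    refine Finset.sum_congr rfl fun w _ => Finset.sum_congr rfl fun u _ => ?_
    ring

/-- trivial bound for the expected largest key weight -/
lemma maxKey_exp' [Nonempty K] (P0 : 𝒲 → ℝ) (P1 : 𝒲 → 𝒰 → ℝ)
    (h0n : ∀ w, 0 ≤ P0 w) (h0 : ∑ w, P0 w = 1)
    (h1n : ∀ w u, 0 ≤ P1 w u) (h1 : ∀ w, ∑ u, P1 w u = 1)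
    (g : 𝒲 → 𝒰 → ℝ) (hg0 : ∀ w u, 0 ≤ g w u) :
    ∑ w : A → 𝒲, ∑ u : A × B × K → 𝒰, cbw P0 P1 w u * maxKey g w u
      ≤ (Fintype.card A * Fintype.card B * Fintype.card K) *
          ∑ w, ∑ u, P0 w * P1 w u * g w u := by
  have hm : ∀ (w : A → 𝒲) (u : A × B × K → 𝒰), maxKey g w u ≤
      ∑ i : A × B × K, g (w i.1) (u i) := by
    intro w u
    refine ciSup_le fun k => ?_
    rw [Fintype.sum_prod_type]
    refine Finset.sum_le_sum fun a _ => ?_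
    rw [Fintype.sum_prod_type]
    refine Finset.sum_le_sum fun b _ => ?_
    exact Finset.single_le_sum (f := fun k => g (w a) (u (a, b, k)))
      (fun k _ => hg0 _ _) (Finset.mem_univ k)
  refine (Finset.sum_le_sum fun w _ => Finset.sum_le_sum fun u _ =>
    mul_le_mul_of_nonneg_left (hm w u) (cbw_nonneg P0 P1 h0n h1n w u)).trans ?_
  simp only [Finset.mul_sum]
  rw [Finset.sum_congr rfl fun w _ => Finset.sum_comm]
  rw [Finset.sum_comm]
  simp only [cbw_single P0 P1 h0 h1 _ g]
  simp only [Finset.sum_const, Finset.card_univ, nsmul_eq_mul, Finset.mul_sum,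
    Fintype.card_prod]
  refine le_of_eq ?_
  refine Finset.sum_congr rfl fun w _ => Finset.sum_congr rfl fun u _ => ?_
  push_cast; ring

end Codebook

set_option linter.unusedSectionVars false

/-! ### One-shot coding theorem -/

section OneShot

variable {𝒲 𝒰 𝒳 𝒴 𝒵 Θ : Type*} [Fintype 𝒲] [Fintype 𝒰] [Fintype 𝒳] [Fintype 𝒴] [Fintype 𝒵]
  [Fintype Θ]

open Classical in
/-- unique decoding -/
def uniqDec {I 𝒴 : Type*} (D : I → 𝒴 → Prop) (y : 𝒴) : Option I :=
  if h : ∃ i, D i y ∧ ∀ i', D i' y → i' = i then some h.choose else none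

lemma uniqDec_eq {I 𝒴 : Type*} (D : I → 𝒴 → Prop) (y : 𝒴) (i : I) (hi : D i y)
    (hu : ∀ i', D i' y → i' = i) : uniqDec D y = some i := by
  have h : ∃ i, D i y ∧ ∀ i', D i' y → i' = i := ⟨i, hi, hu⟩
  unfold uniqDec
  rw [dif_pos h]
  exact congrArg some (hu _ h.choose_spec.1)

open Classical in
lemma uniqDec_ge {I 𝒴 : Type*} [Fintype I] [DecidableEq I] (D : I → 𝒴 → Prop) (y : 𝒴) (i : I) :
    (if D i y then (1 : ℝ) else 0) - ∑ i' ∈ Finset.univ.erase i, (if D i' y then 1 else 0) ≤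
      if uniqDec D y = some i then 1 else 0 := by
  have hn : ∀ s : Finset I, 0 ≤ ∑ i' ∈ s, (if D i' y then (1 : ℝ) else 0) :=
    fun s => Finset.sum_nonneg fun _ _ => by positivity
  by_cases hi : D i y
  · by_cases hu : ∀ i', D i' y → i' = i
    · rw [uniqDec_eq D y i hi hu]
      simp only [hi, if_true]
      linarith [hn (Finset.univ.erase i)]
    · push Not at hu
      obtain ⟨i', h1, h2⟩ := hu
      have := Finset.single_le_sum (s := Finset.univ.erase i)
        (f := fun i' => if D i' y then (1 : ℝ) else 0) (fun _ _ => by positivity)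
        (Finset.mem_erase.2 ⟨h2, Finset.mem_univ i'⟩)
      simp only [h1, if_true] at this
      simp only [hi, if_true]
      have h3 : (0 : ℝ) ≤ if uniqDec D y = some i then 1 else 0 := by positivity
      linarith
  · simp only [hi, if_false]
    have h3 : (0 : ℝ) ≤ if uniqDec D y = some i then 1 else 0 := by positivity
    linarith [hn (Finset.univ.erase i)]

open Classical in
/-- keyed decoder obtained from a joint decoder of message and key -/
def keyDec {M0 M1 K : ℕ} (d : 𝒴 → Option (Fin M0 × Fin M1 × Fin K)) (p : 𝒴 × Fin K) :
    Option (Fin (M0 * M1)) :=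
  (d p.1).bind fun i => if i.2.2 = p.2 then some (finProdFinEquiv (i.1, i.2.1)) else none

lemma keyDec_iff {M0 M1 K : ℕ} (d : 𝒴 → Option (Fin M0 × Fin M1 × Fin K)) (y : 𝒴) (k : Fin K)
    (a : Fin M0) (b : Fin M1) :
    keyDec d (y, k) = some (finProdFinEquiv (a, b)) ↔ d y = some (a, b, k) := by
  unfold keyDec
  rcases h : d y with _ | ⟨a', b', k'⟩
  · simp
  · simp only [Option.bind_some]
    by_cases hk : k' = k
    · simp [hk, Prod.ext_iff]
    · simp [hk]

open Classical in
/-- error functional of a codebook -/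
def errC {M0 M1 K : ℕ} (H : 𝒲 → 𝒰 → 𝒴 → ℝ) (D : 𝒲 → 𝒰 → 𝒴 → Prop)
    (w : Fin M0 → 𝒲) (u : Fin M0 × Fin M1 × Fin K → 𝒰) : ℝ :=
  (1 / ((M0 * M1 : ℕ) * (K : ℝ))) * ∑ i : Fin M0 × Fin M1 × Fin K,
    ((1 - ∑ y, H (w i.1) (u i) y * if D (w i.1) (u i) y then 1 else 0) +
      ∑ i' ∈ Finset.univ.erase i, ∑ y, H (w i.1) (u i) y * if D (w i'.1) (u i') y then 1 else 0)

lemma sum_reindex {M0 M1 K : ℕ} (F : Fin M0 × Fin M1 × Fin K → ℝ) :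
    ∑ m : Fin (M0 * M1), ∑ k : Fin K, F ((finProdFinEquiv.symm m).1, (finProdFinEquiv.symm m).2, k)
      = ∑ i, F i := by
  rw [Fintype.sum_equiv finProdFinEquiv.symm _
    (fun ab : Fin M0 × Fin M1 => ∑ k, F (ab.1, ab.2, k)) (fun m => rfl)]
  rw [Fintype.sum_prod_type, Fintype.sum_prod_type]
  simp only [Fintype.sum_prod_type]

lemma sum_fst {M0 M1 K : ℕ} (h : Fin M0 → ℝ) :
    ∑ i : Fin M0 × Fin M1 × Fin K, h i.1 = M1 * K * ∑ a, h a := by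
  simp only [Fintype.sum_prod_type, Finset.sum_const, Finset.card_univ, Fintype.card_prod,
    Fintype.card_fin, nsmul_eq_mul, ← Finset.mul_sum]
  push_cast
  ring

open Classical in
lemma codebook_det {M0 M1 K : ℕ} (hM0 : 0 < M0) (hM1 : 0 < M1) (hK : 0 < K)
    (fe : 𝒲 → 𝒰 → 𝒳 → ℝ) (hfe0 : ∀ w u x, 0 ≤ fe w u x) (hfe1 : ∀ w u, ∑ x, fe w u x ≤ 1)
    (x0 : 𝒳) (T : 𝒳 → 𝒴 → ℝ) (Q : 𝒳 → 𝒵 → ℝ) (hT : IsChannel T) (hQ : IsChannel Q)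
    (D : 𝒲 → 𝒰 → 𝒴 → Prop)
    (gz : Θ → 𝒵 → 𝒲 → 𝒰 → ℝ)
    (hgz : ∀ w u z, ∑ x, fe w u x * Q x z ≤ ∑ θ, gz θ z w u)
    (w : Fin M0 → 𝒲) (u : Fin M0 × Fin M1 × Fin K → 𝒰) :
    ∃ (f : Fin (M0 * M1) × Fin K → 𝒳 → ℝ) (φ : 𝒴 × Fin K → Option (Fin (M0 * M1)) → ℝ),
      IsChannel f ∧ IsChannel φ ∧
      1 - (1 / ((M0 * M1 : ℕ) * (K : ℝ))) * ∑ m, ∑ k, ∑ x, ∑ y,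
        φ (y, k) (some m) * T x y * f (m, k) x ≤
          errC (fun w u y => ∑ x, fe w u x * T x y) D w u ∧
      ∀ ψ : 𝒵 → 𝒴 → ℝ, IsChannel ψ →
        ∑ z, ∑ m, ∑ k, ((1 / ((M0 * M1 : ℕ) * (K : ℝ))) * (∑ x, Q x z * f (m, k) x)) *
          ∑ y, ψ z y * ∑ m' ∈ Finset.univ.erase m, φ (y, k) (some m') ≤
        1 / K + (∑ θ, ∑ z, maxKey (gz θ z) w u) / ((M0 * M1 : ℕ) * (K : ℝ)) := by
  set M := M0 * M1 with hM
  have hMp : 0 < M := Nat.mul_pos hM0 hM1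
  have hMr : (0 : ℝ) < (M : ℝ) := by exact_mod_cast hMp
  have hKr : (0 : ℝ) < (K : ℝ) := by exact_mod_cast hK
  set idx : Fin M → Fin K → Fin M0 × Fin M1 × Fin K :=
    fun m k => ((finProdFinEquiv.symm m).1, (finProdFinEquiv.symm m).2, k) with hidx
  set Di : Fin M0 × Fin M1 × Fin K → 𝒴 → Prop := fun i y => D (w i.1) (u i) y with hDi
  set d := uniqDec Di with hd
  set fi : Fin M0 × Fin M1 × Fin K → 𝒳 → ℝ := fun i => fe (w i.1) (u i) with hfi
  set f : Fin M × Fin K → 𝒳 → ℝ := fun p x => fi (idx p.1 p.2) x +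
    (1 - ∑ x, fi (idx p.1 p.2) x) * (if x = x0 then 1 else 0) with hf
  set φ : 𝒴 × Fin K → Option (Fin M) → ℝ := fun p o => if keyDec d p = o then 1 else 0 with hφ
  have hr0 : ∀ i, 0 ≤ 1 - ∑ x, fi i x := fun i => by linarith [hfe1 (w i.1) (u i)]
  have hf0 : ∀ p x, 0 ≤ f p x := fun p x =>
    add_nonneg (hfe0 _ _ _) (mul_nonneg (hr0 _) (by positivity))
  have hfφ : ∀ m k y, φ (y, k) (some m) = if d y = some (idx m k) then 1 else 0 := by
    intro m k y
    have := keyDec_iff d y k (finProdFinEquiv.symm m).1 (finProdFinEquiv.symm m).2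
    simp only [Prod.mk.eta, Equiv.apply_symm_apply] at this
    simp only [hφ, this, hidx]
  refine ⟨f, φ, ⟨hf0, ?_⟩, ⟨?_, ?_⟩, ?_, ?_⟩
  · intro p
    simp only [hf, Finset.sum_add_distrib, ← Finset.mul_sum]
    simp
  · intro p o; simp only [hφ]; positivity
  · intro p; simp [hφ]
  · -- error
    obtain ⟨Fn, hFn⟩ : ∃ Fn : Fin M0 × Fin M1 × Fin K → ℝ, Fn = fun i =>
        ((1 - ∑ y, (∑ x, fi i x * T x y) * if Di i y then 1 else 0) +
        ∑ i' ∈ Finset.univ.erase i, ∑ y, (∑ x, fi i x * T x y) *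
          if Di i' y then 1 else 0) := ⟨_, rfl⟩
    have hterm : ∀ m k, 1 - ∑ x, ∑ y, φ (y, k) (some m) * T x y * f (m, k) x ≤
        Fn (idx m k) := by
      intro m k
      set i := idx m k with hi
      have h1 : ∑ y, (∑ x, fi i x * T x y) * ((if Di i y then 1 else 0) -
          ∑ i' ∈ Finset.univ.erase i, (if Di i' y then 1 else 0)) ≤
          ∑ x, ∑ y, φ (y, k) (some m) * T x y * f (m, k) x := by
        rw [Finset.sum_comm (s := (Finset.univ : Finset 𝒳))]
        refine Finset.sum_le_sum fun y _ => ?_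
        rw [Finset.sum_mul]
        refine Finset.sum_le_sum fun x _ => ?_
        rw [hfφ]
        have a1 := uniqDec_ge Di y i
        have a2 : 0 ≤ fi i x * T x y := mul_nonneg (hfe0 _ _ _) (hT.1 _ _)
        have a3 : fi i x ≤ f (m, k) x := by
          simp only [hf]
          exact le_add_of_nonneg_right (mul_nonneg (hr0 _) (by positivity))
        calc fi i x * T x y * ((if Di i y then 1 else 0) -
            ∑ i' ∈ Finset.univ.erase i, (if Di i' y then 1 else 0))
            ≤ fi i x * T x y * (if d y = some i then 1 else 0) :=
              mul_le_mul_of_nonneg_left a1 a2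
          _ ≤ f (m, k) x * T x y * (if d y = some i then 1 else 0) := by
              refine mul_le_mul_of_nonneg_right (mul_le_mul_of_nonneg_right a3 (hT.1 _ _))
                (by positivity)
          _ = _ := by ring
      have h2 : ∑ y, (∑ x, fi i x * T x y) * ((if Di i y then 1 else 0) -
          ∑ i' ∈ Finset.univ.erase i, (if Di i' y then 1 else 0)) =
          ∑ y, (∑ x, fi i x * T x y) * (if Di i y then 1 else 0) -
          ∑ i' ∈ Finset.univ.erase i, ∑ y, (∑ x, fi i x * T x y) *
            (if Di i' y then 1 else 0) := by
        rw [Finset.sum_comm (s := Finset.univ.erase i), ← Finset.sum_sub_distrib]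
        refine Finset.sum_congr rfl fun y _ => ?_
        rw [mul_sub, Finset.mul_sum (s := Finset.univ.erase i)]
      rw [hFn]
      simp only
      linarith
    have hsum := Finset.sum_le_sum fun m (_ : m ∈ Finset.univ) =>
      Finset.sum_le_sum fun k (_ : k ∈ Finset.univ) => hterm m k
    have hre : ∑ m : Fin M, ∑ k : Fin K, Fn (idx m k) = ∑ i, Fn i := sum_reindex Fn
    rw [hre] at hsum
    simp only [Finset.sum_sub_distrib, Finset.sum_const, Finset.card_univ, Fintype.card_fin,
      nsmul_eq_mul, mul_one] at hsum
    have hle := mul_le_mul_of_nonneg_left hsum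
      (show 0 ≤ (1 / ((M : ℕ) * (K : ℝ))) by positivity)
    have e : (1 / ((M : ℕ) * (K : ℝ))) * ((M : ℝ) * K - ∑ m : Fin M, ∑ k : Fin K, ∑ x, ∑ y,
        φ (y, k) (some m) * T x y * f (m, k) x) = 1 - (1 / ((M : ℕ) * (K : ℝ))) *
        ∑ m : Fin M, ∑ k : Fin K, ∑ x, ∑ y, φ (y, k) (some m) * T x y * f (m, k) x := by
      field_simp
    rw [e, hFn] at hle
    exact hle
  · intro ψ hψ
    set Bz : 𝒵 → ℝ := fun z => (1 / ((M : ℕ) * (K : ℝ))) *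
      (M * Q x0 z + ∑ θ, maxKey (gz θ z) w u) with hBz
    have hkey : ∀ z k, ∑ m, ∑ x, Q x z * f (m, k) x ≤ M * Q x0 z + ∑ θ, maxKey (gz θ z) w u := by
      intro z k
      have h1 : ∀ m, ∑ x, Q x z * f (m, k) x ≤ Q x0 z + ∑ θ, gz θ z (w (idx m k).1) (u (idx m k)) := by
        intro m
        have : ∑ x, Q x z * f (m, k) x = ∑ x, fi (idx m k) x * Q x z +
            (1 - ∑ x, fi (idx m k) x) * Q x0 z := by
          simp only [hf, mul_add, Finset.sum_add_distrib]
          congr 1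
          · exact Finset.sum_congr rfl fun x _ => mul_comm _ _
          · simp [mul_comm]
        rw [this]
        have a1 := hgz (w (idx m k).1) (u (idx m k)) z
        have a2 : (1 - ∑ x, fi (idx m k) x) * Q x0 z ≤ Q x0 z := by
          refine mul_le_of_le_one_left (hQ.1 _ _) ?_
          have : 0 ≤ ∑ x, fi (idx m k) x := Finset.sum_nonneg fun x _ => hfe0 _ _ _
          linarith
        linarith
      refine (Finset.sum_le_sum fun m _ => h1 m).trans ?_
      rw [Finset.sum_add_distrib]
      simp only [Finset.sum_const, Finset.card_univ, Fintype.card_fin, nsmul_eq_mul]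
      refine add_le_add le_rfl ?_
      rw [Finset.sum_comm]
      refine Finset.sum_le_sum fun θ _ => ?_
      refine le_trans (le_of_eq ?_) (le_maxKey (gz θ z) w u k)
      rw [Fintype.sum_equiv finProdFinEquiv.symm _
        (fun ab : Fin M0 × Fin M1 => gz θ z (w ab.1) (u (ab.1, ab.2, k))) (fun m => rfl)]
      rw [Fintype.sum_prod_type]
    have hB0 : ∀ z, 0 ≤ M * Q x0 z + ∑ θ, maxKey (gz θ z) w u := by
      intro z
      refine le_trans ?_ (hkey z ⟨0, hK⟩)
      exact Finset.sum_nonneg fun m _ => Finset.sum_nonneg fun x _ => mul_nonneg (hQ.1 _ _) (hf0 _ _)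
    have hzy : ∀ z y, ∑ m, ∑ k, ((1 / ((M : ℕ) * (K : ℝ))) * (∑ x, Q x z * f (m, k) x)) *
        ∑ m' ∈ Finset.univ.erase m, φ (y, k) (some m') ≤ Bz z := by
      intro z y
      have hφ1 : ∀ m k, ∑ m' ∈ Finset.univ.erase m, φ (y, k) (some m') ≤
          if (∃ i, d y = some i ∧ i.2.2 = k) then 1 else 0 := by
        intro m k
        have : ∑ m' ∈ Finset.univ.erase m, φ (y, k) (some m') ≤ ∑ m', φ (y, k) (some m') :=
          Finset.sum_le_sum_of_subset_of_nonneg (Finset.subset_univ _)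
            (fun _ _ _ => by simp only [hφ]; positivity)
        refine this.trans ?_
        split_ifs with hex
        · have : ∑ o, φ (y, k) o = 1 := by simp [hφ]
          rw [Fintype.sum_option] at this
          have h0 : 0 ≤ φ (y, k) none := by simp only [hφ]; positivity
          linarith
        · refine le_of_eq (Finset.sum_eq_zero fun m' _ => ?_)
          rw [hfφ, if_neg]
          intro h
          exact hex ⟨_, h, rfl⟩
      rw [Finset.sum_comm]
      calc ∑ k, ∑ m, ((1 / ((M : ℕ) * (K : ℝ))) * (∑ x, Q x z * f (m, k) x)) *
            ∑ m' ∈ Finset.univ.erase m, φ (y, k) (some m')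
          ≤ ∑ k, ∑ m, ((1 / ((M : ℕ) * (K : ℝ))) * (∑ x, Q x z * f (m, k) x)) *
            (if (∃ i, d y = some i ∧ i.2.2 = k) then 1 else 0) := by
            refine Finset.sum_le_sum fun k _ => Finset.sum_le_sum fun m _ =>
              mul_le_mul_of_nonneg_left (hφ1 m k) (mul_nonneg (by positivity) ?_)
            exact Finset.sum_nonneg fun x _ => mul_nonneg (hQ.1 _ _) (hf0 _ _)
        _ = ∑ k, (1 / ((M : ℕ) * (K : ℝ))) * (∑ m, (∑ x, Q x z * f (m, k) x)) *
            (if (∃ i, d y = some i ∧ i.2.2 = k) then 1 else 0) := by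
            refine Finset.sum_congr rfl fun k _ => ?_
            rw [← Finset.sum_mul, ← Finset.mul_sum]
        _ ≤ ∑ k : Fin K, Bz z * (if (∃ i, d y = some i ∧ i.2.2 = k) then 1 else 0) := by
            refine Finset.sum_le_sum fun k _ => mul_le_mul_of_nonneg_right
              (mul_le_mul_of_nonneg_left (hkey z k) (by positivity)) (by positivity)
        _ ≤ Bz z := by
            rw [← Finset.mul_sum]
            refine mul_le_of_le_one_right (mul_nonneg (by positivity) (hB0 z)) ?_
            rcases hdy : d y with _ | i0
            · simp
            · simp
    calc ∑ z, ∑ m, ∑ k, ((1 / ((M : ℕ) * (K : ℝ))) * (∑ x, Q x z * f (m, k) x)) *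
          ∑ y, ψ z y * ∑ m' ∈ Finset.univ.erase m, φ (y, k) (some m')
        = ∑ z, ∑ y, ψ z y * ∑ m, ∑ k, ((1 / ((M : ℕ) * (K : ℝ))) *
          (∑ x, Q x z * f (m, k) x)) * ∑ m' ∈ Finset.univ.erase m, φ (y, k) (some m') := by
          refine Finset.sum_congr rfl fun z _ => ?_
          simp only [Finset.mul_sum (s := (Finset.univ : Finset 𝒴))]
          rw [Finset.sum_congr rfl fun m _ => Finset.sum_comm]
          rw [Finset.sum_comm]
          refine Finset.sum_congr rfl fun y _ => ?_
          rw [Finset.mul_sum]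
          refine Finset.sum_congr rfl fun m _ => ?_
          rw [Finset.mul_sum]
          refine Finset.sum_congr rfl fun k _ => ?_
          ring
      _ ≤ ∑ z, ∑ y, ψ z y * Bz z :=
          Finset.sum_le_sum fun z _ => Finset.sum_le_sum fun y _ =>
            mul_le_mul_of_nonneg_left (hzy z y) (hψ.1 _ _)
      _ = ∑ z, Bz z := by simp only [← Finset.sum_mul, hψ.2, one_mul]
      _ = _ := by
          simp only [hBz, ← Finset.mul_sum, Finset.sum_add_distrib, hQ.2]
          rw [Finset.sum_comm (s := (Finset.univ : Finset 𝒵))]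
          field_simp

open Classical in
lemma errC_nonneg {M0 M1 K : ℕ} (H : 𝒲 → 𝒰 → 𝒴 → ℝ) (D : 𝒲 → 𝒰 → 𝒴 → Prop)
    (hH0 : ∀ w u y, 0 ≤ H w u y) (hH1 : ∀ w u, ∑ y, H w u y ≤ 1)
    (w : Fin M0 → 𝒲) (u : Fin M0 × Fin M1 × Fin K → 𝒰) : 0 ≤ errC H D w u := by
  unfold errC
  refine mul_nonneg (by positivity) (Finset.sum_nonneg fun i _ => add_nonneg ?_
    (Finset.sum_nonneg fun i' _ => Finset.sum_nonneg fun y _ =>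
      mul_nonneg (hH0 _ _ _) (by positivity)))
  rw [sub_nonneg]
  refine le_trans (Finset.sum_le_sum fun y _ => ?_) (hH1 (w i.1) (u i))
  exact mul_le_of_le_one_right (hH0 _ _ _) (by split_ifs <;> norm_num)

open Classical in
lemma errC_exp {M0 M1 K : ℕ} (hM0 : 0 < M0) (hM1 : 0 < M1) (hK : 0 < K)
    (P0 : 𝒲 → ℝ) (P1 : 𝒲 → 𝒰 → ℝ)
    (h0 : ∑ w, P0 w = 1)
    (h1 : ∀ w, ∑ u, P1 w u = 1)
    (H : 𝒲 → 𝒰 → 𝒴 → ℝ) (D : 𝒲 → 𝒰 → 𝒴 → Prop) (es e1 e2 : ℝ) (he1 : 0 ≤ e1) (he2 : 0 ≤ e2)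
    (hs : 1 - ∑ w, ∑ u, P0 w * P1 w u * ∑ y, H w u y * (if D w u y then 1 else 0) ≤ es)
    (hsame : ∑ w, ∑ u, ∑ u', P0 w * P1 w u * P1 w u' *
      ∑ y, H w u y * (if D w u' y then 1 else 0) ≤ e1)
    (hdiff : ∑ w, ∑ w', ∑ u, ∑ u', P0 w * P0 w' * (P1 w u * P1 w' u' *
      ∑ y, H w u y * (if D w' u' y then 1 else 0)) ≤ e2) :
    ∑ w : Fin M0 → 𝒲, ∑ u : Fin M0 × Fin M1 × Fin K → 𝒰, cbw P0 P1 w u * errC H D w u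
      ≤ es + ((M1 * K : ℝ) - 1) * e1 + ((M0 * M1 * K : ℝ) - 1) * e2 := by
  set E : ((Fin M0 → 𝒲) → (Fin M0 × Fin M1 × Fin K → 𝒰) → ℝ) → ℝ := fun F =>
    ∑ w : Fin M0 → 𝒲, ∑ u : Fin M0 × Fin M1 × Fin K → 𝒰, cbw P0 P1 w u * F w u with hE
  set B := es + ((M1 * K : ℝ) - 1) * e1 + ((M0 * M1 * K : ℝ) - 1) * e2 with hB
  have hterm : ∀ i : Fin M0 × Fin M1 × Fin K, E (fun w u =>
    ((1 - ∑ y, H (w i.1) (u i) y * if D (w i.1) (u i) y then 1 else 0) +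
      ∑ i' ∈ Finset.univ.erase i, ∑ y, H (w i.1) (u i) y *
        if D (w i'.1) (u i') y then 1 else 0)) ≤ B := by
    intro i
    have hsplit : E (fun w u =>
      ((1 - ∑ y, H (w i.1) (u i) y * if D (w i.1) (u i) y then 1 else 0) +
      ∑ i' ∈ Finset.univ.erase i, ∑ y, H (w i.1) (u i) y *
        if D (w i'.1) (u i') y then 1 else 0)) =
      (1 - E (fun w u => ∑ y, H (w i.1) (u i) y * if D (w i.1) (u i) y then 1 else 0)) +
      ∑ i' ∈ Finset.univ.erase i, E (fun w u => ∑ y, H (w i.1) (u i) y *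
        if D (w i'.1) (u i') y then 1 else 0) := by
      simp only [hE]
      rw [Finset.sum_comm (s := Finset.univ.erase i)]
      rw [← cbw_one (A := Fin M0) (B := Fin M1) (K := Fin K) P0 P1 h0 h1]
      rw [← Finset.sum_sub_distrib, ← Finset.sum_add_distrib]
      refine Finset.sum_congr rfl fun w _ => ?_
      rw [Finset.sum_comm (s := Finset.univ.erase i)]
      rw [← Finset.sum_sub_distrib, ← Finset.sum_add_distrib]
      refine Finset.sum_congr rfl fun u _ => ?_
      rw [← Finset.mul_sum, cbw_one P0 P1 h0 h1]
      ring
    rw [hsplit]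
    have a1 := cbw_single (A := Fin M0) (B := Fin M1) (K := Fin K) P0 P1 h0 h1 i
      (fun w u => ∑ y, H w u y * if D w u y then 1 else 0)
    have a2 : E (fun w u => ∑ y, H (w i.1) (u i) y * if D (w i.1) (u i) y then 1 else 0) =
      ∑ w, ∑ u, P0 w * P1 w u * ∑ y, H w u y * (if D w u y then 1 else 0) := a1
    rw [a2]
    have a3 : ∀ i' ∈ Finset.univ.erase i, E (fun w u => ∑ y, H (w i.1) (u i) y *
        if D (w i'.1) (u i') y then 1 else 0) ≤ (if i.1 = i'.1 then e1 else 0) + e2 := by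
      intro i' hi'
      have hne : i ≠ i' := (Finset.ne_of_mem_erase hi').symm
      by_cases he : i.1 = i'.1
      · rw [if_pos he]
        have := cbw_same (A := Fin M0) (B := Fin M1) (K := Fin K) P0 P1 h0 h1 i i' hne he
          (fun w u u' => ∑ y, H w u y * if D w u' y then 1 else 0)
        have b : E (fun w u => ∑ y, H (w i.1) (u i) y *
          if D (w i'.1) (u i') y then 1 else 0) = ∑ w, ∑ u, ∑ u', P0 w * P1 w u * P1 w u' *
            ∑ y, H w u y * (if D w u' y then 1 else 0) := by
          rw [← this, ← he]
        rw [b]; linarith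
      · rw [if_neg he]
        have := cbw_diff (A := Fin M0) (B := Fin M1) (K := Fin K) P0 P1 h0 h1 i i' he
          (fun w u w' u' => ∑ y, H w u y * if D w' u' y then 1 else 0)
        have b : E (fun w u => ∑ y, H (w i.1) (u i) y *
          if D (w i'.1) (u i') y then 1 else 0) = ∑ w, ∑ w', ∑ u, ∑ u', P0 w * P0 w' *
            (P1 w u * P1 w' u' * ∑ y, H w u y * (if D w' u' y then 1 else 0)) := this
        rw [b]; linarith
    have a4 : ∑ i' ∈ Finset.univ.erase i, ((if i.1 = i'.1 then e1 else 0) + e2) =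
        ((M1 * K : ℝ) - 1) * e1 + ((M0 * M1 * K : ℝ) - 1) * e2 := by
      rw [Finset.sum_erase_eq_sub (Finset.mem_univ i)]
      have := sum_fst (M0 := M0) (M1 := M1) (K := K) (fun a => (if i.1 = a then e1 else 0) + e2)
      rw [this]
      simp only [Finset.sum_add_distrib, Finset.sum_const, Finset.card_univ, Fintype.card_fin,
        nsmul_eq_mul, Finset.sum_ite_eq, Finset.mem_univ, if_true]
      ring
    have a5 := Finset.sum_le_sum a3
    rw [a4] at a5
    rw [hB]
    linarith
  have hfin : ∑ w : Fin M0 → 𝒲, ∑ u : Fin M0 × Fin M1 × Fin K → 𝒰, cbw P0 P1 w u * errC H D w u =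
      (1 / ((M0 * M1 : ℕ) * (K : ℝ))) * ∑ i, E (fun w u =>
    ((1 - ∑ y, H (w i.1) (u i) y * if D (w i.1) (u i) y then 1 else 0) +
      ∑ i' ∈ Finset.univ.erase i, ∑ y, H (w i.1) (u i) y *
        if D (w i'.1) (u i') y then 1 else 0)) := by
    simp only [hE, errC]
    rw [Finset.sum_comm (s := (Finset.univ : Finset (Fin M0 × Fin M1 × Fin K))), Finset.mul_sum]
    refine Finset.sum_congr rfl fun w _ => ?_
    rw [Finset.sum_comm (s := (Finset.univ : Finset (Fin M0 × Fin M1 × Fin K))), Finset.mul_sum]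
    refine Finset.sum_congr rfl fun u _ => ?_
    rw [← Finset.mul_sum]
    ring
  rw [hfin]
  have hMr : (0 : ℝ) < M0 := by exact_mod_cast hM0
  have hMr1 : (0 : ℝ) < M1 := by exact_mod_cast hM1
  have hKr : (0 : ℝ) < K := by exact_mod_cast hK
  calc _ ≤ (1 / ((M0 * M1 : ℕ) * (K : ℝ))) * ∑ i : Fin M0 × Fin M1 × Fin K, B := by
        refine mul_le_mul_of_nonneg_left (Finset.sum_le_sum fun i _ => hterm i) (by positivity)
    _ = B := by
        simp only [Finset.sum_const, Finset.card_univ, Fintype.card_prod, Fintype.card_fin,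
          nsmul_eq_mul]
        push_cast
        field_simp

open Classical in
theorem oneshot {M0 M1 K : ℕ} (hM0 : 0 < M0) (hM1 : 0 < M1) (hK : 0 < K)
    (P0 : 𝒲 → ℝ) (P1 : 𝒲 → 𝒰 → ℝ)
    (h0n : ∀ w, 0 ≤ P0 w) (h0 : ∑ w, P0 w = 1)
    (h1n : ∀ w u, 0 ≤ P1 w u) (h1 : ∀ w, ∑ u, P1 w u = 1)
    (fe : 𝒲 → 𝒰 → 𝒳 → ℝ) (hfe0 : ∀ w u x, 0 ≤ fe w u x) (hfe1 : ∀ w u, ∑ x, fe w u x ≤ 1)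
    (x0 : 𝒳) (T : 𝒳 → 𝒴 → ℝ) (Q : 𝒳 → 𝒵 → ℝ) (hT : IsChannel T) (hQ : IsChannel Q)
    (D : 𝒲 → 𝒰 → 𝒴 → Prop)
    (gz : Θ → 𝒵 → 𝒲 → 𝒰 → ℝ) (hgz0 : ∀ θ z w u, 0 ≤ gz θ z w u)
    (hgz : ∀ w u z, ∑ x, fe w u x * Q x z ≤ ∑ θ, gz θ z w u)
    (es e1 e2 ee G : ℝ) (he1 : 0 ≤ e1) (he2 : 0 ≤ e2) (hee : 0 < ee) (hG : 0 < G)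
    (hs : 1 - ∑ w, ∑ u, P0 w * P1 w u *
      ∑ y, (∑ x, fe w u x * T x y) * (if D w u y then 1 else 0) ≤ es)
    (hsame : ∑ w, ∑ u, ∑ u', P0 w * P1 w u * P1 w u' *
      ∑ y, (∑ x, fe w u x * T x y) * (if D w u' y then 1 else 0) ≤ e1)
    (hdiff : ∑ w, ∑ w', ∑ u, ∑ u', P0 w * P0 w' * (P1 w u * P1 w' u' *
      ∑ y, (∑ x, fe w u x * T x y) * (if D w' u' y then 1 else 0)) ≤ e2)
    (hle : es + ((M1 * K : ℝ) - 1) * e1 + ((M0 * M1 * K : ℝ) - 1) * e2 ≤ ee)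
    (hsec : ∑ θ, ∑ z, ∑ w : Fin M0 → 𝒲, ∑ u : Fin M0 × Fin M1 × Fin K → 𝒰,
      cbw P0 P1 w u * maxKey (gz θ z) w u ≤ G) :
    ∃ (f : Fin (M0 * M1) × Fin K → 𝒳 → ℝ) (φ : 𝒴 × Fin K → Option (Fin (M0 * M1)) → ℝ),
      IsChannel f ∧ IsChannel φ ∧
      1 - (1 / ((M0 * M1 : ℕ) * (K : ℝ))) * ∑ m, ∑ k, ∑ x, ∑ y,
        φ (y, k) (some m) * T x y * f (m, k) x ≤ 2 * ee ∧
      ∀ ψ : 𝒵 → 𝒴 → ℝ, IsChannel ψ →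
        ∑ z, ∑ m, ∑ k, ((1 / ((M0 * M1 : ℕ) * (K : ℝ))) * (∑ x, Q x z * f (m, k) x)) *
          ∑ y, ψ z y * ∑ m' ∈ Finset.univ.erase m, φ (y, k) (some m') ≤
        1 / K + 2 * G / ((M0 * M1 : ℕ) * (K : ℝ)) := by
  have hH0 : ∀ w u y, 0 ≤ ∑ x, fe w u x * T x y := fun w u y =>
    Finset.sum_nonneg fun x _ => mul_nonneg (hfe0 _ _ _) (hT.1 _ _)
  have hH1 : ∀ w u, ∑ y, ∑ x, fe w u x * T x y ≤ 1 := by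
    intro w u
    rw [Finset.sum_comm]
    simp only [← Finset.mul_sum, hT.2, mul_one]
    exact hfe1 w u
  obtain ⟨⟨w, u⟩, hw1, hw2⟩ := exists_le_of_avg
    (Ω := (Fin M0 → 𝒲) × (Fin M0 × Fin M1 × Fin K → 𝒰))
    (fun c => cbw P0 P1 c.1 c.2) (fun c => cbw_nonneg P0 P1 h0n h1n _ _)
    (by rw [Fintype.sum_prod_type]; exact cbw_one P0 P1 h0 h1)
    (fun c => errC (fun w u y => ∑ x, fe w u x * T x y) D c.1 c.2)
    (fun c => ∑ θ, ∑ z, maxKey (gz θ z) c.1 c.2)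
    (fun c => errC_nonneg _ D hH0 hH1 _ _)
    (fun c => Finset.sum_nonneg fun θ _ => Finset.sum_nonneg fun z _ =>
      maxKey_nonneg _ (hgz0 θ z) _ _) ee G hee hG
    (by
      rw [Fintype.sum_prod_type]
      exact (errC_exp hM0 hM1 hK P0 P1 h0 h1 _ D es e1 e2 he1 he2 hs hsame hdiff).trans hle)
    (by
      refine le_trans (le_of_eq ?_) hsec
      simp only [Finset.mul_sum]
      rw [Finset.sum_comm]
      refine Finset.sum_congr rfl fun θ _ => ?_
      rw [Finset.sum_comm]
      refine Finset.sum_congr rfl fun z _ => ?_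
      rw [Fintype.sum_prod_type])
  obtain ⟨f, φ, hf, hφ, he, ha⟩ := codebook_det hM0 hM1 hK fe hfe0 hfe1 x0 T Q hT hQ D gz hgz w u
  refine ⟨f, φ, hf, hφ, he.trans hw1, fun ψ hψ => (ha ψ hψ).trans ?_⟩
  refine add_le_add le_rfl (div_le_div_of_nonneg_right hw2 (by positivity))

end OneShot

set_option linter.unusedSectionVars false

/-! ### Method of types -/

section Types

variable {S B : Type*} [Fintype S] [Fintype B]

open Classical in
/-- empirical distribution -/
def ty {n : ℕ} (s : Fin n → S) (a : S) : ℝ := (∑ l, if s l = a then (1 : ℝ) else 0) / n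

open Classical in
/-- push forward of a weight function -/
def push (p : S → B) (θ : S → ℝ) (b : B) : ℝ := ∑ a, if p a = b then θ a else 0

/-- entropy in nats -/
def ent (θ : S → ℝ) : ℝ := ∑ a, Real.negMulLog (θ a)

lemma ty_nonneg {n : ℕ} (s : Fin n → S) (a : S) : 0 ≤ ty s a := by
  unfold ty
  refine div_nonneg (Finset.sum_nonneg fun _ _ => ?_) (Nat.cast_nonneg n)
  split_ifs <;> norm_num

lemma sum_eq_ty {n : ℕ} (hn : 0 < n) (s : Fin n → S) (F : S → ℝ) :
    ∑ l, F (s l) = n * ∑ a, ty s a * F a := by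
  classical
  have hn' : (n : ℝ) ≠ 0 := by positivity
  rw [Finset.mul_sum]
  have : ∀ a, (n : ℝ) * (ty s a * F a) = ∑ l, if s l = a then F a else 0 := by
    intro a
    unfold ty
    rw [← mul_assoc, mul_div_cancel₀ _ hn', Finset.sum_mul]
    refine Finset.sum_congr rfl fun l _ => ?_
    split_ifs <;> simp_all
  simp only [this]
  rw [Finset.sum_comm]
  refine Finset.sum_congr rfl fun l _ => ?_
  simp

lemma sum_ty {n : ℕ} (hn : 0 < n) (s : Fin n → S) : ∑ a, ty s a = 1 := by
  have h := sum_eq_ty hn s (fun _ => 1)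
  have hn' : (n : ℝ) ≠ 0 := by positivity
  simp only [Finset.sum_const, Finset.card_univ, Fintype.card_fin, nsmul_eq_mul, mul_one] at h
  have := mul_left_cancel₀ hn' (h.symm.trans (mul_one _).symm)
  exact this

lemma ty_pos {n : ℕ} (hn : 0 < n) (s : Fin n → S) (l : Fin n) : 0 < ty s (s l) := by
  classical
  unfold ty
  refine div_pos ?_ (by exact_mod_cast hn)
  refine lt_of_lt_of_le one_pos ?_
  have := Finset.single_le_sum (s := Finset.univ) (f := fun l' => if s l' = s l then (1 : ℝ) else 0)
    (fun _ _ => by positivity) (Finset.mem_univ l)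
  simpa using this

lemma push_ty {n : ℕ} (p : S → B) (s : Fin n → S) (b : B) :
    push p (ty s) b = ty (fun l => p (s l)) b := by
  classical
  unfold push ty
  have : ∀ a, (if p a = b then (∑ l, if s l = a then (1 : ℝ) else 0) / n else 0) =
      (∑ l, if s l = a then (if p a = b then (1 : ℝ) else 0) else 0) / n := by
    intro a
    split_ifs <;> simp
  simp only [this]
  rw [← Finset.sum_div, Finset.sum_comm]
  congr 1
  refine Finset.sum_congr rfl fun l _ => ?_
  simp

lemma push_nonneg (p : S → B) (θ : S → ℝ) (hθ : ∀ a, 0 ≤ θ a) (b : B) : 0 ≤ push p θ b := by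
  unfold push
  refine Finset.sum_nonneg fun a _ => ?_
  split_ifs
  · exact hθ a
  · exact le_rfl

lemma le_push (p : S → B) (θ : S → ℝ) (hθ : ∀ a, 0 ≤ θ a) (a : S) : θ a ≤ push p θ (p a) := by
  classical
  unfold push
  have := Finset.single_le_sum (s := Finset.univ) (f := fun a' => if p a' = p a then θ a' else 0)
    (fun a' _ => by split_ifs; exacts [hθ _, le_rfl]) (Finset.mem_univ a)
  simpa using this

lemma sum_push (p : S → B) (θ : S → ℝ) (F : B → ℝ) :
    ∑ b, push p θ b * F b = ∑ a, θ a * F (p a) := by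
  classical
  unfold push
  simp only [Finset.sum_mul]
  rw [Finset.sum_comm]
  refine Finset.sum_congr rfl fun a _ => ?_
  simp [ite_mul]

lemma sum_push_one (p : S → B) (θ : S → ℝ) : ∑ b, push p θ b = ∑ a, θ a := by
  have := sum_push p θ (fun _ => 1)
  simpa using this

lemma push_push {C : Type*} (p : S → B) (p' : B → C) (θ : S → ℝ) :
    push p' (push p θ) = push (fun a => p' (p a)) θ := by
  classical
  funext c
  have := sum_push p θ (fun b => if p' b = c then 1 else 0)
  simp only [mul_ite, mul_one, mul_zero] at this
  rw [push.eq_1 p', push.eq_1 (fun a => p' (p a))]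
  refine Eq.trans ?_ (this.trans ?_)
  · exact Finset.sum_congr rfl fun _ _ => by congr
  · exact Finset.sum_congr rfl fun _ _ => by congr

lemma ent_eq (θ : S → ℝ) : ent θ = -∑ a, θ a * Real.log (θ a) := by
  unfold ent Real.negMulLog
  simp

lemma ent_push (p : S → B) (θ : S → ℝ) :
    ent (push p θ) = -∑ a, θ a * Real.log (push p θ (p a)) := by
  rw [ent_eq, sum_push p θ (fun b => Real.log (push p θ b))]

open Classical in
lemma type_count {n : ℕ} (hn : 0 < n) (p : S → B) (β : Fin n → B) (θ : S → ℝ)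
    (g h : S → ℝ) (hg : ∀ s, 0 ≤ g s) (hgh : ∀ s, g s ≤ Real.exp (h s)) :
    ∑ s : Fin n → S, (if ty s = θ ∧ (∀ l, p (s l) = β l) then ∏ l, g (s l) else 0) ≤
      Real.exp (n * (ent θ - ent (push p θ) + ∑ a, θ a * h a)) := by
  by_cases hne : ∃ s : Fin n → S, ty s = θ
  swap
  · push Not at hne
    rw [Finset.sum_eq_zero]
    · positivity
    · intro s _
      simp [hne s]
  have hθ : ∀ a, 0 ≤ θ a := by
    obtain ⟨s, rfl⟩ := hne
    exact ty_nonneg s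
  set C := Real.exp (n * (ent θ - ent (push p θ) + ∑ a, θ a * h a)) with hC
  have hterm : ∀ s : Fin n → S,
      (if ty s = θ ∧ (∀ l, p (s l) = β l) then ∏ l, g (s l) else 0) ≤
      C * ∏ l, (if p (s l) = β l then θ (s l) / push p θ (β l) else 0) := by
    intro s
    split_ifs with hs
    · obtain ⟨h1, h2⟩ := hs
      have hpos : ∀ l, 0 < θ (s l) := fun l => by rw [← h1]; exact ty_pos hn s l
      have hpos2 : ∀ l, 0 < push p θ (β l) := fun l => by
        rw [← h2 l]; exact (hpos l).trans_le (le_push p θ hθ _)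
      have e1 : ∏ l, (if p (s l) = β l then θ (s l) / push p θ (β l) else 0) =
          Real.exp (∑ l, (Real.log (θ (s l)) - Real.log (push p θ (p (s l))))) := by
        rw [Real.exp_sum]
        refine Finset.prod_congr rfl fun l _ => ?_
        rw [if_pos (h2 l), h2 l, Real.exp_sub, Real.exp_log (hpos l), Real.exp_log (hpos2 l)]
      rw [e1, hC, ← Real.exp_add]
      rw [sum_eq_ty hn s (fun a => Real.log (θ a) - Real.log (push p θ (p a))), h1]
      have e2 : (n : ℝ) * (ent θ - ent (push p θ) + ∑ a, θ a * h a) +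
          n * ∑ a, θ a * (Real.log (θ a) - Real.log (push p θ (p a))) = ∑ l, h (s l) := by
        rw [sum_eq_ty hn s h, h1, ent_eq, ent_push]
        simp only [mul_sub, Finset.sum_sub_distrib]
        ring
      rw [e2, Real.exp_sum]
      exact Finset.prod_le_prod (fun l _ => hg _) (fun l _ => hgh _)
    · refine mul_nonneg (Real.exp_pos _).le (Finset.prod_nonneg fun l _ => ?_)
      split_ifs
      · exact div_nonneg (hθ _) (push_nonneg p θ hθ _)
      · exact le_rfl
  refine (Finset.sum_le_sum fun s _ => hterm s).trans ?_
  rw [← Finset.mul_sum, sum_prod_pi (fun l a => if p a = β l then θ a / push p θ (β l) else 0)]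
  refine mul_le_of_le_one_right (Real.exp_pos _).le (Finset.prod_le_one ?_ ?_)
  · intro l _
    refine Finset.sum_nonneg fun a _ => ?_
    split_ifs
    · exact div_nonneg (hθ _) (push_nonneg p θ hθ _)
    · exact le_rfl
  · intro l _
    have : ∑ a, (if p a = β l then θ a / push p θ (β l) else 0) =
        push p θ (β l) / push p θ (β l) := by
      nth_rewrite 2 [push]
      rw [Finset.sum_div]
      refine Finset.sum_congr rfl fun a _ => ?_
      split_ifs <;> simp
    rw [this]
    exact div_self_le_one _

open Classical in
lemma type_count_inj {n : ℕ} (hn : 0 < n) (p : S → B) (β : Fin n → B) (θ : S → ℝ)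
    (g h : S → ℝ) (hg : ∀ s, 0 ≤ g s) (hgh : ∀ s, g s ≤ Real.exp (h s))
    {I : Type*} [Fintype I] (e : I → Fin n → S) (he : Function.Injective e)
    (hp : ∀ i l, p (e i l) = β l) :
    ∑ i, (if ty (e i) = θ then ∏ l, g (e i l) else 0) ≤
      Real.exp (n * (ent θ - ent (push p θ) + ∑ a, θ a * h a)) := by
  refine le_trans ?_ (type_count hn p β θ g h hg hgh)
  rw [← Finset.sum_image (s := Finset.univ) (g := e)
    (f := fun s => if ty s = θ then ∏ l, g (s l) else 0) (fun a _ b _ hab => he hab)]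
  refine le_trans (Finset.sum_le_sum (g := fun s =>
    if ty s = θ ∧ (∀ l, p (s l) = β l) then ∏ l, g (s l) else 0) fun s hs => ?_) ?_
  · obtain ⟨i, -, rfl⟩ := Finset.mem_image.1 hs
    simp [hp i]
  · refine Finset.sum_le_sum_of_subset_of_nonneg (Finset.subset_univ _) fun s _ _ => ?_
    split_ifs
    · exact Finset.prod_nonneg fun l _ => hg _
    · exact le_rfl

lemma ent_unit (θ : S → ℝ) (h : ∑ a, θ a = 1) : ent (push (fun _ => ()) θ) = 0 := by
  have h1 := sum_push_one (fun _ : S => ()) θ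
  simp only [Finset.univ_unique, Finset.sum_singleton] at h1
  unfold ent
  simp only [Finset.univ_unique, Finset.sum_singleton]
  rw [h1, h]; simp

end Types

set_option linter.unusedSectionVars false

/-! ### Secrecy bound for a fixed type -/

section Sec

variable {W U X Z : Type*} [Fintype W] [Fintype U] [Fintype X] [Fintype Z]

/-- combine four sequences -/
def comb {n : ℕ} (w : Fin n → W) (u : Fin n → U) (x : Fin n → X) (z : Fin n → Z) :
    Fin n → W × U × X × Z := fun l => (w l, u l, x l, z l)

open Classical in
/-- part of the adversary's observation probability of joint type `θ` -/
def gth (n : ℕ) (ρ : U → X → ℝ) (q : X → Z → ℝ) (θ : W × U × X × Z → ℝ)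
    (z : Fin n → Z) (w : Fin n → W) (u : Fin n → U) : ℝ :=
  ∑ x : Fin n → X, if ty (comb w u x z) = θ then ∏ l, ρ (u l) (x l) * q (x l) (z l) else 0

/-- exponents -/
def Psi1 (τ : W → ℝ) (σ : W → U → ℝ) (ρ : U → X → ℝ) (q : X → Z → ℝ)
    (θ : W × U × X × Z → ℝ) : ℝ :=
  ent θ + ∑ a, θ a * (Real.log (τ a.1) + Real.log (σ a.1 a.2.1) + Real.log (ρ a.2.1 a.2.2.1) +
    Real.log (q a.2.2.1 a.2.2.2))

/-- projections -/
def pWUZ (a : W × U × X × Z) : W × U × Z := (a.1, a.2.1, a.2.2.2)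
/-- projections -/
def pWZ (a : W × U × X × Z) : W × Z := (a.1, a.2.2.2)
/-- projections -/
def pZ (a : W × U × X × Z) : Z := a.2.2.2
/-- projections -/
def pWUX (a : W × U × X × Z) : W × U × X := (a.1, a.2.1, a.2.2.1)

/-- exponents -/
def Psi2 (ρ : U → X → ℝ) (q : X → Z → ℝ) (θ : W × U × X × Z → ℝ) : ℝ :=
  ent (push pZ θ) + (ent θ - ent (push pWUZ θ) +
    ∑ a, θ a * (Real.log (ρ a.2.1 a.2.2.1) + Real.log (q a.2.2.1 a.2.2.2)))

/-- exponents -/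
def Psi3 (τ : W → ℝ) (θ : W × U × X × Z → ℝ) : ℝ :=
  ent (push pWZ θ) - ent (push pZ θ) + ∑ a, θ a * Real.log (τ a.1)

lemma le_exp_log' {x : ℝ} (_hx : 0 ≤ x) : x ≤ Real.exp (Real.log x) := Real.le_exp_log x

lemma gth_nonneg (n : ℕ) (ρ : U → X → ℝ) (q : X → Z → ℝ) (hρ : ∀ u x, 0 ≤ ρ u x)
    (hq : ∀ x z, 0 ≤ q x z) (θ : W × U × X × Z → ℝ) (z : Fin n → Z) (w : Fin n → W)
    (u : Fin n → U) : 0 ≤ gth n ρ q θ z w u := by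
  unfold gth
  refine Finset.sum_nonneg fun x _ => ?_
  split_ifs
  · exact Finset.prod_nonneg fun l _ => mul_nonneg (hρ _ _) (hq _ _)
  · exact le_rfl

lemma gth_le {n : ℕ} (hn : 0 < n) (ρ : U → X → ℝ) (q : X → Z → ℝ) (hρ : ∀ u x, 0 ≤ ρ u x)
    (hq : ∀ x z, 0 ≤ q x z) (θ : W × U × X × Z → ℝ) (z : Fin n → Z) (w : Fin n → W)
    (u : Fin n → U) : gth n ρ q θ z w u ≤ Real.exp (n * (ent θ - ent (push pWUZ θ) +
    ∑ a, θ a * (Real.log (ρ a.2.1 a.2.2.1) + Real.log (q a.2.2.1 a.2.2.2)))) := by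
  classical
  have := type_count_inj hn pWUZ (fun l => (w l, u l, z l)) θ
    (fun a : W × U × X × Z => ρ a.2.1 a.2.2.1 * q a.2.2.1 a.2.2.2)
    (fun a => Real.log (ρ a.2.1 a.2.2.1) + Real.log (q a.2.2.1 a.2.2.2))
    (fun a => mul_nonneg (hρ _ _) (hq _ _))
    (fun a => by
      rw [Real.exp_add]
      exact mul_le_mul (Real.le_exp_log _) (Real.le_exp_log _) (hq _ _) (Real.exp_pos _).le)
    (fun x : Fin n → X => comb w u x z)
    (fun x x' h => by
      funext l
      have := congrFun h l
      simp only [comb, Prod.mk.injEq] at this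
      exact this.2.2.1)
    (fun x l => rfl)
  refine le_trans (le_of_eq ?_) this
  unfold gth
  exact Finset.sum_congr rfl fun x _ => by congr

lemma gth_type {n : ℕ} (ρ : U → X → ℝ) (q : X → Z → ℝ) (θ : W × U × X × Z → ℝ) (z : Fin n → Z)
    (w : Fin n → W) (u : Fin n → U) (h : ty (fun l => (w l, z l)) ≠ push pWZ θ) :
    gth n ρ q θ z w u = 0 := by
  unfold gth
  refine Finset.sum_eq_zero fun x _ => ?_
  rw [if_neg]
  rintro rfl
  apply h
  funext b
  rw [push_ty]
  rfl

/-- the total mass -/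
lemma gth_total {n : ℕ} (hn : 0 < n) (τ : W → ℝ) (σ : W → U → ℝ) (ρ : U → X → ℝ) (q : X → Z → ℝ)
    (hτ : ∀ w, 0 ≤ τ w) (hσ : ∀ w u, 0 ≤ σ w u) (hρ : ∀ u x, 0 ≤ ρ u x)
    (hq : ∀ x z, 0 ≤ q x z) (θ : W × U × X × Z → ℝ) :
    ∑ z : Fin n → Z, ∑ w : Fin n → W, ∑ u : Fin n → U,
      (∏ l, τ (w l)) * (∏ l, σ (w l) (u l)) * gth n ρ q θ z w u ≤
        Real.exp (n * Psi1 τ σ ρ q θ) := by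
  classical
  have hg0 : ∀ a : W × U × X × Z,
      0 ≤ τ a.1 * σ a.1 a.2.1 * ρ a.2.1 a.2.2.1 * q a.2.2.1 a.2.2.2 := fun a =>
    mul_nonneg (mul_nonneg (mul_nonneg (hτ _) (hσ _ _)) (hρ _ _)) (hq _ _)
  by_cases hne : ∃ s : Fin n → W × U × X × Z, ty s = θ
  swap
  · push Not at hne
    have : ∀ z w u, gth n ρ q θ z w u = 0 := by
      intro z w u
      unfold gth
      exact Finset.sum_eq_zero fun x _ => by rw [if_neg (hne _)]
    simp only [this, mul_zero, Finset.sum_const_zero]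
    positivity
  have hθ1 : ∑ a, θ a = 1 := by
    obtain ⟨s, rfl⟩ := hne
    exact sum_ty hn s
  have := type_count_inj hn (fun _ : W × U × X × Z => ()) (fun _ => ()) θ
    (fun a => τ a.1 * σ a.1 a.2.1 * ρ a.2.1 a.2.2.1 * q a.2.2.1 a.2.2.2)
    (fun a => Real.log (τ a.1) + Real.log (σ a.1 a.2.1) + Real.log (ρ a.2.1 a.2.2.1) +
      Real.log (q a.2.2.1 a.2.2.2)) hg0
    (fun a => by
      rw [Real.exp_add, Real.exp_add, Real.exp_add]
      have h1 : τ a.1 * σ a.1 a.2.1 ≤ Real.exp (Real.log (τ a.1)) *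
          Real.exp (Real.log (σ a.1 a.2.1)) :=
        mul_le_mul (Real.le_exp_log _) (Real.le_exp_log _) (hσ _ _) (Real.exp_pos _).le
      have h2 := mul_le_mul h1 (Real.le_exp_log (ρ a.2.1 a.2.2.1)) (hρ _ _) (by positivity)
      exact mul_le_mul h2 (Real.le_exp_log _) (hq _ _) (by positivity))
    (I := (Fin n → Z) × (Fin n → W) × (Fin n → U) × (Fin n → X))
    (fun i => comb i.2.1 i.2.2.1 i.2.2.2 i.1)
    (fun i i' h => by
      have : ∀ l, _ := fun l => congrFun h l
      simp only [comb, Prod.mk.injEq] at this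
      refine Prod.ext (funext fun l => (this l).2.2.2) (Prod.ext (funext fun l => (this l).1)
        (Prod.ext (funext fun l => (this l).2.1) (funext fun l => (this l).2.2.1))))
    (fun _ _ => rfl)
  rw [ent_unit θ hθ1, sub_zero] at this
  refine le_trans (le_of_eq ?_) this
  simp only [Fintype.sum_prod_type]
  refine Finset.sum_congr rfl fun z _ => Finset.sum_congr rfl fun w _ =>
    Finset.sum_congr rfl fun u _ => ?_
  unfold gth
  rw [Finset.mul_sum]
  refine Finset.sum_congr rfl fun x _ => ?_
  simp only [comb, mul_ite, mul_zero, ← Finset.prod_mul_distrib, mul_assoc]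

lemma gth_total_one {n : ℕ} (τ : W → ℝ) (σ : W → U → ℝ) (ρ : U → X → ℝ) (q : X → Z → ℝ)
    (hτ : IsDist τ) (hσ : IsChannel σ) (hρ : IsChannel ρ) (hq : IsChannel q)
    (θ : W × U × X × Z → ℝ) :
    ∑ z : Fin n → Z, ∑ w : Fin n → W, ∑ u : Fin n → U,
      (∏ l, τ (w l)) * (∏ l, σ (w l) (u l)) * gth n ρ q θ z w u ≤ 1 := by
  classical
  have h1 : ∀ z w u, gth n ρ q θ z w u ≤ ∑ x : Fin n → X, ∏ l, ρ (u l) (x l) * q (x l) (z l) := by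
    intro z w u
    unfold gth
    refine Finset.sum_le_sum fun x _ => ?_
    split_ifs
    · exact le_rfl
    · exact Finset.prod_nonneg fun l _ => mul_nonneg (hρ.1 _ _) (hq.1 _ _)
  calc _ ≤ ∑ z : Fin n → Z, ∑ w : Fin n → W, ∑ u : Fin n → U,
      (∏ l, τ (w l)) * (∏ l, σ (w l) (u l)) *
        ∑ x : Fin n → X, ∏ l, ρ (u l) (x l) * q (x l) (z l) :=
        Finset.sum_le_sum fun z _ => Finset.sum_le_sum fun w _ => Finset.sum_le_sum fun u _ =>
          mul_le_mul_of_nonneg_left (h1 z w u) (mul_nonneg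
            (Finset.prod_nonneg fun l _ => hτ.1 _) (Finset.prod_nonneg fun l _ => hσ.1 _ _))
    _ = ∑ w : Fin n → W, (∏ l, τ (w l)) * ∑ u : Fin n → U, (∏ l, σ (w l) (u l)) *
        ∑ x : Fin n → X, (∏ l, ρ (u l) (x l)) * ∑ z : Fin n → Z, ∏ l, q (x l) (z l) := by
        rw [Finset.sum_comm]
        refine Finset.sum_congr rfl fun w _ => ?_
        rw [Finset.sum_comm, Finset.mul_sum]
        refine Finset.sum_congr rfl fun u _ => ?_
        rw [← mul_assoc, ← Finset.mul_sum]
        congr 1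
        rw [Finset.sum_comm]
        refine Finset.sum_congr rfl fun x _ => ?_
        rw [Finset.mul_sum]
        simp only [Finset.prod_mul_distrib]
    _ = 1 := by
        have a1 : ∀ x : Fin n → X, ∑ z : Fin n → Z, ∏ l, q (x l) (z l) = 1 := fun x => by
          rw [sum_prod_pi (fun l => q (x l))]; simp [hq.2]
        have a2 : ∀ u : Fin n → U, ∑ x : Fin n → X, ∏ l, ρ (u l) (x l) = 1 := fun u => by
          rw [sum_prod_pi (fun l => ρ (u l))]; simp [hρ.2]
        have a3 : ∀ w : Fin n → W, ∑ u : Fin n → U, ∏ l, σ (w l) (u l) = 1 := fun w => by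
          rw [sum_prod_pi (fun l => σ (w l))]; simp [hσ.2]
        simp only [a1, mul_one, a2, a3]
        exact sum_prod_one τ hτ.2 n
    _ ≤ 1 := le_rfl

lemma sec_A {n M0 M1 K : ℕ} (hn : 0 < n) (hK : 0 < K) (τ : W → ℝ) (σ : W → U → ℝ)
    (ρ : U → X → ℝ) (q : X → Z → ℝ)
    (hτ : IsDist τ) (hσ : IsChannel σ) (hρ : IsChannel ρ) (hq : IsChannel q)
    (θ : W × U × X × Z → ℝ) :
    ∑ z : Fin n → Z, ∑ w : Fin M0 → Fin n → W, ∑ u : Fin M0 × Fin M1 × Fin K → Fin n → U,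
      cbw (fun w => ∏ l, τ (w l)) (nfold σ n) w u * maxKey (gth n ρ q θ z) w u ≤
      M0 * M1 * K * Real.exp (n * Psi1 τ σ ρ q θ) := by
  have : Nonempty (Fin K) := ⟨⟨0, hK⟩⟩
  calc _ ≤ ∑ z : Fin n → Z, ((M0 * M1 * K : ℝ) * ∑ w : Fin n → W, ∑ u : Fin n → U,
      (∏ l, τ (w l)) * (∏ l, σ (w l) (u l)) * gth n ρ q θ z w u) := by
        refine Finset.sum_le_sum fun z _ => ?_
        have := maxKey_exp' (A := Fin M0) (B := Fin M1) (K := Fin K)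
          (fun w : Fin n → W => ∏ l, τ (w l)) (nfold σ n)
          (fun w => Finset.prod_nonneg fun l _ => hτ.1 _) (sum_prod_one τ hτ.2 n)
          (fun w u => Finset.prod_nonneg fun l _ => hσ.1 _ _)
          (fun w => by unfold nfold; rw [sum_prod_pi (fun l => σ (w l))]; simp [hσ.2])
          (gth n ρ q θ z) (gth_nonneg n ρ q hρ.1 hq.1 θ z)
        simp only [Fintype.card_fin] at this
        exact this
    _ ≤ _ := by
        rw [← Finset.mul_sum]
        exact mul_le_mul_of_nonneg_left (gth_total hn τ σ ρ q hτ.1 hσ.1 hρ.1 hq.1 θ)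
          (by positivity)

lemma sec_B {n M0 M1 K : ℕ} (hn : 0 < n) (hK : 0 < K) (τ : W → ℝ) (σ : W → U → ℝ)
    (ρ : U → X → ℝ) (q : X → Z → ℝ)
    (hτ : IsDist τ) (hσ : IsChannel σ) (hρ : IsChannel ρ) (hq : IsChannel q)
    (θ : W × U × X × Z → ℝ) (hθ : ∑ a, θ a = 1) :
    ∑ z : Fin n → Z, ∑ w : Fin M0 → Fin n → W, ∑ u : Fin M0 × Fin M1 × Fin K → Fin n → U,
      cbw (fun w => ∏ l, τ (w l)) (nfold σ n) w u * maxKey (gth n ρ q θ z) w u ≤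
      Real.log K * Real.exp (n * Psi2 ρ q θ) * min 1 (M0 * Real.exp (n * Psi3 τ θ)) +
        2 * (M0 * M1) := by
  classical
  have : Nonempty (Fin K) := ⟨⟨0, hK⟩⟩
  set c := Real.exp (n * (ent θ - ent (push pWUZ θ) +
    ∑ a, θ a * (Real.log (ρ a.2.1 a.2.2.1) + Real.log (q a.2.2.1 a.2.2.2)))) with hc
  have hcK : 0 ≤ c * Real.log K :=
    mul_nonneg (Real.exp_pos _).le (Real.log_nonneg (by exact_mod_cast hK))
  have h1 : ∀ z : Fin n → Z, ∑ w : Fin M0 → Fin n → W,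
      ∑ u : Fin M0 × Fin M1 × Fin K → Fin n → U,
      cbw (fun w => ∏ l, τ (w l)) (nfold σ n) w u * maxKey (gth n ρ q θ z) w u ≤
      c * Real.log K * ((if ty z = push pZ θ then 1 else 0) *
        min 1 (M0 * Real.exp (n * Psi3 τ θ))) +
      2 * (M0 * M1) * ∑ w : Fin n → W, ∑ u : Fin n → U,
        (∏ l, τ (w l)) * (∏ l, σ (w l) (u l)) * gth n ρ q θ z w u := by
    intro z
    have := maxKey_exp (A := Fin M0) (B := Fin M1) (K := Fin K)
          (fun w : Fin n → W => ∏ l, τ (w l)) (nfold σ n)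
          (fun w => Finset.prod_nonneg fun l _ => hτ.1 _) (sum_prod_one τ hτ.2 n)
          (fun w u => Finset.prod_nonneg fun l _ => hσ.1 _ _)
          (fun w => by unfold nfold; rw [sum_prod_pi (fun l => σ (w l))]; simp [hσ.2])
          (gth n ρ q θ z) c (Real.exp_pos _) (gth_nonneg n ρ q hρ.1 hq.1 θ z)
          (gth_le hn ρ q hρ.1 hq.1 θ z)
          (fun w => ty (fun l => (w l, z l)) = push pWZ θ)
          (fun w u h => gth_type ρ q θ z w u h)
    simp only [Fintype.card_fin] at this
    refine this.trans (add_le_add (mul_le_mul_of_nonneg_left ?_ hcK) le_rfl)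
    split_ifs with hz
    · rw [one_mul]
      refine min_le_min le_rfl (mul_le_mul_of_nonneg_left ?_ (by positivity))
      have h2 := type_count_inj hn (fun a : W × Z => a.2) z (push pWZ θ)
        (fun a => τ a.1) (fun a => Real.log (τ a.1)) (fun a => hτ.1 _)
        (fun a => Real.le_exp_log _) (fun w : Fin n → W => fun l => (w l, z l))
        (fun w w' h => by
          funext l
          have := congrFun h l
          simp only [Prod.mk.injEq] at this
          exact this.1)
        (fun _ _ => rfl)
      have e1 : push (fun a : W × Z => a.2) (push pWZ θ) = push pZ θ := push_push _ _ _
      rw [e1, sum_push pWZ θ (fun a => Real.log (τ a.1))] at h2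
      refine le_trans (le_of_eq ?_) h2
      refine Finset.sum_congr rfl fun w _ => ?_
      simp only [mul_ite, mul_one, mul_zero]
    · rw [zero_mul]
      have : ∀ w : Fin n → W, ¬ ty (fun l => (w l, z l)) = push pWZ θ := by
        intro w h
        apply hz
        have := congrArg (push (fun a : W × Z => a.2)) h
        have e1 : push (fun a : W × Z => a.2) (push pWZ θ) = push pZ θ := push_push _ _ _
        rw [e1] at this
        rw [← this]
        funext b
        rw [push_ty]
      simp [this]
  refine (Finset.sum_le_sum fun z _ => h1 z).trans ?_
  rw [Finset.sum_add_distrib, ← Finset.mul_sum, ← Finset.mul_sum, ← Finset.sum_mul]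
  refine add_le_add ?_ (mul_le_of_le_one_right (by positivity)
    (gth_total_one τ σ ρ q hτ hσ hρ hq θ))
  have h3 : ∑ z : Fin n → Z, (if ty z = push pZ θ then (1 : ℝ) else 0) ≤
      Real.exp (n * ent (push pZ θ)) := by
    have := type_count_inj hn (fun _ : Z => ()) (fun _ => ()) (push pZ θ)
      (fun _ => 1) (fun _ => 0) (fun _ => zero_le_one) (fun _ => by simp)
      (fun z : Fin n → Z => z) (fun _ _ h => h) (fun _ _ => rfl)
    rw [ent_unit _ ((sum_push_one pZ θ).trans hθ)] at this
    simp only [mul_zero, Finset.sum_const_zero, add_zero, sub_zero, Finset.prod_const_one] at this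
    refine le_trans (le_of_eq ?_) this
    exact Finset.sum_congr rfl fun _ _ => by congr
  calc c * Real.log K * ((∑ z : Fin n → Z, (if ty z = push pZ θ then (1 : ℝ) else 0)) *
        min 1 (M0 * Real.exp (n * Psi3 τ θ)))
      ≤ c * Real.log K * (Real.exp (n * ent (push pZ θ)) *
        min 1 (M0 * Real.exp (n * Psi3 τ θ))) := by
        refine mul_le_mul_of_nonneg_left (mul_le_mul_of_nonneg_right h3 ?_) hcK
        exact le_min zero_le_one (by positivity)
    _ = _ := by
        have : Real.exp (n * Psi2 ρ q θ) = Real.exp (n * ent (push pZ θ)) * c := by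
          rw [hc, ← Real.exp_add, Psi2]; ring_nf
        rw [this]; ring

end Sec

set_option linter.unusedSectionVars false

/-! ### Information identities -/

section Info

variable {W U X Y Z : Type*} [Fintype W] [Fintype U] [Fintype X] [Fintype Y] [Fintype Z]

lemma comp_channel {A B C : Type*} [Fintype B] [Fintype C] {μ : B → C → ℝ} {σ : A → B → ℝ}
    (hμ : IsChannel μ) (hσ : IsChannel σ) : IsChannel (comp μ σ) := by
  refine ⟨fun a c => Finset.sum_nonneg fun b _ => mul_nonneg (hσ.1 _ _) (hμ.1 _ _), fun a => ?_⟩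
  unfold comp
  rw [Finset.sum_comm]
  simp only [← Finset.mul_sum, hμ.2, mul_one, hσ.2]

lemma marg_dist {A B : Type*} [Fintype A] [Fintype B] {σ : A → B → ℝ} {τ : A → ℝ}
    (hσ : IsChannel σ) (hτ : IsDist τ) : IsDist (marg σ τ) := by
  refine ⟨fun b => Finset.sum_nonneg fun a _ => mul_nonneg (hτ.1 _) (hσ.1 _ _), ?_⟩
  unfold marg
  rw [Finset.sum_comm]
  simp only [← Finset.mul_sum, hσ.2, mul_one, hτ.2]

lemma chan_le_one {A B : Type*} [Fintype B] {σ : A → B → ℝ} (hσ : IsChannel σ) (a : A) (b : B) :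
    σ a b ≤ 1 := by
  rw [← hσ.2 a]
  exact Finset.single_le_sum (f := fun b => σ a b) (fun b _ => hσ.1 a b) (Finset.mem_univ b)

lemma mutInfo_nonneg {U Y : Type*} [Fintype U] [Fintype Y] (μ : U → Y → ℝ) (π : U → ℝ)
    (hμ : IsChannel μ) (hπ : IsDist π) : 0 ≤ mutInfo μ π := by
  have hl : 0 < Real.log 2 := Real.log_pos (by norm_num)
  have h : ∀ u y, (π u * μ u y - π u * ∑ u', π u' * μ u' y) / Real.log 2 ≤
      π u * μ u y * Real.logb 2 (μ u y / ∑ u', π u' * μ u' y) := by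
    intro u y
    rw [Real.logb, ← mul_div_assoc]
    refine div_le_div_of_nonneg_right ?_ hl.le
    have ho : 0 ≤ ∑ u', π u' * μ u' y :=
      Finset.sum_nonneg fun u' _ => mul_nonneg (hπ.1 _) (hμ.1 _ _)
    rcases (hπ.1 u).eq_or_lt with h0 | h0
    · simp [← h0]
    rcases (hμ.1 u y).eq_or_lt with h1 | h1
    · rw [← h1]; simp only [mul_zero, zero_mul, zero_sub]
      exact neg_nonpos.2 (mul_nonneg h0.le ho)
    have ho' : 0 < ∑ u', π u' * μ u' y := by
      refine (mul_pos h0 h1).trans_le ?_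
      exact Finset.single_le_sum (f := fun u' => π u' * μ u' y)
        (fun u' _ => mul_nonneg (hπ.1 _) (hμ.1 _ _)) (Finset.mem_univ u)
    have := Real.one_sub_inv_le_log_of_pos (div_pos h1 ho')
    have h2 := mul_le_mul_of_nonneg_left this (mul_pos h0 h1).le
    refine le_trans (le_of_eq ?_) h2
    field_simp
  unfold mutInfo
  refine le_trans (le_of_eq ?_) (Finset.sum_le_sum fun u _ => Finset.sum_le_sum fun y _ => h u y)
  simp only [← Finset.sum_div, Finset.sum_sub_distrib, ← Finset.mul_sum, ← Finset.sum_mul, hμ.2,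
    hπ.2]
  rw [Finset.sum_comm]
  simp only [← Finset.mul_sum, hμ.2, mul_one, hπ.2]
  simp

lemma marg_comp_eq (V : U → Y → ℝ) (σ : W → U → ℝ) (τ : W → ℝ) (y : Y) :
    ∑ u, marg σ τ u * V u y = ∑ w, τ w * comp V σ w y := by
  unfold marg comp
  simp only [Finset.sum_mul, Finset.mul_sum]
  rw [Finset.sum_comm]
  simp only [mul_assoc]

lemma le_sum_term {A : Type*} [Fintype A] (f : A → ℝ) (h : ∀ a, 0 ≤ f a) (a : A) :
    f a ≤ ∑ a, f a :=
  Finset.single_le_sum (fun a _ => h a) (Finset.mem_univ a)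

lemma chain_rule (V : U → Y → ℝ) (σ : W → U → ℝ) (τ : W → ℝ)
    (hV : IsChannel V) (hσ : IsChannel σ) (hτ : IsDist τ) :
    mutInfo V (marg σ τ) = mutInfo (comp V σ) τ + condMutInfo V σ τ := by
  have e1 : mutInfo V (marg σ τ) = ∑ w, ∑ u, ∑ y, τ w * σ w u * V u y *
      Real.logb 2 (V u y / ∑ w, τ w * comp V σ w y) := by
    unfold mutInfo
    simp only [marg_comp_eq]
    rw [Finset.sum_comm (s := (Finset.univ : Finset W))]
    refine Finset.sum_congr rfl fun u _ => ?_
    rw [Finset.sum_comm]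
    refine Finset.sum_congr rfl fun y _ => ?_
    unfold marg
    rw [← Finset.sum_mul, ← Finset.sum_mul]
  have e2 : mutInfo (comp V σ) τ = ∑ w, ∑ u, ∑ y, τ w * σ w u * V u y *
      Real.logb 2 (comp V σ w y / ∑ w, τ w * comp V σ w y) := by
    unfold mutInfo
    refine Finset.sum_congr rfl fun w _ => ?_
    rw [Finset.sum_comm]
    refine Finset.sum_congr rfl fun y _ => ?_
    rw [← Finset.sum_mul]
    congr 1
    unfold comp
    rw [Finset.mul_sum]
    simp only [mul_assoc]
  rw [e1, e2, condMutInfo]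
  simp only [← Finset.sum_add_distrib]
  refine Finset.sum_congr rfl fun w _ => Finset.sum_congr rfl fun u _ =>
    Finset.sum_congr rfl fun y _ => ?_
  rw [← mul_add]
  have hc := comp_channel hV hσ
  by_cases h0 : τ w * σ w u * V u y = 0
  · simp [h0]
  have h0' : τ w * σ w u * V u y ≠ 0 := h0
  simp only [mul_ne_zero_iff] at h0
  obtain ⟨⟨ha, hb⟩, hcc⟩ := h0
  have hcp : 0 < comp V σ w y := lt_of_lt_of_le
    (mul_pos ((hσ.1 w u).lt_of_ne' hb) ((hV.1 u y).lt_of_ne' hcc))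
    (le_sum_term (fun u => σ w u * V u y) (fun u => mul_nonneg (hσ.1 _ _) (hV.1 _ _)) u)
  have hop : 0 < ∑ w, τ w * comp V σ w y := lt_of_lt_of_le
    (mul_pos ((hτ.1 w).lt_of_ne' ha) hcp)
    (le_sum_term (fun w => τ w * comp V σ w y) (fun w => mul_nonneg (hτ.1 _) (hc.1 _ _)) w)
  congr 1
  rw [Real.logb_div hcc hop.ne', Real.logb_div hcp.ne' hop.ne', Real.logb_div hcc hcp.ne']
  ring

/-- lower bound for the divergence -/
lemma div_lower (q : X → Z → ℝ) (hq : IsChannel q) (π : U → ℝ) (hπ : ∀ u, 0 ≤ π u)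
    (ρ : U → X → ℝ) (hρ : ∀ u x, 0 ≤ ρ u x) (ζ : U × X → Z → ℝ) (hζ : IsChannel ζ) :
    -∑ u, ∑ x, ∑ _z : Z, π u * ρ u x / Real.log 2 ≤ ∑ u, ∑ x, ∑ z,
      π u * ρ u x * ζ (u, x) z * Real.logb 2 (ζ (u, x) z / q x z) := by
  have hl : 0 < Real.log 2 := Real.log_pos (by norm_num)
  simp only [← Finset.sum_neg_distrib]
  refine Finset.sum_le_sum fun u _ => Finset.sum_le_sum fun x _ => Finset.sum_le_sum fun z _ => ?_
  rw [Real.logb, ← mul_div_assoc, ← neg_div]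
  refine div_le_div_of_nonneg_right ?_ hl.le
  have hp : 0 ≤ π u * ρ u x := mul_nonneg (hπ _) (hρ _ _)
  have : -1 ≤ ζ (u, x) z * Real.log (ζ (u, x) z / q x z) := by
    rcases (hζ.1 (u, x) z).eq_or_lt with h0 | h0
    · rw [← h0]; norm_num
    rcases (hq.1 x z).eq_or_lt with h1 | h1
    · rw [← h1]; norm_num
    have h2 := Real.one_sub_inv_le_log_of_pos (div_pos h0 h1)
    have h3 := mul_le_mul_of_nonneg_left h2 h0.le
    refine le_trans ?_ h3
    have : ζ (u, x) z * (1 - (ζ (u, x) z / q x z)⁻¹) = ζ (u, x) z - q x z := by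
      field_simp
    rw [this]
    linarith [chan_le_one hq x z]
  have := mul_le_mul_of_nonneg_left this hp
  linarith

lemma L_le (t : X → Y → ℝ) (q : X → Z → ℝ) (hq : IsChannel q) (ρ : U → X → ℝ)
    (σ : W → U → ℝ) (τ : W → ℝ) (hρ : IsChannel ρ) (hσ : IsChannel σ) (hτ : IsDist τ)
    (ζ : U × X → Z → ℝ) (hζ : IsChannel ζ) (ν : U → Z → ℝ)
    (hν : ∀ u z, ∑ x, ρ u x * ζ (u, x) z = ν u z) :
    Lfun t q ρ σ τ ≤ ∑ u, ∑ x, ∑ z,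
      marg σ τ u * ρ u x * ζ (u, x) z * Real.logb 2 (ζ (u, x) z / q x z) +
      max (Sfun (comp t ρ) ν σ τ) 0 := by
  have hπ := marg_dist hσ hτ
  have hl : 0 < Real.log 2 := Real.log_pos (by norm_num)
  set LB := -∑ u, ∑ x, ∑ _z : Z, marg σ τ u * ρ u x / Real.log 2 with hLB
  have hLB0 : LB ≤ 0 := by
    rw [hLB, neg_nonpos]
    exact Finset.sum_nonneg fun u _ => Finset.sum_nonneg fun x _ => Finset.sum_nonneg fun z _ =>
      div_nonneg (mul_nonneg (hπ.1 _) (hρ.1 _ _)) hl.le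
  have hνc : IsChannel ν := by
    refine ⟨fun u z => ?_, fun u => ?_⟩
    · rw [← hν]; exact Finset.sum_nonneg fun x _ => mul_nonneg (hρ.1 _ _) (hζ.1 _ _)
    · simp only [← hν]
      rw [Finset.sum_comm]
      simp only [← Finset.mul_sum, hζ.2, mul_one, hρ.2]
  have hF : Fdiv ν q ρ (marg σ τ) ≤ ∑ u, ∑ x, ∑ z,
      marg σ τ u * ρ u x * ζ (u, x) z * Real.logb 2 (ζ (u, x) z / q x z) := by
    refine csInf_le ⟨LB, ?_⟩ ⟨ζ, hζ, hν, rfl⟩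
    rintro d ⟨ζ', hζ', -, rfl⟩
    exact div_lower q hq _ hπ.1 ρ hρ.1 ζ' hζ'
  refine le_trans (csInf_le ⟨LB, ?_⟩ ⟨ν, hνc, rfl⟩) (add_le_add hF le_rfl)
  rintro d ⟨ν', -, rfl⟩
  have : LB ≤ Fdiv ν' q ρ (marg σ τ) := by
    unfold Fdiv
    rcases Set.eq_empty_or_nonempty { d | ∃ ζ : U × X → Z → ℝ, IsChannel ζ ∧
      (∀ u z, ∑ x, ρ u x * ζ (u, x) z = ν' u z) ∧ d = ∑ u, ∑ x, ∑ z, marg σ τ u * ρ u x *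
        ζ (u, x) z * Real.logb 2 (ζ (u, x) z / q x z) } with h | h
    · rw [h, Real.sInf_empty]; exact hLB0
    · refine le_csInf h ?_
      rintro d ⟨ζ', hζ', -, rfl⟩
      exact div_lower q hq _ hπ.1 ρ hρ.1 ζ' hζ'
  linarith [le_max_right (Sfun (comp t ρ) ν' σ τ) 0]

/-! ### pushes -/

lemma push_pWUZ (θ : W × U × X × Z → ℝ) (w : W) (u : U) (z : Z) :
    push pWUZ θ (w, u, z) = ∑ x, θ (w, u, x, z) := by
  classical
  unfold push pWUZ
  simp only [Fintype.sum_prod_type, Prod.mk.injEq, ite_and]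
  simp

lemma push_pWZ (θ : W × U × X × Z → ℝ) (w : W) (z : Z) :
    push pWZ θ (w, z) = ∑ u, ∑ x, θ (w, u, x, z) := by
  classical
  unfold push pWZ
  simp only [Fintype.sum_prod_type, Prod.mk.injEq, ite_and]
  simp

lemma push_pZ (θ : W × U × X × Z → ℝ) (z : Z) :
    push pZ θ z = ∑ w, ∑ u, ∑ x, θ (w, u, x, z) := by
  classical
  unfold push pZ
  simp only [Fintype.sum_prod_type]
  simp

lemma push_pWUX (θ : W × U × X × Z → ℝ) (w : W) (u : U) (x : X) :
    push pWUX θ (w, u, x) = ∑ z, θ (w, u, x, z) := by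
  classical
  unfold push pWUX
  simp only [Fintype.sum_prod_type, Prod.mk.injEq, ite_and]
  simp only [Finset.sum_ite_irrel, Finset.sum_const_zero, Finset.sum_ite_eq', Finset.mem_univ,
    if_true]
  rw [Finset.sum_comm]
  simp

end Info

set_option linter.unusedSectionVars false

/-! ### The exponent -/

section Expo

variable {W U X Y Z : Type*} [Fintype W] [Fintype U] [Fintype X] [Fintype Y] [Fintype Z]

/-- the exponent function of a joint type; `a`, `A` are rates in nats -/
def Efun (τ : W → ℝ) (σ : W → U → ℝ) (ρ : U → X → ℝ) (q : X → Z → ℝ) (a A : ℝ)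
    (θ : W × U × X × Z → ℝ) : ℝ :=
  max (-Psi1 τ σ ρ q θ) (A - Psi2 ρ q θ + max (-Psi3 τ θ - a) 0)

lemma theta_factor (q : X → Z → ℝ) (hq : IsChannel q) (ρ : U → X → ℝ)
    (σ : W → U → ℝ) (τ : W → ℝ) (hρ : IsChannel ρ) (hσ : IsChannel σ) (hσ' : Deterministic σ)
    (hτ : IsDist τ) (θ : W × U × X × Z → ℝ) (hθ : ∀ a, 0 ≤ θ a)
    (hp : ∀ w u x, ∑ z, θ (w, u, x, z) = τ w * σ w u * ρ u x) :
    ∃ ζ : U × X → Z → ℝ, IsChannel ζ ∧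
      ∀ w u x z, θ (w, u, x, z) = τ w * σ w u * ρ u x * ζ (u, x) z := by
  classical
  have hπ := marg_dist hσ hτ
  have hz : ∀ w u x z, τ w * σ w u * ρ u x = 0 → θ (w, u, x, z) = 0 := by
    intro w u x z h
    have h1 := le_sum_term (fun z => θ (w, u, x, z)) (fun z => hθ _) z
    simp only [hp, h] at h1
    exact le_antisymm h1 (hθ _)
  refine ⟨fun ux z => if marg σ τ ux.1 * ρ ux.1 ux.2 = 0 then q ux.2 z else
    (∑ w, θ (w, ux.1, ux.2, z)) / (marg σ τ ux.1 * ρ ux.1 ux.2), ⟨?_, ?_⟩, ?_⟩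
  · intro ux z
    dsimp only
    split_ifs
    · exact hq.1 _ _
    · exact div_nonneg (Finset.sum_nonneg fun w _ => hθ _) (mul_nonneg (hπ.1 _) (hρ.1 _ _))
  · intro ux
    dsimp only
    split_ifs with h
    · exact hq.2 _
    · rw [← Finset.sum_div, Finset.sum_comm]
      simp only [hp, ← Finset.sum_mul]
      exact div_self h
  · intro w u x z
    dsimp only
    by_cases h0 : τ w * σ w u * ρ u x = 0
    · rw [hz w u x z h0, h0, zero_mul]
    · have h0' := h0
      simp only [mul_ne_zero_iff] at h0'
      obtain ⟨⟨ha, hb⟩, hc⟩ := h0'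
      have hw : ∀ w', w' ≠ w → σ w' u = 0 := by
        intro w' hne
        by_contra h
        exact hne (hσ' u w' w ((hσ.1 _ _).lt_of_ne' h) ((hσ.1 _ _).lt_of_ne' hb))
      have hm : marg σ τ u = τ w * σ w u := by
        unfold marg
        exact Finset.sum_eq_single w (fun w' _ hne => by rw [hw w' hne, mul_zero]) (by simp)
      have hs : ∑ w, θ (w, u, x, z) = θ (w, u, x, z) :=
        Finset.sum_eq_single w (fun w' _ hne => hz w' u x z (by rw [hw w' hne]; ring)) (by simp)
      rw [hm, hs, if_neg h0]
      field_simp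

lemma exponent_exact (t : X → Y → ℝ) (q : X → Z → ℝ) (hq : IsChannel q) (ρ : U → X → ℝ)
    (σ : W → U → ℝ) (τ : W → ℝ) (hρ : IsChannel ρ) (hσ : IsChannel σ) (hσ' : Deterministic σ)
    (hτ : IsDist τ) (θ : W × U × X × Z → ℝ) (hθ : ∀ a, 0 ≤ θ a)
    (hθq : ∀ a, q a.2.2.1 a.2.2.2 = 0 → θ a = 0)
    (hp : ∀ b, push pWUX θ b = τ b.1 * σ b.1 b.2.1 * ρ b.2.1 b.2.2) :
    Real.log 2 * Lfun t q ρ σ τ ≤ Efun τ σ ρ q (Real.log 2 * mutInfo (comp (comp t ρ) σ) τ)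
      (Real.log 2 * (mutInfo (comp (comp t ρ) σ) τ + condMutInfo (comp t ρ) σ τ)) θ := by
  have hl : 0 < Real.log 2 := Real.log_pos (by norm_num)
  have hp' : ∀ w u x, ∑ z, θ (w, u, x, z) = τ w * σ w u * ρ u x := by
    intro w u x
    rw [← push_pWUX, hp]
  obtain ⟨ζ, hζ, hf⟩ := theta_factor q hq ρ σ τ hρ hσ hσ' hτ θ hθ hp'
  set ν : U → Z → ℝ := fun u z => ∑ x, ρ u x * ζ (u, x) z with hν
  have hνc : IsChannel ν := by
    refine ⟨fun u z => Finset.sum_nonneg fun x _ => mul_nonneg (hρ.1 _ _) (hζ.1 _ _), fun u => ?_⟩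
    simp only [hν]
    rw [Finset.sum_comm]
    simp only [← Finset.mul_sum, hζ.2, mul_one, hρ.2]
  have hcc := comp_channel hνc hσ
  have hL := L_le t q hq ρ σ τ hρ hσ hτ ζ hζ ν (fun _ _ => rfl)
  have q1 : ∀ w u z, push pWUZ θ (w, u, z) = τ w * σ w u * ν u z := by
    intro w u z
    rw [push_pWUZ, hν, Finset.mul_sum]
    exact Finset.sum_congr rfl fun x _ => by rw [hf]; ring
  have q2 : ∀ w z, push pWZ θ (w, z) = τ w * comp ν σ w z := by
    intro w z
    rw [push_pWZ, comp, Finset.mul_sum]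
    refine Finset.sum_congr rfl fun u _ => ?_
    rw [hν, Finset.mul_sum, Finset.mul_sum]
    exact Finset.sum_congr rfl fun x _ => by rw [hf]; ring
  have q3 : ∀ z, push pZ θ z = ∑ w, τ w * comp ν σ w z := by
    intro z
    rw [push_pZ]
    exact Finset.sum_congr rfl fun w _ => by rw [← push_pWZ, q2]
  -- positivity
  have hpos : ∀ w u x z, θ (w, u, x, z) ≠ 0 → 0 < τ w ∧ 0 < σ w u ∧ 0 < ρ u x ∧ 0 < ζ (u, x) z ∧
      0 < q x z ∧ 0 < ν u z ∧ 0 < comp ν σ w z ∧ 0 < ∑ w, τ w * comp ν σ w z := by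
    intro w u x z h
    have hqz : q x z ≠ 0 := fun h' => h (hθq (w, u, x, z) h')
    rw [hf] at h
    simp only [mul_ne_zero_iff] at h
    obtain ⟨⟨⟨ha, hb⟩, hc⟩, hd⟩ := h
    have ha := (hτ.1 w).lt_of_ne' ha
    have hb := (hσ.1 w u).lt_of_ne' hb
    have hc := (hρ.1 u x).lt_of_ne' hc
    have hd := (hζ.1 (u, x) z).lt_of_ne' hd
    have he : 0 < ν u z := (mul_pos hc hd).trans_le
      (le_sum_term (fun x => ρ u x * ζ (u, x) z) (fun x => mul_nonneg (hρ.1 _ _) (hζ.1 _ _)) x)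
    have hg : 0 < comp ν σ w z := (mul_pos hb he).trans_le
      (le_sum_term (fun u => σ w u * ν u z) (fun u => mul_nonneg (hσ.1 _ _) (hνc.1 _ _)) u)
    have hh : 0 < ∑ w, τ w * comp ν σ w z := (mul_pos ha hg).trans_le
      (le_sum_term (fun w => τ w * comp ν σ w z) (fun w => mul_nonneg (hτ.1 _) (hcc.1 _ _)) w)
    exact ⟨ha, hb, hc, hd, (hq.1 x z).lt_of_ne' hqz, he, hg, hh⟩
  -- the three quantities
  have hD : Real.log 2 * (∑ u, ∑ x, ∑ z,
      marg σ τ u * ρ u x * ζ (u, x) z * Real.logb 2 (ζ (u, x) z / q x z)) =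
      -Psi1 τ σ ρ q θ := by
    have e1 : ∑ u, ∑ x, ∑ z,
        marg σ τ u * ρ u x * ζ (u, x) z * Real.logb 2 (ζ (u, x) z / q x z) =
        ∑ a : W × U × X × Z, θ a * Real.logb 2 (ζ (a.2.1, a.2.2.1) a.2.2.2 /
          q a.2.2.1 a.2.2.2) := by
      simp only [Fintype.sum_prod_type]
      rw [Finset.sum_comm (s := (Finset.univ : Finset W))]
      refine Finset.sum_congr rfl fun u _ => ?_
      rw [Finset.sum_comm (s := (Finset.univ : Finset W))]
      refine Finset.sum_congr rfl fun x _ => ?_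
      rw [Finset.sum_comm (s := (Finset.univ : Finset W))]
      refine Finset.sum_congr rfl fun z _ => ?_
      rw [← Finset.sum_mul]
      congr 1
      simp only [hf, marg, Finset.sum_mul]
    rw [e1, Psi1, ent_eq, neg_add, neg_neg, Finset.mul_sum, ← Finset.sum_neg_distrib,
      ← Finset.sum_add_distrib]
    refine Finset.sum_congr rfl ?_
    rintro ⟨w, u, x, z⟩ -
    dsimp only
    by_cases h0 : θ (w, u, x, z) = 0
    · simp [h0]
    obtain ⟨ha, hb, hc, hd, he, -, -, -⟩ := hpos w u x z h0
    have : Real.log (θ (w, u, x, z)) = Real.log (τ w) + Real.log (σ w u) + Real.log (ρ u x) +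
        Real.log (ζ (u, x) z) := by
      rw [hf, Real.log_mul (by positivity) hd.ne', Real.log_mul (by positivity) hc.ne',
        Real.log_mul ha.ne' hb.ne']
    rw [this, Real.logb, Real.log_div hd.ne' he.ne']
    field_simp
    ring
  have hI0 : Real.log 2 * mutInfo (comp ν σ) τ = -Psi3 τ θ := by
    have e1 : mutInfo (comp ν σ) τ = ∑ b, push pWZ θ b *
        Real.logb 2 (comp ν σ b.1 b.2 / ∑ w, τ w * comp ν σ w b.2) := by
      simp only [Fintype.sum_prod_type, q2]
      rfl
    rw [e1, sum_push pWZ θ (fun b => Real.logb 2 (comp ν σ b.1 b.2 / ∑ w, τ w * comp ν σ w b.2)),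
      Psi3, ent_push, ent_push, Finset.mul_sum]
    rw [neg_add, neg_sub, sub_neg_eq_add, ← Finset.sum_neg_distrib, ← Finset.sum_neg_distrib,
      ← Finset.sum_add_distrib, ← Finset.sum_add_distrib]
    refine Finset.sum_congr rfl ?_
    rintro ⟨w, u, x, z⟩ -
    by_cases h0 : θ (w, u, x, z) = 0
    · simp [h0]
    obtain ⟨ha, hb, hc, hd, he, hg, hh, hi⟩ := hpos w u x z h0
    simp only [pWZ, pZ, q2, q3]
    rw [Real.logb, Real.log_div hh.ne' hi.ne', Real.log_mul ha.ne' hh.ne']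
    field_simp
    ring
  have hIc : Real.log 2 * (mutInfo (comp ν σ) τ + condMutInfo ν σ τ) =
      Psi2 ρ q θ - Psi1 τ σ ρ q θ := by
    have e1 : condMutInfo ν σ τ = ∑ b, push pWUZ θ b *
        Real.logb 2 (ν b.2.1 b.2.2 / comp ν σ b.1 b.2.2) := by
      simp only [Fintype.sum_prod_type, q1]
      rfl
    rw [mul_add, hI0, e1,
      sum_push pWUZ θ (fun b => Real.logb 2 (ν b.2.1 b.2.2 / comp ν σ b.1 b.2.2)),
      Psi3, Psi1, Psi2, ent_push pWZ, ent_push pWUZ, Finset.mul_sum]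
    have : Psi1 τ σ ρ q θ = Psi1 τ σ ρ q θ := rfl
    rw [ent_push pZ]
    have key : ∑ a : W × U × X × Z, (Real.log 2 * (θ a * Real.logb 2 (ν (pWUZ a).2.1 (pWUZ a).2.2 /
        comp ν σ (pWUZ a).1 (pWUZ a).2.2)) + θ a * Real.log (push pWZ θ (pWZ a))
        - θ a * Real.log (τ a.1)) = ∑ a : W × U × X × Z, (
        θ a * Real.log (push pWUZ θ (pWUZ a)) - θ a * Real.log (τ a.1) -
          θ a * Real.log (σ a.1 a.2.1)) := by
      refine Finset.sum_congr rfl ?_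
      rintro ⟨w, u, x, z⟩ -
      by_cases h0 : θ (w, u, x, z) = 0
      · simp [h0]
      obtain ⟨ha, hb, hc, hd, he, hg, hh, hi⟩ := hpos w u x z h0
      simp only [pWZ, pWUZ, q2, q1]
      rw [Real.logb, Real.log_div hg.ne' hh.ne', Real.log_mul ha.ne' hh.ne',
        Real.log_mul (by positivity) hg.ne', Real.log_mul ha.ne' hb.ne']
      field_simp
      ring
    simp only [Finset.sum_add_distrib, Finset.sum_sub_distrib, mul_add] at key ⊢
    linarith
  -- assemble
  have hS : Real.log 2 * Sfun (comp t ρ) ν σ τ =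
      Real.log 2 * (mutInfo (comp (comp t ρ) σ) τ + condMutInfo (comp t ρ) σ τ)
      - (Psi2 ρ q θ - Psi1 τ σ ρ q θ) +
      max (-Psi3 τ θ - Real.log 2 * mutInfo (comp (comp t ρ) σ) τ) 0 := by
    have em : max (-Psi3 τ θ - Real.log 2 * mutInfo (comp (comp t ρ) σ) τ) 0 =
        Real.log 2 * max (mutInfo (comp ν σ) τ - mutInfo (comp (comp t ρ) σ) τ) 0 := by
      rw [mul_max_of_nonneg _ _ hl.le, mul_sub, hI0, mul_zero]
    rw [em, ← hIc, ← mul_sub, Sfun]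
    rcases le_total (mutInfo (comp (comp t ρ) σ) τ) (mutInfo (comp ν σ) τ) with h | h
    · rw [max_eq_right (by linarith), max_eq_left (by linarith)]; ring
    · rw [max_eq_left (by linarith), max_eq_right (by linarith)]; ring
  refine (mul_le_mul_of_nonneg_left hL hl.le).trans ?_
  rw [mul_add, hD, mul_max_of_nonneg _ _ hl.le, hS, mul_zero, Efun]
  rcases le_total (Real.log 2 * (mutInfo (comp (comp t ρ) σ) τ + condMutInfo (comp t ρ) σ τ)
      - (Psi2 ρ q θ - Psi1 τ σ ρ q θ) +
      max (-Psi3 τ θ - Real.log 2 * mutInfo (comp (comp t ρ) σ) τ) 0) 0 with h | h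
  · rw [max_eq_right h, add_zero]
    exact le_max_left _ _
  · rw [max_eq_left h]
    refine le_trans (le_of_eq ?_) (le_max_right _ _)
    ring

lemma continuous_push {S B : Type*} [Fintype S] [Fintype B] (p : S → B) (b : B) :
    Continuous fun θ : S → ℝ => push p θ b := by
  unfold push
  refine continuous_finsetSum _ fun a _ => ?_
  split_ifs
  · exact continuous_apply a
  · exact continuous_const

lemma continuous_ent {S : Type*} [Fintype S] : Continuous fun θ : S → ℝ => ent θ := by
  unfold ent
  exact continuous_finsetSum _ fun a _ => Real.continuous_negMulLog.comp (continuous_apply a)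

lemma continuous_ent_push {S B : Type*} [Fintype S] [Fintype B] (p : S → B) :
    Continuous fun θ : S → ℝ => ent (push p θ) :=
  continuous_ent.comp (continuous_pi fun b => continuous_push p b)

lemma continuous_lin {S : Type*} [Fintype S] (F : S → ℝ) :
    Continuous fun θ : S → ℝ => ∑ a, θ a * F a :=
  continuous_finsetSum _ fun a _ => (continuous_apply a).mul continuous_const

lemma continuous_Efun (τ : W → ℝ) (σ : W → U → ℝ) (ρ : U → X → ℝ) (q : X → Z → ℝ) (a A : ℝ) :
    Continuous (Efun τ σ ρ q a A) := by
  unfold Efun Psi1 Psi2 Psi3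
  have h1 := continuous_ent (S := W × U × X × Z)
  have h2 := continuous_ent_push (pWUZ (W := W) (U := U) (X := X) (Z := Z))
  have h3 := continuous_ent_push (pWZ (W := W) (U := U) (X := X) (Z := Z))
  have h4 := continuous_ent_push (pZ (W := W) (U := U) (X := X) (Z := Z))
  have h5 := fun F => continuous_lin (S := W × U × X × Z) F
  exact ((h1.add (h5 _)).neg).max ((continuous_const.sub (h4.add ((h1.sub h2).add (h5 _)))).add
    ((((h3.sub h4).add (h5 _)).neg.sub continuous_const).max continuous_const))

lemma exponent_near (t : X → Y → ℝ) (q : X → Z → ℝ) (hq : IsChannel q) (ρ : U → X → ℝ)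
    (σ : W → U → ℝ) (τ : W → ℝ) (hρ : IsChannel ρ) (hσ : IsChannel σ) (hσ' : Deterministic σ)
    (hτ : IsDist τ) (α η : ℝ) (hη : 0 < η) (hα : α ≤ Lfun t q ρ σ τ) :
    ∃ δ > 0, ∀ θ : W × U × X × Z → ℝ, (∀ a, 0 ≤ θ a) → ∑ a, θ a = 1 →
    (∀ a, q a.2.2.1 a.2.2.2 = 0 → θ a = 0) →
    (∀ b, |push pWUX θ b - τ b.1 * σ b.1 b.2.1 * ρ b.2.1 b.2.2| ≤ δ) →
    Real.log 2 * α - η ≤ Efun τ σ ρ q (Real.log 2 * mutInfo (comp (comp t ρ) σ) τ)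
      (Real.log 2 * (mutInfo (comp (comp t ρ) σ) τ + condMutInfo (comp t ρ) σ τ)) θ := by
  have hl : 0 < Real.log 2 := Real.log_pos (by norm_num)
  set E := Efun τ σ ρ q (Real.log 2 * mutInfo (comp (comp t ρ) σ) τ)
      (Real.log 2 * (mutInfo (comp (comp t ρ) σ) τ + condMutInfo (comp t ρ) σ τ)) with hE
  have hEc : Continuous E := continuous_Efun _ _ _ _ _ _
  set d : (W × U × X × Z → ℝ) → ℝ := fun θ =>
    ∑ b : W × U × X, |push pWUX θ b - τ b.1 * σ b.1 b.2.1 * ρ b.2.1 b.2.2| with hd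
  have hdc : Continuous d := continuous_finsetSum _ fun b _ =>
    ((continuous_push pWUX b).sub continuous_const).abs
  set C : Set (W × U × X × Z → ℝ) := {θ | (∀ a, 0 ≤ θ a) ∧ ∑ a, θ a = 1 ∧
    (∀ a, q a.2.2.1 a.2.2.2 = 0 → θ a = 0) ∧ E θ ≤ Real.log 2 * α - η} with hC
  have hCc : IsCompact C := by
    have hb : C ⊆ Set.Icc (0 : W × U × X × Z → ℝ) 1 := by
      rintro θ ⟨h1, h2, -, -⟩
      exact ⟨fun a => h1 a, fun a => (le_sum_term θ h1 a).trans h2.le⟩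
    refine isCompact_Icc.of_isClosed_subset ?_ hb
    have : C = (⋂ a, {θ | 0 ≤ θ a}) ∩ ({θ | ∑ a, θ a = 1} ∩ ((⋂ a, ⋂ (_ : q a.2.2.1 a.2.2.2 = 0),
        {θ | θ a = 0}) ∩ {θ | E θ ≤ Real.log 2 * α - η})) := by
      ext θ; simp [hC]
    rw [this]
    refine (isClosed_iInter fun a => isClosed_le continuous_const (continuous_apply a)).inter
      ((isClosed_eq (continuous_finsetSum _ fun a _ => continuous_apply a)
        continuous_const).inter
      ((isClosed_iInter fun a => isClosed_iInter fun _ =>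
        isClosed_eq (continuous_apply a) continuous_const).inter
      (isClosed_le hEc continuous_const)))
  rcases C.eq_empty_or_nonempty with hemp | hne
  · refine ⟨1, one_pos, fun θ h1 h2 h3 _ => ?_⟩
    by_contra h
    have : θ ∈ C := ⟨h1, h2, h3, (not_le.1 h).le⟩
    rw [hemp] at this
    exact this
  · obtain ⟨θ0, hθ0, hmin⟩ := hCc.exists_isMinOn hne hdc.continuousOn
    have hd0 : 0 < d θ0 := by
      refine lt_of_le_of_ne (Finset.sum_nonneg fun b _ => abs_nonneg _) fun h => ?_
      obtain ⟨h1, h2, h3, h4⟩ := hθ0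
      have := (Finset.sum_eq_zero_iff_of_nonneg (fun b _ => abs_nonneg _)).1 h.symm
      have h5 := exponent_exact t q hq ρ σ τ hρ hσ hσ' hτ θ0 h1 h3 (fun b => by
        have := this b (Finset.mem_univ b)
        rw [abs_eq_zero, sub_eq_zero] at this
        exact this)
      have h6 := mul_le_mul_of_nonneg_left hα hl.le
      have h7 : Real.log 2 * Lfun t q ρ σ τ ≤ E θ0 := h5
      linarith
    set N : ℝ := (Fintype.card (W × U × X) : ℝ) with hN
    have hN0 : 0 ≤ N := Nat.cast_nonneg _
    refine ⟨d θ0 / (2 * (N + 1)), by positivity, fun θ h1 h2 h3 h4 => ?_⟩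
    by_contra h
    have hm : θ ∈ C := ⟨h1, h2, h3, (not_le.1 h).le⟩
    have h5 : d θ0 ≤ d θ := hmin hm
    have h6 : d θ ≤ N * (d θ0 / (2 * (N + 1))) := by
      refine (Finset.sum_le_sum fun b _ => h4 b).trans ?_
      simp [hN]
    have h7 : N * (d θ0 / (2 * (N + 1))) < d θ0 := by
      rw [← mul_div_assoc, div_lt_iff₀ (by positivity)]
      nlinarith
    linarith

end Expo

set_option linter.unusedSectionVars false

/-! ### Error side -/

section Err

variable {W U X Y Z : Type*} [Fintype W] [Fintype U] [Fintype X] [Fintype Y] [Fintype Z]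

lemma nfold_comp {A B C : Type*} [Fintype B] (n : ℕ) (σ : A → B → ℝ) (μ : B → C → ℝ)
    (a : Fin n → A) (c : Fin n → C) :
    ∑ b : Fin n → B, nfold σ n a b * nfold μ n b c = nfold (comp μ σ) n a c := by
  classical
  unfold nfold comp
  simp only [← Finset.prod_mul_distrib]
  exact sum_prod_pi (fun l b => σ (a l) b * μ b (c l))

lemma nfold_channel {A B : Type*} [Fintype B] {σ : A → B → ℝ} (hσ : IsChannel σ) (n : ℕ) :
    IsChannel (nfold σ n) := by
  classical
  refine ⟨fun a b => Finset.prod_nonneg fun l _ => hσ.1 _ _, fun a => ?_⟩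
  unfold nfold
  rw [sum_prod_pi (fun l b => σ (a l) b)]
  simp [hσ.2]

lemma pmass_comp {A B : Type*} [Fintype A] (n : ℕ) (τ : A → ℝ) (μ : A → B → ℝ) (b : Fin n → B) :
    ∑ a : Fin n → A, (∏ l, τ (a l)) * nfold μ n a b = ∏ l, ∑ a, τ a * μ a (b l) := by
  classical
  unfold nfold
  simp only [← Finset.prod_mul_distrib]
  exact sum_prod_pi (fun l a => τ a * μ a (b l))

/-- joint typicality of the encoder -/
def Typ {n : ℕ} (τ : W → ℝ) (σ : W → U → ℝ) (ρ : U → X → ℝ) (δ : ℝ)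
    (w : Fin n → W) (u : Fin n → U) (x : Fin n → X) : Prop :=
  ∀ b : W × U × X, |ty (fun l => (w l, u l, x l)) b - τ b.1 * σ b.1 b.2.1 * ρ b.2.1 b.2.2| ≤ δ

open Classical in
/-- the sub-stochastic encoder -/
def fenc (n : ℕ) (τ : W → ℝ) (σ : W → U → ℝ) (ρ : U → X → ℝ) (δ : ℝ)
    (w : Fin n → W) (u : Fin n → U) (x : Fin n → X) : ℝ :=
  nfold ρ n u x * (if Typ τ σ ρ δ w u x then 1 else 0)

/-- decoding region -/
def Dreg (n : ℕ) (τ : W → ℝ) (σ : W → U → ℝ) (V : U → Y → ℝ) (A B : ℝ)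
    (w : Fin n → W) (u : Fin n → U) (y : Fin n → Y) : Prop :=
  (2 : ℝ) ^ ((n : ℝ) * B) * nfold (comp V σ) n w y ≤ nfold V n u y ∧
  (2 : ℝ) ^ ((n : ℝ) * A) * (∏ l, ∑ w', τ w' * comp V σ w' (y l)) ≤ nfold V n u y

lemma fenc_nonneg (n : ℕ) (τ : W → ℝ) (σ : W → U → ℝ) (ρ : U → X → ℝ) (δ : ℝ) (hρ : IsChannel ρ)
    (w : Fin n → W) (u : Fin n → U) (x : Fin n → X) : 0 ≤ fenc n τ σ ρ δ w u x := by
  unfold fenc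
  refine mul_nonneg ((nfold_channel hρ n).1 _ _) ?_
  split_ifs <;> norm_num

lemma fenc_le (n : ℕ) (τ : W → ℝ) (σ : W → U → ℝ) (ρ : U → X → ℝ) (δ : ℝ) (hρ : IsChannel ρ)
    (w : Fin n → W) (u : Fin n → U) (x : Fin n → X) :
    fenc n τ σ ρ δ w u x ≤ nfold ρ n u x := by
  unfold fenc
  have := (nfold_channel hρ n).1 u x
  split_ifs <;> simp [this]

lemma fenc_sum (n : ℕ) (τ : W → ℝ) (σ : W → U → ℝ) (ρ : U → X → ℝ) (δ : ℝ) (hρ : IsChannel ρ)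
    (w : Fin n → W) (u : Fin n → U) : ∑ x, fenc n τ σ ρ δ w u x ≤ 1 :=
  (Finset.sum_le_sum fun x _ => fenc_le n τ σ ρ δ hρ w u x).trans ((nfold_channel hρ n).2 u).le

lemma fencT_le (n : ℕ) (t : X → Y → ℝ) (ht : IsChannel t) (τ : W → ℝ) (σ : W → U → ℝ)
    (ρ : U → X → ℝ) (δ : ℝ) (hρ : IsChannel ρ)
    (w : Fin n → W) (u : Fin n → U) (y : Fin n → Y) :
    ∑ x, fenc n τ σ ρ δ w u x * nfold t n x y ≤ nfold (comp t ρ) n u y := by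
  rw [← nfold_comp]
  exact Finset.sum_le_sum fun x _ => mul_le_mul_of_nonneg_right (fenc_le n τ σ ρ δ hρ w u x)
    ((nfold_channel ht n).1 _ _)

open Classical in
lemma same_bound (n : ℕ) (t : X → Y → ℝ) (ht : IsChannel t) (τ : W → ℝ) (σ : W → U → ℝ)
    (ρ : U → X → ℝ) (δ A B : ℝ) (hρ : IsChannel ρ) (hσ : IsChannel σ) (hτ : IsDist τ) :
    ∑ w : Fin n → W, ∑ u : Fin n → U, ∑ u' : Fin n → U,
      (∏ l, τ (w l)) * nfold σ n w u * nfold σ n w u' *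
      ∑ y, (∑ x, fenc n τ σ ρ δ w u x * nfold t n x y) *
        (if Dreg n τ σ (comp t ρ) A B w u' y then 1 else 0) ≤ (2 : ℝ) ^ (-((n : ℝ) * B)) := by
  have hV := comp_channel ht hρ
  have hVn := nfold_channel hV n
  have hσn := nfold_channel hσ n
  have hP0 : ∀ w : Fin n → W, 0 ≤ ∏ l, τ (w l) := fun w => Finset.prod_nonneg fun l _ => hτ.1 _
  set e := (2 : ℝ) ^ (-((n : ℝ) * B)) with he
  have he0 : 0 < e := Real.rpow_pos_of_pos two_pos _
  have hD : ∀ w u' y, nfold (comp (comp t ρ) σ) n w y *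
      (if Dreg n τ σ (comp t ρ) A B w u' y then 1 else 0) ≤ e * nfold (comp t ρ) n u' y := by
    intro w u' y
    split_ifs with h
    · rw [mul_one]
      have := mul_le_mul_of_nonneg_left h.1 he0.le
      rw [← mul_assoc, he, ← Real.rpow_add two_pos, neg_add_cancel, Real.rpow_zero, one_mul] at this
      exact this
    · rw [mul_zero]; exact mul_nonneg he0.le (hVn.1 _ _)
  calc _ ≤ ∑ w : Fin n → W, ∑ u : Fin n → U, ∑ u' : Fin n → U,
      (∏ l, τ (w l)) * nfold σ n w u * nfold σ n w u' *
      ∑ y, (nfold (comp t ρ) n u y) *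
        (if Dreg n τ σ (comp t ρ) A B w u' y then 1 else 0) := by
        refine Finset.sum_le_sum fun w _ => Finset.sum_le_sum fun u _ =>
          Finset.sum_le_sum fun u' _ => mul_le_mul_of_nonneg_left
          (Finset.sum_le_sum fun y _ => mul_le_mul_of_nonneg_right
            (fencT_le n t ht τ σ ρ δ hρ w u y) (by split_ifs <;> norm_num))
          (mul_nonneg (mul_nonneg (hP0 _) (hσn.1 _ _)) (hσn.1 _ _))
    _ = ∑ w : Fin n → W, ∑ u' : Fin n → U, (∏ l, τ (w l)) * nfold σ n w u' *
        ∑ y, nfold (comp (comp t ρ) σ) n w y *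
          (if Dreg n τ σ (comp t ρ) A B w u' y then 1 else 0) := by
        refine Finset.sum_congr rfl fun w _ => ?_
        rw [Finset.sum_comm]
        refine Finset.sum_congr rfl fun u' _ => ?_
        simp only [← nfold_comp n σ (comp t ρ), Finset.mul_sum, Finset.sum_mul]
        rw [Finset.sum_comm]
        exact Finset.sum_congr rfl fun y _ => Finset.sum_congr rfl fun u _ => by ring
    _ ≤ ∑ w : Fin n → W, ∑ u' : Fin n → U, (∏ l, τ (w l)) * nfold σ n w u' *
        ∑ y, e * nfold (comp t ρ) n u' y := by
        refine Finset.sum_le_sum fun w _ => Finset.sum_le_sum fun u' _ =>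
          mul_le_mul_of_nonneg_left (Finset.sum_le_sum fun y _ => hD w u' y)
          (mul_nonneg (hP0 _) (hσn.1 _ _))
    _ = e := by
        simp only [← Finset.mul_sum, hVn.2, mul_one, ← Finset.sum_mul, hσn.2,
          sum_prod_one τ hτ.2 n, one_mul]

open Classical in
lemma diff_bound (n : ℕ) (t : X → Y → ℝ) (ht : IsChannel t) (τ : W → ℝ) (σ : W → U → ℝ)
    (ρ : U → X → ℝ) (δ A B : ℝ) (hρ : IsChannel ρ) (hσ : IsChannel σ) (hτ : IsDist τ) :
    ∑ w : Fin n → W, ∑ w' : Fin n → W, ∑ u : Fin n → U, ∑ u' : Fin n → U,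
      (∏ l, τ (w l)) * (∏ l, τ (w' l)) * (nfold σ n w u * nfold σ n w' u' *
      ∑ y, (∑ x, fenc n τ σ ρ δ w u x * nfold t n x y) *
        (if Dreg n τ σ (comp t ρ) A B w' u' y then 1 else 0)) ≤ (2 : ℝ) ^ (-((n : ℝ) * A)) := by
  have hV := comp_channel ht hρ
  have hVn := nfold_channel hV n
  have hσn := nfold_channel hσ n
  have hP0 : ∀ w : Fin n → W, 0 ≤ ∏ l, τ (w l) := fun w => Finset.prod_nonneg fun l _ => hτ.1 _
  set e := (2 : ℝ) ^ (-((n : ℝ) * A)) with he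
  have he0 : 0 < e := Real.rpow_pos_of_pos two_pos _
  have hD : ∀ w' u' y, (∏ l, ∑ w, τ w * comp (comp t ρ) σ w (y l)) *
      (if Dreg n τ σ (comp t ρ) A B w' u' y then 1 else 0) ≤ e * nfold (comp t ρ) n u' y := by
    intro w' u' y
    split_ifs with h
    · rw [mul_one]
      have := mul_le_mul_of_nonneg_left h.2 he0.le
      rw [← mul_assoc, he, ← Real.rpow_add two_pos, neg_add_cancel, Real.rpow_zero, one_mul] at this
      exact this
    · rw [mul_zero]; exact mul_nonneg he0.le (hVn.1 _ _)
  calc _ ≤ ∑ w : Fin n → W, ∑ w' : Fin n → W, ∑ u : Fin n → U, ∑ u' : Fin n → U,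
      (∏ l, τ (w l)) * (∏ l, τ (w' l)) * (nfold σ n w u * nfold σ n w' u' *
      ∑ y, nfold (comp t ρ) n u y *
        (if Dreg n τ σ (comp t ρ) A B w' u' y then 1 else 0)) := by
        refine Finset.sum_le_sum fun w _ => Finset.sum_le_sum fun w' _ =>
          Finset.sum_le_sum fun u _ =>
          Finset.sum_le_sum fun u' _ => mul_le_mul_of_nonneg_left (mul_le_mul_of_nonneg_left
          (Finset.sum_le_sum fun y _ => mul_le_mul_of_nonneg_right
            (fencT_le n t ht τ σ ρ δ hρ w u y) (by split_ifs <;> norm_num))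
          (mul_nonneg (hσn.1 _ _) (hσn.1 _ _))) (mul_nonneg (hP0 _) (hP0 _))
    _ = ∑ w' : Fin n → W, ∑ u' : Fin n → U, (∏ l, τ (w' l)) * nfold σ n w' u' *
        ∑ y, (∏ l, ∑ w, τ w * comp (comp t ρ) σ w (y l)) *
          (if Dreg n τ σ (comp t ρ) A B w' u' y then 1 else 0) := by
        rw [Finset.sum_comm]
        refine Finset.sum_congr rfl fun w' _ => ?_
        have e1 : ∀ w : Fin n → W, (∑ u : Fin n → U, ∑ u' : Fin n → U,
            (∏ l, τ (w l)) * (∏ l, τ (w' l)) * (nfold σ n w u * nfold σ n w' u' *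
            ∑ y, nfold (comp t ρ) n u y *
              (if Dreg n τ σ (comp t ρ) A B w' u' y then 1 else 0))) =
            ∑ u' : Fin n → U, ∑ y, (∏ l, τ (w l)) * nfold (comp (comp t ρ) σ) n w y *
              ((∏ l, τ (w' l)) * nfold σ n w' u' *
              (if Dreg n τ σ (comp t ρ) A B w' u' y then 1 else 0)) := by
          intro w
          rw [Finset.sum_comm]
          refine Finset.sum_congr rfl fun u' _ => ?_
          simp only [← nfold_comp n σ (comp t ρ), Finset.mul_sum, Finset.sum_mul]
          rw [Finset.sum_comm]
          exact Finset.sum_congr rfl fun y _ => Finset.sum_congr rfl fun u _ => by ring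
        simp only [e1]
        rw [Finset.sum_comm]
        refine Finset.sum_congr rfl fun u' _ => ?_
        rw [Finset.sum_comm, Finset.mul_sum]
        refine Finset.sum_congr rfl fun y _ => ?_
        rw [← Finset.sum_mul, pmass_comp]
        ring
    _ ≤ ∑ w : Fin n → W, ∑ u' : Fin n → U, (∏ l, τ (w l)) * nfold σ n w u' *
        ∑ y, e * nfold (comp t ρ) n u' y := by
        refine Finset.sum_le_sum fun w _ => Finset.sum_le_sum fun u' _ =>
          mul_le_mul_of_nonneg_left (Finset.sum_le_sum fun y _ => hD w u' y)
          (mul_nonneg (hP0 _) (hσn.1 _ _))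
    _ = e := by
        simp only [← Finset.mul_sum, hVn.2, mul_one, ← Finset.sum_mul, hσn.2,
          sum_prod_one τ hτ.2 n, one_mul]

lemma comb_bij {n : ℕ} : Function.Bijective
    (fun i : (Fin n → W) × (Fin n → U) × (Fin n → X) × (Fin n → Y) =>
      comb i.1 i.2.1 i.2.2.1 i.2.2.2) := by
  constructor
  · intro i i' h
    have : ∀ l, _ := fun l => congrFun h l
    simp only [comb, Prod.mk.injEq] at this
    exact Prod.ext (funext fun l => (this l).1) (Prod.ext (funext fun l => (this l).2.1)
        (Prod.ext (funext fun l => (this l).2.2.1) (funext fun l => (this l).2.2.2)))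
  · intro s
    exact ⟨(fun l => (s l).1, fun l => (s l).2.1, fun l => (s l).2.2.1, fun l => (s l).2.2.2), rfl⟩

lemma sum_comb {n : ℕ} (F : (Fin n → W × U × X × Y) → ℝ) :
    ∑ w : Fin n → W, ∑ u : Fin n → U, ∑ x : Fin n → X, ∑ y : Fin n → Y, F (comb w u x y) =
      ∑ s, F s := by
  rw [← Fintype.sum_bijective _ (comb_bij (W := W) (U := U) (X := X) (Y := Y) (n := n))
    (fun i => F (comb i.1 i.2.1 i.2.2.1 i.2.2.2)) F (fun _ => rfl)]
  simp only [Fintype.sum_prod_type]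

/-- the ratio test from a log-likelihood sum -/
lemma ratio_test {n : ℕ} (v o : Fin n → ℝ) (hv : ∀ l, 0 < v l) (ho : ∀ l, 0 < o l)
    (m δ : ℝ) (h : |∑ l, Real.logb 2 (v l / o l) - n * m| ≤ n * δ) :
    (2 : ℝ) ^ ((n : ℝ) * (m - δ)) * ∏ l, o l ≤ ∏ l, v l := by
  have h1 : (n : ℝ) * (m - δ) ≤ ∑ l, Real.logb 2 (v l / o l) := by
    have := (abs_le.1 h).1
    linarith
  have h2 : (2 : ℝ) ^ (∑ l, Real.logb 2 (v l / o l)) = ∏ l, (v l / o l) := by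
    rw [← Real.logb_prod _ _ (fun l _ => (div_pos (hv l) (ho l)).ne')]
    exact Real.rpow_logb two_pos (by norm_num) (Finset.prod_pos fun l _ => div_pos (hv l) (ho l))
  have h3 := Real.rpow_le_rpow_of_exponent_le (one_le_two : (1 : ℝ) ≤ 2) h1
  rw [h2, Finset.prod_div_distrib, le_div_iff₀ (Finset.prod_pos fun l _ => ho l)] at h3
  exact h3

open Classical in
lemma succ_bound (t : X → Y → ℝ) (ht : IsChannel t) (τ : W → ℝ) (σ : W → U → ℝ)
    (ρ : U → X → ℝ) (hρ : IsChannel ρ) (hσ : IsChannel σ) (hτ : IsDist τ)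
    (δ' δ η : ℝ) (hδ' : 0 < δ') (hδ : 0 < δ) (hη : 0 < η) :
    ∀ᶠ n : ℕ in Filter.atTop,
    1 - ∑ w : Fin n → W, ∑ u : Fin n → U, (∏ l, τ (w l)) * nfold σ n w u *
      ∑ y, (∑ x, fenc n τ σ ρ δ' w u x * nfold t n x y) *
        (if Dreg n τ σ (comp t ρ) (mutInfo (comp (comp t ρ) σ) τ + condMutInfo (comp t ρ) σ τ - δ)
          (condMutInfo (comp t ρ) σ τ - δ) w u y then 1 else 0) ≤ η := by
  set V := comp t ρ with hVdef
  have hV : IsChannel V := comp_channel ht hρ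
  have hVσ : IsChannel (comp V σ) := comp_channel hV hσ
  set a := mutInfo (comp V σ) τ with ha
  set b := condMutInfo V σ τ with hb
  set P : W × U × X × Y → ℝ := fun s => τ s.1 * σ s.1 s.2.1 * ρ s.2.1 s.2.2.1 * t s.2.2.1 s.2.2.2
    with hP
  have hP0 : ∀ s, 0 ≤ P s := fun s =>
    mul_nonneg (mul_nonneg (mul_nonneg (hτ.1 _) (hσ.1 _ _)) (hρ.1 _ _)) (ht.1 _ _)
  have hP1 : ∑ s, P s = 1 := by
    simp only [hP, Fintype.sum_prod_type, ← Finset.mul_sum, ht.2, hρ.2, hσ.2, hτ.2, mul_one]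
  set out : Y → ℝ := fun y => ∑ w, τ w * comp V σ w y with hout
  -- three kinds of test functions
  let h1 : W × U × X × Y → ℝ := fun s => Real.logb 2 (V s.2.1 s.2.2.2 / comp V σ s.1 s.2.2.2)
  let h2 : W × U × X × Y → ℝ := fun s => Real.logb 2 (V s.2.1 s.2.2.2 / out s.2.2.2)
  let h3 : W × U × X → W × U × X × Y → ℝ := fun c s => if (s.1, s.2.1, s.2.2.1) = c then 1 else 0
  have m1 : ∑ s, P s * h1 s = b := by
    simp only [hP, h1, Fintype.sum_prod_type, hb, condMutInfo]
    refine Finset.sum_congr rfl fun w _ => Finset.sum_congr rfl fun u _ => ?_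
    rw [Finset.sum_comm]
    refine Finset.sum_congr rfl fun y _ => ?_
    rw [← Finset.sum_mul]
    congr 1
    simp only [hVdef, comp, Finset.mul_sum, mul_assoc]
  have m2 : ∑ s, P s * h2 s = a + b := by
    rw [ha, hb, ← chain_rule V σ τ hV hσ hτ]
    simp only [hP, h2, Fintype.sum_prod_type, mutInfo, marg_comp_eq]
    rw [Finset.sum_comm]
    refine Finset.sum_congr rfl fun u _ => ?_
    have : ∀ w : W, (∑ x, ∑ y, τ w * σ w u * ρ u x * t x y * Real.logb 2 (V u y / out y)) =
        ∑ y, τ w * σ w u * V u y * Real.logb 2 (V u y / out y) := by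
      intro w
      rw [Finset.sum_comm]
      refine Finset.sum_congr rfl fun y _ => ?_
      rw [← Finset.sum_mul]
      congr 1
      simp only [hVdef, comp, Finset.mul_sum, mul_assoc]
    simp only [this]
    rw [Finset.sum_comm]
    refine Finset.sum_congr rfl fun y _ => ?_
    rw [← Finset.sum_mul]
    congr 1
    rw [← Finset.sum_mul]
    rfl
  have m3 : ∀ c, ∑ s, P s * h3 c s = τ c.1 * σ c.1 c.2.1 * ρ c.2.1 c.2.2 := by
    rintro ⟨w, u, x⟩
    have e : ∀ s : W × U × X × Y, P s * h3 (w, u, x) s =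
        (fun (c : W × U × X) (y : Y) => if c = (w, u, x) then
          τ w * σ w u * ρ u x * t x y else 0) (s.1, s.2.1, s.2.2.1) s.2.2.2 := by
      rintro ⟨w', u', x', y⟩
      simp only [h3, hP]
      split_ifs with h
      · simp only [Prod.mk.injEq] at h
        obtain ⟨rfl, rfl, rfl⟩ := h
        simp
      · simp
    simp only [e, Fintype.sum_prod_type, Prod.mk.injEq, ite_and]
    simp only [Finset.sum_ite_irrel, Finset.sum_const_zero, Finset.sum_ite_eq', Finset.mem_univ,
      if_true]
    simp [← Finset.mul_sum, ht.2]
  set N : ℝ := (Fintype.card (W × U × X) : ℝ) with hN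
  have hN0 : 0 ≤ N := Nat.cast_nonneg _
  have hη' : 0 < η / (N + 2) := by positivity
  have E1 := wlln P hP0 hP1 h1 δ _ hδ hη'
  have E2 := wlln P hP0 hP1 h2 δ _ hδ hη'
  have E3 := Filter.eventually_all.2 fun c => wlln P hP0 hP1 (h3 c) δ' _ hδ' hη'
  filter_upwards [E1, E2, E3, Filter.eventually_gt_atTop 0] with n E1 E2 E3 hn
  simp only [m1, m2, m3] at E1 E2 E3
  have hn' : (0 : ℝ) < n := by exact_mod_cast hn
  set b1 : (Fin n → W × U × X × Y) → ℝ := fun s =>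
    if (n : ℝ) * δ < |∑ l, h1 (s l) - n * b| then 1 else 0 with hb1
  set b2 : (Fin n → W × U × X × Y) → ℝ := fun s =>
    if (n : ℝ) * δ < |∑ l, h2 (s l) - n * (a + b)| then 1 else 0 with hb2
  set b3 : W × U × X → (Fin n → W × U × X × Y) → ℝ := fun c s =>
    if (n : ℝ) * δ' < |∑ l, h3 c (s l) - n * (τ c.1 * σ c.1 c.2.1 * ρ c.2.1 c.2.2)| then 1 else 0
    with hb3
  have b10 : ∀ s, 0 ≤ b1 s := fun s => by simp only [hb1]; split_ifs <;> norm_num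
  have b20 : ∀ s, 0 ≤ b2 s := fun s => by simp only [hb2]; split_ifs <;> norm_num
  have b30 : ∀ c s, 0 ≤ b3 c s := fun c s => by simp only [hb3]; split_ifs <;> norm_num
  set g : (Fin n → W × U × X × Y) → ℝ := fun s =>
    (if Typ τ σ ρ δ' (fun l => (s l).1) (fun l => (s l).2.1) (fun l => (s l).2.2.1) then 1 else 0) *
    (if Dreg n τ σ V (a + b - δ) (b - δ) (fun l => (s l).1) (fun l => (s l).2.1)
      (fun l => (s l).2.2.2) then 1 else 0) with hg
  have hsum : ∑ w : Fin n → W, ∑ u : Fin n → U, (∏ l, τ (w l)) * nfold σ n w u *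
      ∑ y, (∑ x, fenc n τ σ ρ δ' w u x * nfold t n x y) *
        (if Dreg n τ σ V (a + b - δ) (b - δ) w u y then 1 else 0) =
      ∑ s : Fin n → W × U × X × Y, (∏ l, P (s l)) * g s := by
    rw [← sum_comb]
    refine Finset.sum_congr rfl fun w _ => Finset.sum_congr rfl fun u _ => ?_
    rw [Finset.sum_comm]
    rw [Finset.mul_sum]
    refine Finset.sum_congr rfl fun y _ => ?_
    rw [Finset.sum_mul, Finset.mul_sum]
    refine Finset.sum_congr rfl fun x _ => ?_
    have e : g (comb w u x y) = (if Typ τ σ ρ δ' w u x then 1 else 0) *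
        (if Dreg n τ σ V (a + b - δ) (b - δ) w u y then 1 else 0) := rfl
    rw [e]
    simp only [hP, comb, fenc, nfold, Finset.prod_mul_distrib]
    ring
  have hkey : ∀ s : Fin n → W × U × X × Y,
      (∏ l, P (s l)) * (1 - g s) ≤ (∏ l, P (s l)) * (b1 s + b2 s + ∑ c, b3 c s) := by
    intro s
    have hp : 0 ≤ ∏ l, P (s l) := Finset.prod_nonneg fun l _ => hP0 _
    rcases hp.eq_or_lt with h0 | hpos
    · rw [← h0]; simp
    refine mul_le_mul_of_nonneg_left ?_ hp
    have hg1 : 0 ≤ g s := by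
      simp only [hg]
      exact mul_nonneg (by split_ifs <;> norm_num) (by split_ifs <;> norm_num)
    have hb3s : 0 ≤ ∑ c, b3 c s := Finset.sum_nonneg fun c _ => b30 c s
    by_cases c1 : (n : ℝ) * δ < |∑ l, h1 (s l) - n * b|
    · have : b1 s = 1 := if_pos c1
      linarith [b20 s]
    by_cases c2 : (n : ℝ) * δ < |∑ l, h2 (s l) - n * (a + b)|
    · have : b2 s = 1 := if_pos c2
      linarith [b10 s]
    by_cases c3 : ∃ c : W × U × X,
        (n : ℝ) * δ' < |∑ l, h3 c (s l) - n * (τ c.1 * σ c.1 c.2.1 * ρ c.2.1 c.2.2)|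
    · obtain ⟨c, hc⟩ := c3
      have h1' : b3 c s = 1 := if_pos hc
      have := le_sum_term (fun c => b3 c s) (fun c => b30 c s) c
      simp only [h1'] at this
      linarith [b10 s, b20 s]
    push Not at c1 c2 c3
    have hP' : ∀ l, P (s l) ≠ 0 := fun l => (Finset.prod_ne_zero_iff.1 hpos.ne') l (Finset.mem_univ l)
    have hs : ∀ l, 0 < V (s l).2.1 (s l).2.2.2 ∧ 0 < comp V σ (s l).1 (s l).2.2.2 ∧
        0 < out (s l).2.2.2 := by
      intro l
      have := hP' l
      simp only [hP, mul_ne_zero_iff] at this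
      obtain ⟨⟨⟨p1, p2⟩, p3⟩, p4⟩ := this
      have p1 := (hτ.1 _).lt_of_ne' p1
      have p2 := (hσ.1 _ _).lt_of_ne' p2
      have p3 := (hρ.1 _ _).lt_of_ne' p3
      have p4 := (ht.1 _ _).lt_of_ne' p4
      have v1 : 0 < V (s l).2.1 (s l).2.2.2 := (mul_pos p3 p4).trans_le
        (le_sum_term (fun x => ρ (s l).2.1 x * t x (s l).2.2.2)
          (fun x => mul_nonneg (hρ.1 _ _) (ht.1 _ _)) _)
      have v2 : 0 < comp V σ (s l).1 (s l).2.2.2 := (mul_pos p2 v1).trans_le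
        (le_sum_term (fun u => σ (s l).1 u * V u (s l).2.2.2)
          (fun u => mul_nonneg (hσ.1 _ _) (hV.1 _ _)) _)
      exact ⟨v1, v2, (mul_pos p1 v2).trans_le
        (le_sum_term (fun w => τ w * comp V σ w (s l).2.2.2)
          (fun w => mul_nonneg (hτ.1 _) (hVσ.1 _ _)) _)⟩
    have hgs : g s = 1 := by
      simp only [hg]
      rw [if_pos, if_pos, one_mul]
      · exact ⟨ratio_test _ _ (fun l => (hs l).1) (fun l => (hs l).2.1) b δ c1,
          ratio_test _ _ (fun l => (hs l).1) (fun l => (hs l).2.2) (a + b) δ c2⟩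
      · intro c
        have := c3 c
        have e : ty (fun l => ((s l).1, (s l).2.1, (s l).2.2.1)) c -
            τ c.1 * σ c.1 c.2.1 * ρ c.2.1 c.2.2 =
            (∑ l, h3 c (s l) - n * (τ c.1 * σ c.1 c.2.1 * ρ c.2.1 c.2.2)) / n := by
          have e' : ty (fun l => ((s l).1, (s l).2.1, (s l).2.2.1)) c = (∑ l, h3 c (s l)) / n := by
            unfold ty
            simp only [h3]
            congr 1
            refine Finset.sum_congr rfl fun l _ => ?_
            split_ifs <;> rfl
          rw [e']
          field_simp
        beta_reduce
        rw [e, abs_div, abs_of_pos hn', div_le_iff₀ hn']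
        linarith
    rw [hgs]
    linarith [b10 s, b20 s]
  have hone := sum_prod_one P hP1 n
  rw [hsum]
  calc _ = ∑ s : Fin n → W × U × X × Y, (∏ l, P (s l)) * (1 - g s) := by
        simp only [mul_sub, mul_one, Finset.sum_sub_distrib, hone]
    _ ≤ ∑ s : Fin n → W × U × X × Y, (∏ l, P (s l)) * (b1 s + b2 s + ∑ c, b3 c s) :=
        Finset.sum_le_sum fun s _ => hkey s
    _ = ∑ s : Fin n → W × U × X × Y, (∏ l, P (s l)) * b1 s +
        ∑ s : Fin n → W × U × X × Y, (∏ l, P (s l)) * b2 s +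
        ∑ c, ∑ s : Fin n → W × U × X × Y, (∏ l, P (s l)) * b3 c s := by
        simp only [mul_add, Finset.sum_add_distrib, Finset.mul_sum]
        congr 1
        rw [Finset.sum_comm]
    _ ≤ η / (N + 2) + η / (N + 2) + ∑ _c : W × U × X, η / (N + 2) :=
        add_le_add (add_le_add E1 E2) (Finset.sum_le_sum fun c _ => E3 c)
    _ = η := by
        rw [Finset.sum_const, Finset.card_univ, nsmul_eq_mul, ← hN]
        field_simp
        ring

end Err

set_option linter.unusedSectionVars false

/-! ### Secrecy side: summing over the types -/

section SecSum

variable {W U X Y Z : Type*} [Fintype W] [Fintype U] [Fintype X] [Fintype Y] [Fintype Z]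

lemma gth_zero_of_not_type {n : ℕ} (ρ : U → X → ℝ) (q : X → Z → ℝ)
    (θ : W × U × X × Z → ℝ) (h : ¬ ∃ s : Fin n → W × U × X × Z, ty s = θ)
    (z : Fin n → Z) (w : Fin n → W) (u : Fin n → U) : gth n ρ q θ z w u = 0 := by
  unfold gth
  exact Finset.sum_eq_zero fun x _ => by rw [if_neg fun h' => h ⟨_, h'⟩]

lemma gth_zero_of_q {n : ℕ} (ρ : U → X → ℝ) (q : X → Z → ℝ)
    (θ : W × U × X × Z → ℝ) (a : W × U × X × Z) (ha : q a.2.2.1 a.2.2.2 = 0) (hθ : θ a ≠ 0)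
    (z : Fin n → Z) (w : Fin n → W) (u : Fin n → U) : gth n ρ q θ z w u = 0 := by
  classical
  unfold gth
  refine Finset.sum_eq_zero fun x _ => ?_
  split_ifs with h
  swap
  · rfl
  have : ∃ l, comb w u x z l = a := by
    by_contra hne
    push Not at hne
    apply hθ
    rw [← h]
    unfold ty
    simp [hne]
  obtain ⟨l, hl⟩ := this
  refine Finset.prod_eq_zero (Finset.mem_univ l) ?_
  subst hl
  simp only [comb] at ha
  rw [ha, mul_zero]

lemma sec_theta {n M0 M1 K : ℕ} (hn : 0 < n) (hM0 : 0 < M0) (hM1 : 0 < M1) (hK : 0 < K)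
    (τ : W → ℝ) (σ : W → U → ℝ) (ρ : U → X → ℝ) (q : X → Z → ℝ)
    (hτ : IsDist τ) (hσ : IsChannel σ) (hρ : IsChannel ρ) (hq : IsChannel q)
    (a A c e : ℝ) (hc : 0 ≤ c) (hMa : (M0 : ℝ) ≤ Real.exp (n * a))
    (hMA : Real.exp (n * (A - c)) ≤ 8 * (M0 * M1 * K))
    (θ : W × U × X × Z → ℝ) (hθ : ∑ a, θ a = 1) (he : e ≤ Efun τ σ ρ q a A θ) :
    ∑ z : Fin n → Z, ∑ w : Fin M0 → Fin n → W, ∑ u : Fin M0 × Fin M1 × Fin K → Fin n → U,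
      cbw (fun w => ∏ l, τ (w l)) (nfold σ n) w u * maxKey (gth n ρ q θ z) w u ≤
      M0 * M1 * K * (2 / K + (1 + 8 * Real.log K) * Real.exp (-(n * (e - c)))) := by
  have hn' : (0 : ℝ) < n := by exact_mod_cast hn
  have hK' : (1 : ℝ) ≤ K := by exact_mod_cast hK
  have hM0' : (0 : ℝ) < M0 := by exact_mod_cast hM0
  have hM1' : (0 : ℝ) < M1 := by exact_mod_cast hM1
  have hlog : 0 ≤ Real.log K := Real.log_nonneg hK'
  have hK0 : (0 : ℝ) < K := by linarith
  rcases le_max_iff.1 (show e ≤ max _ _ from he) with h | h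
  · refine (sec_A hn hK τ σ ρ q hτ hσ hρ hq θ).trans ?_
    refine mul_le_mul_of_nonneg_left ?_ (by positivity)
    have h1 : Real.exp (n * Psi1 τ σ ρ q θ) ≤ Real.exp (-(n * (e - c))) := by
      apply Real.exp_le_exp.2
      rw [← mul_neg]
      exact mul_le_mul_of_nonneg_left (by linarith) hn'.le
    have h2 : 0 ≤ 2 / (K : ℝ) := by positivity
    have h3 := mul_nonneg hlog (Real.exp_pos (-(n * (e - c)))).le
    nlinarith
  · refine (sec_B hn hK τ σ ρ q hτ hσ hρ hq θ hθ).trans ?_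
    set m := max (-Psi3 τ θ - a) 0 with hm
    have h1 : min 1 ((M0 : ℝ) * Real.exp (n * Psi3 τ θ)) ≤ Real.exp (-(n * m)) := by
      rcases le_total (-Psi3 τ θ - a) 0 with h' | h'
      · rw [hm, max_eq_right h']
        simp
      · rw [hm, max_eq_left h']
        refine (min_le_right _ _).trans ?_
        refine (mul_le_mul_of_nonneg_right hMa (Real.exp_pos _).le).trans (le_of_eq ?_)
        rw [← Real.exp_add]
        congr 1
        ring
    have h2 : Real.exp (n * Psi2 ρ q θ) * min 1 ((M0 : ℝ) * Real.exp (n * Psi3 τ θ)) ≤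
        8 * (M0 * M1 * K) * Real.exp (-(n * (e - c))) := by
      refine (mul_le_mul_of_nonneg_left h1 (Real.exp_pos _).le).trans ?_
      refine le_trans ?_ (mul_le_mul_of_nonneg_right hMA (Real.exp_pos _).le)
      rw [← Real.exp_add, ← Real.exp_add]
      apply Real.exp_le_exp.2
      have := mul_le_mul_of_nonneg_left h hn'.le
      nlinarith
    have h3 := mul_le_mul_of_nonneg_left h2 hlog
    have h4 : (M0 * M1 * K : ℝ) * (2 / K) = 2 * (M0 * M1) := by field_simp
    have h5 : 0 ≤ (M0 * M1 * K : ℝ) * Real.exp (-(n * (e - c))) := by positivity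
    nlinarith

/-- type from counts -/
def tyR {S : Type*} (n : ℕ) (θ : S → Fin (n + 1)) (a : S) : ℝ := ((θ a : ℕ) : ℝ) / n

lemma exists_tyR {S : Type*} [Fintype S] {n : ℕ} (s : Fin n → S) :
    ∃ θ : S → Fin (n + 1), ty s = tyR n θ := by
  classical
  refine ⟨fun a => ⟨(Finset.univ.filter fun l => s l = a).card, ?_⟩, ?_⟩
  · refine Nat.lt_succ_of_le ((Finset.card_le_univ _).trans ?_)
    simp
  · funext a
    unfold ty tyR
    simp only [Finset.sum_boole]

/-- closeness of the channel-input marginal of a type -/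
def Good (τ : W → ℝ) (σ : W → U → ℝ) (ρ : U → X → ℝ) (δ : ℝ) (θ : W × U × X × Z → ℝ) : Prop :=
  ∀ b, |push pWUX θ b - τ b.1 * σ b.1 b.2.1 * ρ b.2.1 b.2.2| ≤ δ

open Classical in
/-- the type decomposition of the adversary's observation probabilities -/
def gzf (n : ℕ) (τ : W → ℝ) (σ : W → U → ℝ) (ρ : U → X → ℝ) (q : X → Z → ℝ) (δ : ℝ)
    (θ : W × U × X × Z → Fin (n + 1)) (z : Fin n → Z) (w : Fin n → W) (u : Fin n → U) : ℝ :=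
  if Good τ σ ρ δ (tyR n θ) then gth n ρ q (tyR n θ) z w u else 0

lemma gzf_nonneg (n : ℕ) (τ : W → ℝ) (σ : W → U → ℝ) (ρ : U → X → ℝ) (q : X → Z → ℝ) (δ : ℝ)
    (hρ : IsChannel ρ) (hq : IsChannel q)
    (θ : W × U × X × Z → Fin (n + 1)) (z : Fin n → Z) (w : Fin n → W) (u : Fin n → U) :
    0 ≤ gzf n τ σ ρ q δ θ z w u := by
  unfold gzf
  split_ifs
  · exact gth_nonneg n ρ q hρ.1 hq.1 _ _ _ _
  · exact le_rfl

open Classical in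
lemma gzf_sum (n : ℕ) (τ : W → ℝ) (σ : W → U → ℝ) (ρ : U → X → ℝ) (q : X → Z → ℝ) (δ : ℝ)
    (hρ : IsChannel ρ) (hq : IsChannel q) (w : Fin n → W) (u : Fin n → U) (z : Fin n → Z) :
    ∑ x, fenc n τ σ ρ δ w u x * nfold q n x z ≤ ∑ θ, gzf n τ σ ρ q δ θ z w u := by
  have e : ∀ θ : W × U × X × Z → Fin (n + 1), gzf n τ σ ρ q δ θ z w u =
      ∑ x, if Good τ σ ρ δ (tyR n θ) ∧ ty (comb w u x z) = tyR n θ then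
        ∏ l, ρ (u l) (x l) * q (x l) (z l) else 0 := by
    intro θ
    unfold gzf gth
    split_ifs with h
    · exact Finset.sum_congr rfl fun x _ => by simp only [h, true_and]
    · simp [h]
  simp only [e]
  rw [Finset.sum_comm]
  refine Finset.sum_le_sum fun x _ => ?_
  have hp : ∀ l, 0 ≤ ρ (u l) (x l) * q (x l) (z l) := fun l => mul_nonneg (hρ.1 _ _) (hq.1 _ _)
  have hnn : ∀ θ : W × U × X × Z → Fin (n + 1), 0 ≤
      if Good τ σ ρ δ (tyR n θ) ∧ ty (comb w u x z) = tyR n θ then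
        ∏ l, ρ (u l) (x l) * q (x l) (z l) else 0 := by
    intro θ
    split_ifs
    · exact Finset.prod_nonneg fun l _ => hp l
    · exact le_rfl
  unfold fenc
  split_ifs with h
  · obtain ⟨θ, hθ⟩ := exists_tyR (comb w u x z)
    have hg : Good τ σ ρ δ (tyR n θ) := by
      rw [← hθ]
      intro b
      rw [push_ty]
      exact h b
    have := le_sum_term _ hnn θ
    rw [if_pos ⟨hg, hθ⟩] at this
    refine le_trans (le_of_eq ?_) this
    unfold nfold
    rw [mul_one, Finset.prod_mul_distrib]
  · rw [mul_zero, zero_mul]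
    exact Finset.sum_nonneg fun θ _ => hnn θ

lemma maxKey_zero_sum {n M0 M1 K : ℕ} (hK : 0 < K) (P0 : (Fin n → W) → ℝ)
    (P1 : (Fin n → W) → (Fin n → U) → ℝ)
    (g : (Fin n → Z) → (Fin n → W) → (Fin n → U) → ℝ) (hg : ∀ z w u, g z w u = 0) :
    ∑ z : Fin n → Z, ∑ w : Fin M0 → Fin n → W, ∑ u : Fin M0 × Fin M1 × Fin K → Fin n → U,
      cbw P0 P1 w u * maxKey (g z) w u = 0 := by
  have : Nonempty (Fin K) := ⟨⟨0, hK⟩⟩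
  refine Finset.sum_eq_zero fun z _ => Finset.sum_eq_zero fun w _ =>
    Finset.sum_eq_zero fun u _ => ?_
  have : maxKey (g z) w u = 0 := by
    unfold maxKey
    simp [hg]
  rw [this, mul_zero]

open Classical in
lemma sec_total {n M0 M1 K : ℕ} (hn : 0 < n) (hM0 : 0 < M0) (hM1 : 0 < M1) (hK : 0 < K)
    (τ : W → ℝ) (σ : W → U → ℝ) (ρ : U → X → ℝ) (q : X → Z → ℝ)
    (hτ : IsDist τ) (hσ : IsChannel σ) (hρ : IsChannel ρ) (hq : IsChannel q)
    (a A c e δ : ℝ) (hc : 0 ≤ c) (hMa : (M0 : ℝ) ≤ Real.exp (n * a))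
    (hMA : Real.exp (n * (A - c)) ≤ 8 * (M0 * M1 * K))
    (he : ∀ θ : W × U × X × Z → ℝ, (∀ a, 0 ≤ θ a) → ∑ a, θ a = 1 →
      (∀ a, q a.2.2.1 a.2.2.2 = 0 → θ a = 0) →
      (∀ b, |push pWUX θ b - τ b.1 * σ b.1 b.2.1 * ρ b.2.1 b.2.2| ≤ δ) →
      e ≤ Efun τ σ ρ q a A θ) :
    ∑ θ : W × U × X × Z → Fin (n + 1), ∑ z : Fin n → Z, ∑ w : Fin M0 → Fin n → W,
      ∑ u : Fin M0 × Fin M1 × Fin K → Fin n → U,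
      cbw (fun w => ∏ l, τ (w l)) (nfold σ n) w u * maxKey (gzf n τ σ ρ q δ θ z) w u ≤
      ((n : ℝ) + 1) ^ Fintype.card (W × U × X × Z) *
      (M0 * M1 * K * (2 / K + (1 + 8 * Real.log K) * Real.exp (-(n * (e - c))))) := by
  have hK' : (1 : ℝ) ≤ K := by exact_mod_cast hK
  have hlog : 0 ≤ Real.log K := Real.log_nonneg hK'
  have hB : 0 ≤ (M0 * M1 * K * (2 / K + (1 + 8 * Real.log K) * Real.exp (-(n * (e - c)))) : ℝ) := by
    positivity
  have key : ∀ θ : W × U × X × Z → Fin (n + 1), ∑ z : Fin n → Z, ∑ w : Fin M0 → Fin n → W,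
      ∑ u : Fin M0 × Fin M1 × Fin K → Fin n → U,
      cbw (fun w => ∏ l, τ (w l)) (nfold σ n) w u * maxKey (gzf n τ σ ρ q δ θ z) w u ≤
      (M0 * M1 * K * (2 / K + (1 + 8 * Real.log K) * Real.exp (-(n * (e - c))))) := by
    intro θ
    by_cases hg : Good τ σ ρ δ (tyR n θ)
    swap
    · rw [maxKey_zero_sum hK _ _ _ (fun z w u => by unfold gzf; rw [if_neg hg])]
      exact hB
    have hgz : ∀ z, gzf n τ σ ρ q δ θ z = gth n ρ q (tyR n θ) z := by
      intro z; funext w u; unfold gzf; rw [if_pos hg]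
    simp only [hgz]
    by_cases hty : ∃ s : Fin n → W × U × X × Z, ty s = tyR n θ
    swap
    · rw [maxKey_zero_sum hK _ _ _ (fun z w u => gth_zero_of_not_type ρ q _ hty z w u)]
      exact hB
    by_cases hqz : ∃ a : W × U × X × Z, q a.2.2.1 a.2.2.2 = 0 ∧ tyR n θ a ≠ 0
    · obtain ⟨a, ha, hθa⟩ := hqz
      rw [maxKey_zero_sum hK _ _ _ (fun z w u => gth_zero_of_q ρ q _ a ha hθa z w u)]
      exact hB
    push Not at hqz
    obtain ⟨s, hs⟩ := hty
    have h1 : ∑ a, tyR n θ a = 1 := by rw [← hs]; exact sum_ty hn s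
    exact sec_theta hn hM0 hM1 hK τ σ ρ q hτ hσ hρ hq a A c e hc hMa hMA _ h1
      (he _ (fun a => by rw [← hs]; exact ty_nonneg s a) h1 hqz hg)
  refine (Finset.sum_le_sum fun θ _ => key θ).trans (le_of_eq ?_)
  rw [Finset.sum_const, Finset.card_univ, nsmul_eq_mul]
  congr 1
  rw [Fintype.card_fun]
  simp

end SecSum

set_option linter.unusedSectionVars false

/-! ### Existence of good one-round codes -/

section Good

variable {W U X Y Z : Type*} [Fintype W] [Fintype U] [Fintype X] [Fintype Y] [Fintype Z]

lemma floor_size (n : ℕ) (x : ℝ) (hx : 0 ≤ x) :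
    ∃ N : ℕ, 0 < N ∧ (N : ℝ) ≤ (2 : ℝ) ^ ((n : ℝ) * x) ∧ (2 : ℝ) ^ ((n : ℝ) * x) ≤ 2 * N := by
  have h1 : (1 : ℝ) ≤ (2 : ℝ) ^ ((n : ℝ) * x) :=
    Real.one_le_rpow one_le_two (mul_nonneg (Nat.cast_nonneg n) hx)
  have h0 : 0 < ⌊(2 : ℝ) ^ ((n : ℝ) * x)⌋₊ := Nat.floor_pos.2 h1
  refine ⟨⌊(2 : ℝ) ^ ((n : ℝ) * x)⌋₊, h0, Nat.floor_le (by linarith), ?_⟩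
  have h2 := Nat.lt_floor_add_one ((2 : ℝ) ^ ((n : ℝ) * x))
  have h3 : (1 : ℝ) ≤ (⌊(2 : ℝ) ^ ((n : ℝ) * x)⌋₊ : ℝ) := by exact_mod_cast h0
  linarith

lemma rpow_mono_n (n : ℕ) {x y : ℝ} (h : x ≤ y) :
    (2 : ℝ) ^ ((n : ℝ) * x) ≤ (2 : ℝ) ^ ((n : ℝ) * y) :=
  Real.rpow_le_rpow_of_exponent_le one_le_two (mul_le_mul_of_nonneg_left h (Nat.cast_nonneg n))

lemma rpow_add_n (n : ℕ) (x y : ℝ) :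
    (2 : ℝ) ^ ((n : ℝ) * x) * (2 : ℝ) ^ ((n : ℝ) * y) = (2 : ℝ) ^ ((n : ℝ) * (x + y)) := by
  rw [← Real.rpow_add two_pos]; congr 1; ring

lemma sizes (n : ℕ) (a b α δ : ℝ) (ha : 0 ≤ a) (hα : 0 ≤ α) (hb : α ≤ b) (hδ : 0 < δ) :
    ∃ M0 M1 K : ℕ, 0 < M0 ∧ 0 < M1 ∧ 0 < K ∧
      (M0 : ℝ) ≤ (2 : ℝ) ^ ((n : ℝ) * a) ∧ (K : ℝ) ≤ (2 : ℝ) ^ ((n : ℝ) * α) ∧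
      (2 : ℝ) ^ ((n : ℝ) * (α - 3 * δ)) ≤ 2 * K ∧
      (2 : ℝ) ^ ((n : ℝ) * (a + b - 9 * δ)) ≤ 8 * (M0 * M1 * K) ∧
      (2 : ℝ) ^ ((n : ℝ) * (a + b - α - 6 * δ)) ≤ 4 * (M0 * M1) ∧
      (M1 * K : ℝ) - 1 ≤ (2 : ℝ) ^ ((n : ℝ) * (b - 3 * δ)) ∧
      (M0 * M1 * K : ℝ) - 1 ≤ (2 : ℝ) ^ ((n : ℝ) * (a + b - 3 * δ)) := by
  obtain ⟨M0, p0, u0, l0⟩ := floor_size n (max (a - 3 * δ) 0) (le_max_right _ _)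
  obtain ⟨M1, p1, u1, l1⟩ := floor_size n (max (b - α - 3 * δ) 0) (le_max_right _ _)
  obtain ⟨K, pk, uk, lk⟩ := floor_size n (max (α - 3 * δ) 0) (le_max_right _ _)
  have q0 : (0 : ℝ) < M0 := by exact_mod_cast p0
  have q1 : (0 : ℝ) < M1 := by exact_mod_cast p1
  have qk : (0 : ℝ) < K := by exact_mod_cast pk
  have v0 := (rpow_mono_n n (le_max_left (a - 3 * δ) 0)).trans l0
  have v1 := (rpow_mono_n n (le_max_left (b - α - 3 * δ) 0)).trans l1
  have vk := (rpow_mono_n n (le_max_left (α - 3 * δ) 0)).trans lk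
  have w01 := mul_le_mul v0 v1 (Real.rpow_pos_of_pos two_pos _).le (by positivity)
  rw [rpow_add_n] at w01
  have w01k := mul_le_mul w01 vk (Real.rpow_pos_of_pos two_pos _).le (by positivity)
  rw [rpow_add_n] at w01k
  have u1k := mul_le_mul u1 uk qk.le (Real.rpow_pos_of_pos two_pos _).le
  rw [rpow_add_n] at u1k
  have u01k := mul_le_mul u0 u1k (mul_pos q1 qk).le (Real.rpow_pos_of_pos two_pos _).le
  rw [rpow_add_n] at u01k
  refine ⟨M0, M1, K, p0, p1, pk, u0.trans (rpow_mono_n n (max_le (by linarith) ha)),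
    uk.trans (rpow_mono_n n (max_le (by linarith) hα)), vk, ?_, ?_, ?_, ?_⟩
  · have e : a + b - 9 * δ = a - 3 * δ + (b - α - 3 * δ) + (α - 3 * δ) := by ring
    rw [e]; linarith
  · have e : a + b - α - 6 * δ = a - 3 * δ + (b - α - 3 * δ) := by ring
    rw [e]; linarith
  · rcases le_or_gt (max (b - α - 3 * δ) 0 + max (α - 3 * δ) 0) 0 with h | h
    · have h1 := rpow_mono_n n h
      rw [mul_zero, Real.rpow_zero] at h1
      have := Real.rpow_pos_of_pos (two_pos : (0 : ℝ) < 2) ((n : ℝ) * (b - 3 * δ))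
      linarith
    · have h1 : max (b - α - 3 * δ) 0 + max (α - 3 * δ) 0 ≤ b - 3 * δ := by
        rcases max_cases (b - α - 3 * δ) 0 with ⟨e1, _⟩ | ⟨e1, _⟩ <;>
        rcases max_cases (α - 3 * δ) 0 with ⟨e2, _⟩ | ⟨e2, _⟩ <;> rw [e1, e2] at h ⊢ <;> linarith
      linarith [rpow_mono_n n h1]
  · rw [mul_assoc]
    rcases le_or_gt (max (a - 3 * δ) 0 + (max (b - α - 3 * δ) 0 + max (α - 3 * δ) 0)) 0 with h | h
    · have h1 := rpow_mono_n n h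
      rw [mul_zero, Real.rpow_zero] at h1
      have := Real.rpow_pos_of_pos (two_pos : (0 : ℝ) < 2) ((n : ℝ) * (a + b - 3 * δ))
      linarith
    · have h1 : max (a - 3 * δ) 0 + (max (b - α - 3 * δ) 0 + max (α - 3 * δ) 0) ≤
          a + b - 3 * δ := by
        rcases max_cases (a - 3 * δ) 0 with ⟨e0, _⟩ | ⟨e0, _⟩ <;>
        rcases max_cases (b - α - 3 * δ) 0 with ⟨e1, _⟩ | ⟨e1, _⟩ <;>
        rcases max_cases (α - 3 * δ) 0 with ⟨e2, _⟩ | ⟨e2, _⟩ <;>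
        rw [e0, e1, e2] at h ⊢ <;> linarith
      linarith [rpow_mono_n n h1]

lemma rpow_tendsto (δ : ℝ) (hδ : 0 < δ) :
    Filter.Tendsto (fun n : ℕ => (2 : ℝ) ^ (-((n : ℝ) * δ))) Filter.atTop (nhds 0) := by
  have h : ∀ n : ℕ, (2 : ℝ) ^ (-((n : ℝ) * δ)) = ((2 : ℝ) ^ (-δ)) ^ n := by
    intro n
    rw [← Real.rpow_natCast, ← Real.rpow_mul two_pos.le]
    congr 1; ring
  simp only [h]
  exact tendsto_pow_atTop_nhds_zero_of_lt_one (Real.rpow_pos_of_pos two_pos _).le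
    (Real.rpow_lt_one_of_one_lt_of_neg one_lt_two (by linarith))

lemma poly_eventually (N : ℕ) (α δ : ℝ) (hα : 0 ≤ α) (hδ : 0 < δ) :
    ∀ᶠ n : ℕ in Filter.atTop,
      2 + 2 * ((n : ℝ) + 1) ^ N * (5 + 8 * (n * α)) ≤ (2 : ℝ) ^ ((n : ℝ) * δ) := by
  have h1 : Filter.Tendsto (fun n : ℕ => ((n + 1 : ℕ) : ℝ) ^ (N + 1) * ((2 : ℝ) ^ (-δ)) ^ (n + 1))
      Filter.atTop (nhds 0) :=
    (tendsto_pow_const_mul_const_pow_of_abs_lt_one (N + 1) (r := (2 : ℝ) ^ (-δ)) (by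
      rw [abs_of_pos (Real.rpow_pos_of_pos two_pos _)]
      exact Real.rpow_lt_one_of_one_lt_of_neg one_lt_two (by linarith))).comp
      (Filter.tendsto_add_atTop_nat 1)
  set C : ℝ := (2 + 10 + 16 * α) * (2 : ℝ) ^ δ with hC
  have hC0 : 0 < C := by have := Real.rpow_pos_of_pos (two_pos : (0 : ℝ) < 2) δ; positivity
  have h2 := h1.eventually_le_const (show (0 : ℝ) < 1 / C by positivity)
  filter_upwards [h2] with n hn
  have e : ((2 : ℝ) ^ (-δ)) ^ (n + 1) = ((2 : ℝ) ^ ((n : ℝ) * δ) * (2 : ℝ) ^ δ)⁻¹ := by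
    rw [← Real.rpow_natCast, ← Real.rpow_mul two_pos.le, ← Real.rpow_add two_pos,
      ← Real.rpow_neg two_pos.le]
    congr 1; push_cast; ring
  rw [e] at hn
  have hp := Real.rpow_pos_of_pos (two_pos : (0 : ℝ) < 2) ((n : ℝ) * δ)
  have hq := Real.rpow_pos_of_pos (two_pos : (0 : ℝ) < 2) δ
  rw [← div_eq_mul_inv, div_le_div_iff₀ (by positivity) hC0, hC, one_mul] at hn
  have h3 : ((n : ℝ) + 1) ^ (N + 1) * (2 + 10 + 16 * α) ≤ (2 : ℝ) ^ ((n : ℝ) * δ) := by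
    refine le_of_mul_le_mul_right ?_ hq
    push_cast at hn
    linarith
  refine le_trans ?_ h3
  have hn0 : (0 : ℝ) ≤ n := Nat.cast_nonneg n
  have h4 : 1 ≤ ((n : ℝ) + 1) ^ N := one_le_pow₀ (by linarith)
  rw [pow_succ]
  set y := ((n : ℝ) + 1) ^ N
  have h5 : 0 ≤ n * y := by positivity
  have h6 : 0 ≤ α * y := by positivity
  nlinarith

set_option maxHeartbeats 2000000 in
theorem good_code (t : X → Y → ℝ) (q : X → Z → ℝ) (ht : IsChannel t) (hq : IsChannel q)
    (ρ : U → X → ℝ) (σ : W → U → ℝ) (τ : W → ℝ)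
    (hρ : IsChannel ρ) (hσ : IsChannel σ) (hσ' : Deterministic σ) (hτ : IsDist τ)
    (r α : ℝ) (hα : 0 ≤ α)
    (h1 : r + α ≤ mutInfo (comp t ρ) (marg σ τ))
    (h2 : α ≤ Lfun t q ρ σ τ)
    (h3 : α ≤ condMutInfo (comp t ρ) σ τ) (δ0 : ℝ) (hδ0 : 0 < δ0) :
    ∀ᶠ n : ℕ in Filter.atTop, ∃ (M K : ℕ) (f : Fin M × Fin K → (Fin n → X) → ℝ)
      (φ : (Fin n → Y) × Fin K → Option (Fin M) → ℝ),
      0 < M ∧ 0 < K ∧ IsChannel f ∧ IsChannel φ ∧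
      (2 : ℝ) ^ ((n : ℝ) * (r - δ0)) ≤ M ∧ (K : ℝ) ≤ (2 : ℝ) ^ ((n : ℝ) * α) ∧
      roundError t f φ < δ0 ∧
      ∀ ψ : (Fin n → Z) → (Fin n → Y) → ℝ, IsChannel ψ →
        ∑ z, ∑ m, ∑ k, ((1 / (M * (K : ℝ))) * (∑ x, nfold q n x z * f (m, k) x)) *
          ∑ y, ψ z y * ∑ m' ∈ Finset.univ.erase m, φ (y, k) (some m') ≤
        (2 : ℝ) ^ (-(n : ℝ) * (α - δ0)) := by
  classical
  have hl : 0 < Real.log 2 := Real.log_pos (by norm_num)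
  have hV := comp_channel ht hρ
  set a := mutInfo (comp (comp t ρ) σ) τ with ha
  set b := condMutInfo (comp t ρ) σ τ with hb
  have ha0 : 0 ≤ a := mutInfo_nonneg _ _ (comp_channel hV hσ) hτ
  rw [chain_rule _ _ _ hV hσ hτ, ← ha, ← hb] at h1
  set δ := δ0 / 20 with hδ
  have hδp : 0 < δ := by positivity
  obtain ⟨δ', hδ'p, hnear⟩ := exponent_near t q hq ρ σ τ hρ hσ hσ' hτ α (Real.log 2 * δ)
    (by positivity) h2
  have E1 := succ_bound t ht τ σ ρ hρ hσ hτ δ' δ (δ0 / 8) hδ'p hδp (by positivity)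
  have E2 := poly_eventually (Fintype.card (W × U × X × Z)) α δ hα hδp
  have E3 := (rpow_tendsto (2 * δ) (by positivity)).eventually_le_const
    (show (0 : ℝ) < δ0 / 16 by positivity)
  have E4 := (rpow_tendsto δ hδp).eventually_le_const (show (0 : ℝ) < 1 / 4 by norm_num)
  filter_upwards [E1, E2, E3, E4, Filter.eventually_gt_atTop 0] with n E1 E2 E3 E4 hn
  rw [← ha, ← hb] at E1
  have hn' : (0 : ℝ) < n := by exact_mod_cast hn
  obtain ⟨M0, M1, K, p0, p1, pk, s1, s2, s3, s4, s5, s6, s7⟩ := sizes n a b α δ ha0 hα h3 hδp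
  have q0 : (0 : ℝ) < M0 := by exact_mod_cast p0
  have q1 : (0 : ℝ) < M1 := by exact_mod_cast p1
  have qk : (0 : ℝ) < K := by exact_mod_cast pk
  have qk1 : (1 : ℝ) ≤ K := by exact_mod_cast pk
  have hlogK0 : 0 ≤ Real.log K := Real.log_nonneg qk1
  have hexp : ∀ x : ℝ, Real.exp (n * (Real.log 2 * x)) = (2 : ℝ) ^ ((n : ℝ) * x) := by
    intro x
    rw [Real.rpow_def_of_pos two_pos]
    congr 1; ring
  -- nonempty input alphabet
  have hWne : Nonempty W := by
    by_contra h
    rw [not_nonempty_iff] at h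
    have := hτ.2
    simp at this
  have hUne : Nonempty U := by
    by_contra h
    rw [not_nonempty_iff] at h
    have := hσ.2 hWne.some
    simp at this
  have hXne : Nonempty X := by
    by_contra h
    rw [not_nonempty_iff] at h
    have := hρ.2 hUne.some
    simp at this
  set G : ℝ := ((n : ℝ) + 1) ^ Fintype.card (W × U × X × Z) *
      (M0 * M1 * K * (2 / K + (1 + 8 * Real.log K) *
        Real.exp (-(n * (Real.log 2 * α - Real.log 2 * δ - Real.log 2 * (9 * δ)))))) with hG
  have hGpos : 0 < G := by positivity
  have hsec := sec_total hn p0 p1 pk τ σ ρ q hτ hσ hρ hq (Real.log 2 * a)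
    (Real.log 2 * (a + b)) (Real.log 2 * (9 * δ)) (Real.log 2 * α - Real.log 2 * δ) δ'
    (by positivity) (by rw [hexp]; exact s1) (by rw [← mul_sub, hexp]; exact s4) hnear
  rw [← hG] at hsec
  have hT := nfold_channel ht n
  have hQ := nfold_channel hq n
  have hσn := nfold_channel hσ n
  have hle : δ0 / 8 + ((M1 * K : ℝ) - 1) * (2 : ℝ) ^ (-((n : ℝ) * (b - δ))) +
      ((M0 * M1 * K : ℝ) - 1) * (2 : ℝ) ^ (-((n : ℝ) * (a + b - δ))) ≤ δ0 / 4 := by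
    have t1 := mul_le_mul_of_nonneg_right s6
      (Real.rpow_pos_of_pos (two_pos : (0 : ℝ) < 2) (-((n : ℝ) * (b - δ)))).le
    have t2 := mul_le_mul_of_nonneg_right s7
      (Real.rpow_pos_of_pos (two_pos : (0 : ℝ) < 2) (-((n : ℝ) * (a + b - δ)))).le
    rw [← Real.rpow_add two_pos] at t1 t2
    have e1 : (n : ℝ) * (b - 3 * δ) + -((n : ℝ) * (b - δ)) = -((n : ℝ) * (2 * δ)) := by ring
    have e2 : (n : ℝ) * (a + b - 3 * δ) + -((n : ℝ) * (a + b - δ)) = -((n : ℝ) * (2 * δ)) := by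
      ring
    rw [e1] at t1
    rw [e2] at t2
    linarith
  obtain ⟨f, φ, hf, hφ, herr, hatt⟩ := oneshot p0 p1 pk (fun w : Fin n → W => ∏ l, τ (w l))
    (nfold σ n) (fun w => Finset.prod_nonneg fun l _ => hτ.1 _) (sum_prod_one τ hτ.2 n)
    hσn.1 hσn.2 (fenc n τ σ ρ δ') (fenc_nonneg n τ σ ρ δ' hρ) (fenc_sum n τ σ ρ δ' hρ)
    (fun _ => hXne.some) (nfold t n) (nfold q n) hT hQ
    (Dreg n τ σ (comp t ρ) (a + b - δ) (b - δ)) (gzf n τ σ ρ q δ')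
    (fun θ z w u => gzf_nonneg n τ σ ρ q δ' hρ hq θ z w u)
    (fun w u z => gzf_sum n τ σ ρ q δ' hρ hq w u z)
    (δ0 / 8) ((2 : ℝ) ^ (-((n : ℝ) * (b - δ)))) ((2 : ℝ) ^ (-((n : ℝ) * (a + b - δ)))) (δ0 / 4) G
    (Real.rpow_pos_of_pos two_pos _).le (Real.rpow_pos_of_pos two_pos _).le (by positivity) hGpos
    E1 (same_bound n t ht τ σ ρ δ' _ _ hρ hσ hτ) (diff_bound n t ht τ σ ρ δ' _ _ hρ hσ hτ)
    hle hsec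
  refine ⟨M0 * M1, K, f, φ, Nat.mul_pos p0 p1, pk, hf, hφ, ?_, s2, ?_, ?_⟩
  · have e : (n : ℝ) * (r - δ0) ≤ (n : ℝ) * (a + b - α - 6 * δ) + -((n : ℝ) * δ) := by
      rw [← mul_neg, ← mul_add]
      exact mul_le_mul_of_nonneg_left (by rw [hδ]; linarith) hn'.le
    refine (Real.rpow_le_rpow_of_exponent_le one_le_two e).trans ?_
    rw [Real.rpow_add two_pos]
    have := mul_le_mul s5 E4 (Real.rpow_pos_of_pos two_pos _).le (by positivity)
    push_cast
    linarith
  · unfold roundError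
    refine lt_of_le_of_lt herr ?_
    linarith
  · intro ψ hψ
    refine (hatt ψ hψ).trans ?_
    have hlogK : Real.log K ≤ n * α := by
      have := Real.log_le_log qk s2
      rw [Real.log_rpow two_pos] at this
      have h2 : Real.log 2 ≤ 1 := by have := Real.log_two_lt_d9; linarith
      have h3 : 0 ≤ n * α := by positivity
      have h5 := mul_le_mul_of_nonneg_left h2 h3
      linarith
    have e1 : Real.exp (-(n * (Real.log 2 * α - Real.log 2 * δ - Real.log 2 * (9 * δ)))) =
        (2 : ℝ) ^ ((n : ℝ) * -(α - 10 * δ)) := by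
      rw [← hexp]; congr 1; ring
    set g := (2 : ℝ) ^ ((n : ℝ) * -(α - 10 * δ)) with hg
    have hg0 : 0 < g := Real.rpow_pos_of_pos two_pos _
    have hKi : 1 / (K : ℝ) ≤ 2 * g := by
      rw [div_le_iff₀ qk]
      have h4 : (1 : ℝ) ≤ g * (2 : ℝ) ^ ((n : ℝ) * (α - 3 * δ)) := by
        rw [hg, rpow_add_n]
        exact Real.one_le_rpow one_le_two (mul_nonneg hn'.le (by linarith))
      have h5 := mul_le_mul_of_nonneg_left s3 hg0.le
      linarith
    set N := ((n : ℝ) + 1) ^ Fintype.card (W × U × X × Z) with hN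
    have hN0 : 0 < N := by positivity
    have e2 : 2 * G / ((M0 * M1 : ℕ) * (K : ℝ)) = 2 * N * (2 * (1 / K) + (1 + 8 * Real.log K) * g) := by
      rw [hG, e1]
      push_cast
      field_simp
    rw [e2]
    have e3 : (2 : ℝ) ^ (-(n : ℝ) * (α - δ0)) = g * (2 : ℝ) ^ ((n : ℝ) * (10 * δ)) := by
      rw [hg, rpow_add_n]
      congr 1
      rw [hδ]; ring
    rw [e3]
    have t1 : 2 * (1 / (K : ℝ)) + (1 + 8 * Real.log K) * g ≤ (5 + 8 * (n * α)) * g := by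
      have := mul_le_mul_of_nonneg_right hlogK hg0.le
      linarith
    calc 1 / (K : ℝ) + 2 * N * (2 * (1 / K) + (1 + 8 * Real.log K) * g)
        ≤ 2 * g + 2 * N * ((5 + 8 * (n * α)) * g) :=
          add_le_add hKi (mul_le_mul_of_nonneg_left t1 (by positivity))
      _ = g * (2 + 2 * N * (5 + 8 * (n * α))) := by ring
      _ ≤ g * (2 : ℝ) ^ ((n : ℝ) * δ) := mul_le_mul_of_nonneg_left E2 hg0.le
      _ ≤ _ := mul_le_mul_of_nonneg_left (rpow_mono_n n (by linarith)) hg0.le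

end Good


set_option linter.unusedSectionVars false

/-! ### From one-round codes to the capacity region -/

section Final

variable {X Y Z : Type*} [Fintype X] [Fintype Y] [Fintype Z]

/-- The decoder that always rejects. -/
def rejectDec {A : Type*} (M : ℕ) : A → Option (Fin M) → ℝ :=
  fun _ o => if o = none then 1 else 0

lemma rejectDec_channel {A : Type*} (M : ℕ) : IsChannel (rejectDec (A := A) M) := by
  refine ⟨fun a b => ?_, fun a => ?_⟩
  · unfold rejectDec; split_ifs <;> norm_num
  · simp [rejectDec]

lemma attackProb_reject {n M K j : ℕ} (q : X → Z → ℝ)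
    (f : Fin j → Fin M × Fin K → (Fin n → X) → ℝ)
    (φ : Fin j → (Fin n → Y) × Fin K → Option (Fin M) → ℝ) (i : Fin j)
    (hφ : φ i = rejectDec M)
    (ψ : (Fin (i.1 + 1) → Fin n → Z) → (Fin n → Y) → ℝ) :
    attackProb q f φ i ψ = 0 := by
  unfold attackProb
  rw [hφ]
  simp [rejectDec]

lemma attackProb_zero {n M K j : ℕ} (hj : 0 < j) (q : X → Z → ℝ)
    (f : Fin j → Fin M × Fin K → (Fin n → X) → ℝ)
    (φ : Fin j → (Fin n → Y) × Fin K → Option (Fin M) → ℝ)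
    (ψ : (Fin (0 + 1) → Fin n → Z) → (Fin n → Y) → ℝ) :
    attackProb q f φ ⟨0, hj⟩ ψ =
      ∑ z : Fin n → Z, ∑ m, ∑ k,
        ((1 / (M * (K : ℝ))) * (∑ x, nfold q n x z * f ⟨0, hj⟩ (m, k) x)) *
          ∑ y, ψ (fun _ => z) y *
            ∑ m' ∈ Finset.univ.erase m, φ ⟨0, hj⟩ (y, k) (some m') := by
  unfold attackProb
  refine Fintype.sum_equiv (Equiv.funUnique (Fin 1) (Fin n → Z)) _ _ ?_
  intro z
  have hz : (fun _ => z 0) = z := by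
    funext i; rw [Subsingleton.elim (0 : Fin 1) i]
  refine Finset.sum_congr rfl fun m _ => Finset.sum_congr rfl fun k _ => ?_
  have e : (Equiv.funUnique (Fin 1) (Fin n → Z)) z = z 0 := rfl
  rw [e, hz]
  congr 1
  unfold advDist
  simp

lemma aa_of_single {j n M K : ℕ} (hj : 1 ≤ j) (t : X → Y → ℝ) (q : X → Z → ℝ)
    (r α κ ε : ℝ) (f : Fin M × Fin K → (Fin n → X) → ℝ)
    (φ : (Fin n → Y) × Fin K → Option (Fin M) → ℝ)
    (hM : 0 < M) (hK : 0 < K) (hf : IsChannel f) (hφ : IsChannel φ)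
    (hr : (2 : ℝ) ^ ((n : ℝ) * r) ≤ M)
    (hκ : (K : ℝ) ≤ (2 : ℝ) ^ ((n : ℝ) * (j : ℝ) * κ))
    (he : roundError t f φ < ε)
    (ha : ∀ ψ : (Fin n → Z) → (Fin n → Y) → ℝ, IsChannel ψ →
        ∑ z, ∑ m, ∑ k, ((1 / (M * (K : ℝ))) * (∑ x, nfold q n x z * f (m, k) x)) *
          ∑ y, ψ z y * ∑ m' ∈ Finset.univ.erase m, φ (y, k) (some m') ≤
        (2 : ℝ) ^ (-(n : ℝ) * α)) :
    IsAACode t q r α κ ε j n := by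
  refine ⟨M, K, fun _ => f, fun i => if i.1 = 0 then φ else rejectDec M, hM, hK,
    fun _ => hf, fun i => ?_, hr, hκ, ⟨⟨0, hj⟩, by simpa using he⟩, ?_⟩
  · dsimp only
    split_ifs
    · exact hφ
    · exact rejectDec_channel M
  · rintro ⟨i, hi⟩ ψ hψ
    rcases i with _ | i
    · have h := attackProb_zero (M := M) (K := K) hi q (fun _ => f)
        (fun i => if i.1 = 0 then φ else rejectDec M) ψ
      refine h.le.trans ?_
      have := ha (fun z => ψ fun _ => z) ⟨fun a b => hψ.1 _ b, fun a => hψ.2 _⟩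
      simpa using this
    · rw [attackProb_reject _ _ _ _ (by simp)]
      exact (Real.rpow_pos_of_pos two_pos _).le

lemma aa_mono {j n : ℕ} (t : X → Y → ℝ) (q : X → Z → ℝ) {r α κ δ δ' : ℝ} (h : δ ≤ δ')
    (hc : IsAACode t q (r - δ) (α - δ) κ δ j n) :
    IsAACode t q (r - δ') (α - δ') κ δ' j n := by
  obtain ⟨M, K, f, φ, hM, hK, hf, hφ, hr, hκ, ⟨i, hi⟩, ha⟩ := hc
  have hn : (0 : ℝ) ≤ n := Nat.cast_nonneg n
  refine ⟨M, K, f, φ, hM, hK, hf, hφ, le_trans ?_ hr, hκ, ⟨i, hi.trans_le h⟩, ?_⟩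
  · refine Real.rpow_le_rpow_of_exponent_le one_le_two (mul_le_mul_of_nonneg_left ?_ hn)
    linarith
  · intro i ψ hψ
    refine (ha i ψ hψ).trans (Real.rpow_le_rpow_of_exponent_le one_le_two ?_)
    have := mul_le_mul_of_nonneg_left h hn
    linarith

lemma aa_trivial {j n : ℕ} (hj : 1 ≤ j) [Nonempty X] (t : X → Y → ℝ) (q : X → Z → ℝ)
    {r α κ : ℝ} (hr : 0 ≤ r) (hκ : 0 ≤ κ) :
    IsAACode t q (r - (r + 2)) (α - (r + 2)) κ (r + 2) j n := by
  classical
  obtain ⟨x0⟩ := (inferInstance : Nonempty X)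
  refine aa_of_single (M := 1) (K := 1) hj t q _ _ _ _
    (fun _ x => if x = fun _ => x0 then 1 else 0) (rejectDec 1) one_pos one_pos ?_
    (rejectDec_channel 1) ?_ ?_ ?_ ?_
  · refine ⟨fun a b => ?_, fun a => ?_⟩
    · dsimp only; split_ifs <;> norm_num
    · simp
  · push_cast
    refine Real.rpow_le_one_of_one_le_of_nonpos one_le_two ?_
    have hn : (0 : ℝ) ≤ n := Nat.cast_nonneg n
    nlinarith
  · push_cast
    exact Real.one_le_rpow one_le_two (by positivity)
  · simp [roundError, rejectDec]
    linarith
  · intro ψ _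
    simp only [rejectDec, reduceCtorEq, if_false, Finset.sum_const_zero, mul_zero]
    exact (Real.rpow_pos_of_pos two_pos _).le

lemma diagonal (P : ℝ → ℕ → Prop) (hmono : ∀ δ δ' n, δ ≤ δ' → P δ n → P δ' n)
    (D : ℝ) (hD : 0 < D) (hPD : ∀ n, P D n)
    (hev : ∀ δ, 0 < δ → ∀ᶠ n in Filter.atTop, P δ n) :
    ∃ d : ℕ → ℝ, (∀ n, P (d n) n) ∧ Filter.Tendsto d Filter.atTop (nhds 0) := by
  set s : ℕ → ℝ := fun n => sInf {δ | 0 < δ ∧ P δ n} with hs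
  have hbd : ∀ n, BddBelow {δ | 0 < δ ∧ P δ n} := fun n => ⟨0, fun x hx => hx.1.le⟩
  have hne : ∀ n, {δ | 0 < δ ∧ P δ n}.Nonempty := fun n => ⟨D, hD, hPD n⟩
  have hs0 : ∀ n, 0 ≤ s n := fun n => le_csInf (hne n) fun x hx => hx.1.le
  have hst : Filter.Tendsto s Filter.atTop (nhds 0) := by
    rw [Metric.tendsto_atTop']
    intro ε hε
    obtain ⟨N, hN⟩ := Filter.eventually_atTop.1 (hev (ε / 2) (half_pos hε))
    refine ⟨N, fun n hn => ?_⟩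
    have := csInf_le (hbd n) (show ε / 2 ∈ _ from ⟨half_pos hε, hN n (le_of_lt hn)⟩)
    rw [Real.dist_eq, sub_zero, abs_of_nonneg (hs0 n)]
    exact lt_of_le_of_lt this (by linarith)
  refine ⟨fun n => s n + 1 / ((n : ℝ) + 1), fun n => ?_, ?_⟩
  · have hp : (0 : ℝ) < 1 / ((n : ℝ) + 1) := by positivity
    obtain ⟨δ, hδ, hlt⟩ := exists_lt_of_csInf_lt (hne n)
      (show s n < s n + 1 / ((n : ℝ) + 1) by linarith)
    exact hmono _ _ _ hlt.le hδ.2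
  · simpa using hst.add tendsto_one_div_add_atTop_nhds_zero_nat

lemma nonempty_of_channels {U W : Type*} [Fintype U] [Fintype W]
    {ρ : U → X → ℝ} {σ : W → U → ℝ} {τ : W → ℝ}
    (hρ : IsChannel ρ) (hσ : IsChannel σ) (hτ : IsDist τ) : Nonempty X := by
  by_contra hX
  rw [not_nonempty_iff] at hX
  rcases isEmpty_or_nonempty W with hW | ⟨⟨w⟩⟩
  · have := hτ.2; simp at this
  rcases isEmpty_or_nonempty U with hU | ⟨⟨u⟩⟩
  · have := hσ.2 w; simp at this
  · have := hρ.2 u; simp at this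

end Final

/-- **Theorem 1** (inner bound via secure transmission of the key).  If there
are finite sets `U`, `W` and distributions `ρ ∈ P(X|U)`, `σ ∈ P(U ≫ W)`,
`τ ∈ P(W)` such that the nonnegative reals `(r, α, κ)` satisfy
`r + α ≤ I(tρ, στ)`, `α ≤ L(t,q|ρ,σ,τ)`, `α ≤ I(tρ, σ|τ)` and `α ≤ jκ`,
then `(r, α, κ) ∈ C_{AA(j)}(t, q)`. -/
theorem inner_bound_secure_key
    {U W : Type*} [Fintype U] [Fintype W]
    (t : X → Y → ℝ) (q : X → Z → ℝ) (ht : IsChannel t) (hq : IsChannel q)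
    (j : ℕ) (hj : 1 ≤ j)
    (ρ : U → X → ℝ) (σ : W → U → ℝ) (τ : W → ℝ)
    (hρ : IsChannel ρ) (hσ : IsChannel σ) (hσ' : Deterministic σ)
    (hτ : IsDist τ)
    (r α κ : ℝ) (hr : 0 ≤ r) (hα : 0 ≤ α) (hκ : 0 ≤ κ)
    (h1 : r + α ≤ mutInfo (comp t ρ) (marg σ τ))
    (h2 : α ≤ Lfun t q ρ σ τ)
    (h3 : α ≤ condMutInfo (comp t ρ) σ τ)
    (h4 : α ≤ (j : ℝ) * κ) :
    InCapRegion t q j r α κ := by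
  haveI : Nonempty X := nonempty_of_channels hρ hσ hτ
  obtain ⟨d, hd, hd0⟩ := diagonal
    (fun δ n => IsAACode t q (r - δ) (α - δ) κ δ j n)
    (fun δ δ' n h hc => aa_mono t q h hc) (r + 2) (by linarith)
    (fun n => aa_trivial hj t q hr hκ)
    (by
      intro δ hδ
      filter_upwards [good_code t q ht hq ρ σ τ hρ hσ hσ' hτ r α hα h1 h2 h3 δ hδ] with n hn
      obtain ⟨M, K, f, φ, hM, hK, hf, hφ, hrM, hKα, he, ha⟩ := hn
      refine aa_of_single hj t q _ _ _ _ f φ hM hK hf hφ hrM (hKα.trans ?_) he ha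
      refine Real.rpow_le_rpow_of_exponent_le one_le_two ?_
      rw [mul_assoc]
      exact mul_le_mul_of_nonneg_left h4 (Nat.cast_nonneg n))
  refine ⟨fun n => r - d n, fun n => α - d n, fun _ => κ, d, hd, ?_⟩
  have e1 : Filter.Tendsto (fun n => r - d n) Filter.atTop (nhds r) := by
    simpa using tendsto_const_nhds.sub hd0
  have e2 : Filter.Tendsto (fun n => α - d n) Filter.atTop (nhds α) := by
    simpa using tendsto_const_nhds.sub hd0
  exact e1.prodMk_nhds (e2.prodMk_nhds (tendsto_const_nhds.prodMk_nhds hd0))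

end AuthAvg
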